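/- For every integer d ≥ 0 there exists ε > 0 with the following property. Let v₀ : ℝ² → ℝ be of class C^{d+8} with Σ_{|l| ≤ d+8} ‖(1+|x₁|+|x₂|)·∂^l_x v₀‖_{L¹∩L∞} ≤ ε, and set u₀(x₁,x₂) = u_s(x₁,x₂,0) + v₀(x₁,x₂). Then for every λ ∈ ℂ∖{0,κ₁,κ₂} there exists a unique continuous bounded function m₀(·,·,λ) : ℝ² → ℂ such that (−∂_{x₂} + ∂²_{x₁} + 2λ∂_{x₁} + u₀(x₁,x₂))·m₀(x₁,x₂,λ) = 0 in the sense of distributions and m₀(x₁,x₂,λ) − χ(x₁,x₂,0,λ) → 0 as x₁² + x₂² → ∞. -/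

import Mathlib

open Complex MeasureTheory
open scoped ENNReal NNReal

noncomputable section

/-- Partial derivative in the first coordinate of `ℝ²`. -/
def pd1 {E : Type*} [NormedAddCommGroup E] [NormedSpace ℝ E]
    (f : ℝ × ℝ → E) (x : ℝ × ℝ) : E :=
  deriv (fun t => f (t, x.2)) x.1

/-- Partial derivative in the second coordinate of `ℝ²`. -/
def pd2 {E : Type*} [NormedAddCommGroup E] [NormedSpace ℝ E]
    (f : ℝ × ℝ → E) (x : ℝ × ℝ) : E :=
  deriv (fun t => f (x.1, t)) x.2

/-- Iterated partial derivative `∂^l_x = ∂_{x₁}^{l₁}∂_{x₂}^{l₂}`. -/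
def pdIter {E : Type*} [NormedAddCommGroup E] [NormedSpace ℝ E]
    (l : ℕ × ℕ) (f : ℝ × ℝ → E) : ℝ × ℝ → E :=
  pd1^[l.1] (pd2^[l.2] f)

/-- The weighted `L¹ ∩ L∞` norm `‖(1+|x₁|+|x₂|)f‖_{L¹} + ‖(1+|x₁|+|x₂|)f‖_{L∞}`. -/
def wL1Linf (f : ℝ × ℝ → ℝ) : ℝ≥0∞ :=
  eLpNorm (fun x : ℝ × ℝ => (1 + |x.1| + |x.2|) * f x) 1 volume
    + eLpNorm (fun x : ℝ × ℝ => (1 + |x.1| + |x.2|) * f x) ⊤ volume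

/-- `θⱼ(x) = κⱼx₁ + κⱼ²x₂` (at `x₃ = 0`). -/
def theta (κ : ℝ) (x : ℝ × ℝ) : ℝ := κ * x.1 + κ ^ 2 * x.2

/-- `τ(x) = e^{θ₁(x)} + a e^{θ₂(x)}` (at `x₃ = 0`). -/
def tau (κ₁ κ₂ a : ℝ) (x : ℝ × ℝ) : ℝ :=
  Real.exp (theta κ₁ x) + a * Real.exp (theta κ₂ x)

/-- The `Gr(1,2)_{>0}` KP line soliton `u_s = 2∂²_{x₁} ln τ` (at `x₃ = 0`). -/
def us (κ₁ κ₂ a : ℝ) (x : ℝ × ℝ) : ℝ :=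
  2 * pd1 (pd1 (fun y => Real.log (tau κ₁ κ₂ a y))) x

/-- The Sato normalized eigenfunction (at `x₃ = 0`). -/
def chi (κ₁ κ₂ a : ℝ) (x : ℝ × ℝ) (lam : ℂ) : ℂ :=
  ((1 - (κ₁ : ℂ) / lam) * Real.exp (theta κ₁ x)
    + (1 - (κ₂ : ℂ) / lam) * (a : ℂ) * Real.exp (theta κ₂ x)) / (tau κ₁ κ₂ a x : ℂ)

/-- `m` solves `(−∂_{x₂} + ∂²_{x₁} + 2λ∂_{x₁} + u₀)m = 0` in the sense of
distributions. -/
def IsDistribLaxSol (u₀ : ℝ × ℝ → ℝ) (lam : ℂ) (m : ℝ × ℝ → ℂ) : Prop :=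
  ∀ φ : ℝ × ℝ → ℂ, ContDiff ℝ (⊤ : ℕ∞) φ → HasCompactSupport φ →
    ∫ x : ℝ × ℝ,
      m x * (pd2 φ x + pd1 (pd1 φ) x - 2 * lam * pd1 φ x + (u₀ x : ℂ) * φ x) = 0

section Part1

/-! ### Calculus of the partial derivatives -/

abbrev Sm (f : ℝ × ℝ → ℂ) : Prop := ContDiff ℝ (⊤ : ℕ∞) f

lemma Sm.diff {f : ℝ × ℝ → ℂ} (hf : Sm f) : Differentiable ℝ f :=
  hf.differentiable (by simp)

lemma slice1_hasDerivAt {f : ℝ × ℝ → ℂ} (hf : Sm f) (x : ℝ × ℝ) :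
    HasDerivAt (fun t => f (t, x.2)) (fderiv ℝ f x (1, 0)) x.1 := by
  have h1 : HasFDerivAt f (fderiv ℝ f x) (x.1, x.2) := (hf.diff x).hasFDerivAt
  have h2 : HasDerivAt (fun t : ℝ => (t, x.2)) ((1 : ℝ), (0 : ℝ)) x.1 :=
    (hasDerivAt_id x.1).prodMk (hasDerivAt_const x.1 x.2)
  exact h1.comp_hasDerivAt x.1 h2

lemma slice2_hasDerivAt {f : ℝ × ℝ → ℂ} (hf : Sm f) (x : ℝ × ℝ) :
    HasDerivAt (fun t => f (x.1, t)) (fderiv ℝ f x (0, 1)) x.2 := by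
  have h1 : HasFDerivAt f (fderiv ℝ f x) (x.1, x.2) := (hf.diff x).hasFDerivAt
  have h2 : HasDerivAt (fun t : ℝ => (x.1, t)) ((0 : ℝ), (1 : ℝ)) x.2 :=
    (hasDerivAt_const x.2 x.1).prodMk (hasDerivAt_id x.2)
  exact h1.comp_hasDerivAt x.2 h2

lemma pd1_eq_fderiv {f : ℝ × ℝ → ℂ} (hf : Sm f) : pd1 f = fun x => fderiv ℝ f x (1, 0) :=
  funext fun x => (slice1_hasDerivAt hf x).deriv

lemma pd2_eq_fderiv {f : ℝ × ℝ → ℂ} (hf : Sm f) : pd2 f = fun x => fderiv ℝ f x (0, 1) :=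
  funext fun x => (slice2_hasDerivAt hf x).deriv

lemma Sm.hd1 {f : ℝ × ℝ → ℂ} (hf : Sm f) (x : ℝ × ℝ) :
    HasDerivAt (fun t => f (t, x.2)) (pd1 f x) x.1 := by
  rw [pd1_eq_fderiv hf]; exact slice1_hasDerivAt hf x

lemma Sm.hd2 {f : ℝ × ℝ → ℂ} (hf : Sm f) (x : ℝ × ℝ) :
    HasDerivAt (fun t => f (x.1, t)) (pd2 f x) x.2 := by
  rw [pd2_eq_fderiv hf]; exact slice2_hasDerivAt hf x

lemma Sm.pd1 {f : ℝ × ℝ → ℂ} (hf : Sm f) : Sm (pd1 f) := by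
  rw [pd1_eq_fderiv hf]
  exact (hf.fderiv_right (m := (⊤ : ℕ∞)) (by simp)).clm_apply contDiff_const

lemma Sm.pd2 {f : ℝ × ℝ → ℂ} (hf : Sm f) : Sm (pd2 f) := by
  rw [pd2_eq_fderiv hf]
  exact (hf.fderiv_right (m := (⊤ : ℕ∞)) (by simp)).clm_apply contDiff_const

lemma hcs_pd1 {f : ℝ × ℝ → ℂ} (hf : Sm f) (h : HasCompactSupport f) :
    HasCompactSupport (pd1 f) := by
  rw [pd1_eq_fderiv hf]
  exact (h.fderiv (𝕜 := ℝ)).comp_left (g := fun L : ℝ × ℝ →L[ℝ] ℂ => L (1, 0)) rfl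

lemma hcs_pd2 {f : ℝ × ℝ → ℂ} (hf : Sm f) (h : HasCompactSupport f) :
    HasCompactSupport (pd2 f) := by
  rw [pd2_eq_fderiv hf]
  exact (h.fderiv (𝕜 := ℝ)).comp_left (g := fun L : ℝ × ℝ →L[ℝ] ℂ => L (0, 1)) rfl

lemma pd1_mul {f g : ℝ × ℝ → ℂ} (hf : Sm f) (hg : Sm g) :
    pd1 (fun x => f x * g x) = fun x => pd1 f x * g x + f x * pd1 g x :=
  funext fun x => ((hf.hd1 x).mul (hg.hd1 x)).deriv

lemma pd2_mul {f g : ℝ × ℝ → ℂ} (hf : Sm f) (hg : Sm g) :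
    pd2 (fun x => f x * g x) = fun x => pd2 f x * g x + f x * pd2 g x :=
  funext fun x => ((hf.hd2 x).mul (hg.hd2 x)).deriv

lemma pd1_add {f g : ℝ × ℝ → ℂ} (hf : Sm f) (hg : Sm g) :
    pd1 (fun x => f x + g x) = fun x => pd1 f x + pd1 g x :=
  funext fun x => ((hf.hd1 x).add (hg.hd1 x)).deriv

lemma pd2_add {f g : ℝ × ℝ → ℂ} (hf : Sm f) (hg : Sm g) :
    pd2 (fun x => f x + g x) = fun x => pd2 f x + pd2 g x :=
  funext fun x => ((hf.hd2 x).add (hg.hd2 x)).deriv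

lemma pd1_sub {f g : ℝ × ℝ → ℂ} (hf : Sm f) (hg : Sm g) :
    pd1 (fun x => f x - g x) = fun x => pd1 f x - pd1 g x :=
  funext fun x => ((hf.hd1 x).sub (hg.hd1 x)).deriv

/-- slices of smooth compactly supported functions -/
lemma slice1_cs {f : ℝ × ℝ → ℂ} (hf : Sm f) (h : HasCompactSupport f) (t : ℝ) :
    ContDiff ℝ (⊤ : ℕ∞) (fun y => f (y, t)) ∧ HasCompactSupport (fun y => f (y, t)) := by
  constructor
  · exact hf.comp (contDiff_id.prodMk contDiff_const)
  · exact h.comp_isClosedEmbedding (Topology.IsClosedEmbedding.of_continuous_injective_isClosedMap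
      (by fun_prop) (fun a b hab => by simpa using hab)
      ((isClosedMap_prodMk_right t)))

lemma slice2_cs {f : ℝ × ℝ → ℂ} (hf : Sm f) (h : HasCompactSupport f) (y : ℝ) :
    ContDiff ℝ (⊤ : ℕ∞) (fun t => f (y, t)) ∧ HasCompactSupport (fun t => f (y, t)) := by
  constructor
  · exact hf.comp (contDiff_const.prodMk contDiff_id)
  · exact h.comp_isClosedEmbedding (Topology.IsClosedEmbedding.of_continuous_injective_isClosedMap
      (by fun_prop) (fun a b hab => by simpa using hab)
      ((isClosedMap_prodMk_left y)))

lemma halfset_gt (t' : ℝ) : {x : ℝ × ℝ | t' < x.2} = Set.univ ×ˢ Set.Ioi t' := by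
  ext x; simp
lemma halfset_le (t' : ℝ) : {x : ℝ × ℝ | x.2 ≤ t'} = Set.univ ×ˢ Set.Iic t' := by
  ext x; simp

lemma Sm.int {f : ℝ × ℝ → ℂ} (hf : Sm f) (h : HasCompactSupport f) : Integrable f :=
  hf.continuous.integrable_of_hasCompactSupport h

lemma cs_integral_deriv {f : ℝ → ℂ} (hf : ContDiff ℝ (⊤ : ℕ∞) f) (h : HasCompactSupport f) :
    ∫ y, deriv f y = 0 := by
  have h1 := h.integral_Ioi_deriv_eq (hf.of_le (by simp)) 0
  have h2 := h.integral_Iic_deriv_eq (hf.of_le (by simp)) 0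
  have hi : Integrable (deriv f) :=
    (hf.continuous_deriv (by simp)).integrable_of_hasCompactSupport h.deriv
  rw [← intervalIntegral.integral_Iic_add_Ioi (b := 0) hi.integrableOn hi.integrableOn, h1, h2]
  ring

lemma int_pd1_strip {ρ : ℝ × ℝ → ℂ} (hρ : Sm ρ) (hc : HasCompactSupport ρ) (s : Set ℝ) :
    ∫ x in Set.univ ×ˢ s, pd1 ρ x = 0 := by
  have hi : Integrable (pd1 ρ) := hρ.pd1.int (hcs_pd1 hρ hc)
  have := hi.integrableOn (s := Set.univ ×ˢ s)
  rw [Measure.volume_eq_prod] at this ⊢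
  rw [IntegrableOn, ← Measure.prod_restrict] at this
  rw [← Measure.prod_restrict, integral_prod_symm _ this]
  simp only [Measure.restrict_univ]
  refine integral_eq_zero_of_ae (Filter.Eventually.of_forall fun t => ?_)
  exact cs_integral_deriv (slice1_cs hρ hc t).1 (slice1_cs hρ hc t).2

lemma int_pd2_gt {ρ : ℝ × ℝ → ℂ} (hρ : Sm ρ) (hc : HasCompactSupport ρ) (t' : ℝ) :
    ∫ x in {x : ℝ × ℝ | t' < x.2}, pd2 ρ x = - ∫ y, ρ (y, t') := by
  have hi : Integrable (pd2 ρ) := hρ.pd2.int (hcs_pd2 hρ hc)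
  rw [halfset_gt]
  have := hi.integrableOn (s := Set.univ ×ˢ Set.Ioi t')
  rw [Measure.volume_eq_prod] at this ⊢
  rw [setIntegral_prod _ this, ← integral_neg]
  simp only [Measure.restrict_univ]
  refine integral_congr_ae (Filter.Eventually.of_forall fun y => ?_)
  exact (slice2_cs hρ hc y).2.integral_Ioi_deriv_eq ((slice2_cs hρ hc y).1.of_le (by simp)) t'

lemma int_pd2_le {ρ : ℝ × ℝ → ℂ} (hρ : Sm ρ) (hc : HasCompactSupport ρ) (t' : ℝ) :
    ∫ x in {x : ℝ × ℝ | x.2 ≤ t'}, pd2 ρ x = ∫ y, ρ (y, t') := by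
  have hi : Integrable (pd2 ρ) := hρ.pd2.int (hcs_pd2 hρ hc)
  rw [halfset_le]
  have := hi.integrableOn (s := Set.univ ×ˢ Set.Iic t')
  rw [Measure.volume_eq_prod] at this ⊢
  rw [setIntegral_prod _ this]
  simp only [Measure.restrict_univ]
  refine integral_congr_ae (Filter.Eventually.of_forall fun y => ?_)
  exact (slice2_cs hρ hc y).2.integral_Iic_deriv_eq ((slice2_cs hρ hc y).1.of_le (by simp)) t'

/-- The formal adjoint `∂_t + ∂_y² + b² + U`. -/
def Hs (b : ℝ) (U : ℝ × ℝ → ℝ) (φ : ℝ × ℝ → ℂ) (x : ℝ × ℝ) : ℂ :=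
  pd2 φ x + pd1 (pd1 φ) x + ((b ^ 2 + U x : ℝ) : ℂ) * φ x

/-- classical solutions of `-∂_t E + ∂_y² E + (b²+U) E = 0` -/
def ClSol (b : ℝ) (U : ℝ × ℝ → ℝ) (E : ℝ × ℝ → ℂ) : Prop :=
  ∀ x, pd2 E x = pd1 (pd1 E) x + ((b ^ 2 + U x : ℝ) : ℂ) * E x

lemma Hs_divergence {b : ℝ} {U : ℝ × ℝ → ℝ} {E φ : ℝ × ℝ → ℂ} (hE : Sm E) (hφ : Sm φ)
    (h : ClSol b U E) (x : ℝ × ℝ) :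
    E x * Hs b U φ x = pd2 (fun x => E x * φ x) x
      + pd1 (fun x => E x * pd1 φ x - pd1 E x * φ x) x := by
  rw [pd2_mul hE hφ, pd1_sub (hE.mul hφ.pd1) (hE.pd1.mul hφ), pd1_mul hE hφ.pd1,
    pd1_mul hE.pd1 hφ]
  simp only [Hs, h x]
  ring

lemma weak_gt {b : ℝ} {U : ℝ × ℝ → ℝ} {E φ : ℝ × ℝ → ℂ} (hE : Sm E) (hφ : Sm φ)
    (hc : HasCompactSupport φ) (h : ClSol b U E) (t' : ℝ) :
    ∫ x in {x : ℝ × ℝ | t' < x.2}, E x * Hs b U φ x = - ∫ y, E (y, t') * φ (y, t') := by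
  have h1 : Sm (fun x => E x * φ x) := hE.mul hφ
  have c1 : HasCompactSupport (fun x => E x * φ x) := hc.mul_left
  have h2 : Sm (fun x => E x * pd1 φ x - pd1 E x * φ x) := (hE.mul hφ.pd1).sub (hE.pd1.mul hφ)
  have c2 : HasCompactSupport (fun x => E x * pd1 φ x - pd1 E x * φ x) :=
    ((hcs_pd1 hφ hc).mul_left).sub hc.mul_left
  simp_rw [Hs_divergence hE hφ h]
  rw [integral_add (h1.pd2.int (hcs_pd2 h1 c1)).integrableOn
    (h2.pd1.int (hcs_pd1 h2 c2)).integrableOn, int_pd2_gt h1 c1, halfset_gt, int_pd1_strip h2 c2,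
    add_zero]

lemma weak_le {b : ℝ} {U : ℝ × ℝ → ℝ} {E φ : ℝ × ℝ → ℂ} (hE : Sm E) (hφ : Sm φ)
    (hc : HasCompactSupport φ) (h : ClSol b U E) (t' : ℝ) :
    ∫ x in {x : ℝ × ℝ | x.2 ≤ t'}, E x * Hs b U φ x = ∫ y, E (y, t') * φ (y, t') := by
  have h1 : Sm (fun x => E x * φ x) := hE.mul hφ
  have c1 : HasCompactSupport (fun x => E x * φ x) := hc.mul_left
  have h2 : Sm (fun x => E x * pd1 φ x - pd1 E x * φ x) := (hE.mul hφ.pd1).sub (hE.pd1.mul hφ)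
  have c2 : HasCompactSupport (fun x => E x * pd1 φ x - pd1 E x * φ x) :=
    ((hcs_pd1 hφ hc).mul_left).sub hc.mul_left
  simp_rw [Hs_divergence hE hφ h]
  rw [integral_add (h1.pd2.int (hcs_pd2 h1 c1)).integrableOn
    (h2.pd1.int (hcs_pd1 h2 c2)).integrableOn, int_pd2_le h1 c1, halfset_le, int_pd1_strip h2 c2,
    add_zero]

lemma Hs_cont {b : ℝ} {U : ℝ × ℝ → ℝ} (hU : Continuous U) {φ : ℝ × ℝ → ℂ} (hφ : Sm φ) :
    Continuous (Hs b U φ) := by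
  have h1 := hφ.pd2.continuous
  have h2 := hφ.pd1.pd1.continuous
  have h3 := hφ.continuous
  unfold Hs
  fun_prop

lemma Hs_cs {b : ℝ} {U : ℝ × ℝ → ℝ} {φ : ℝ × ℝ → ℂ} (hφ : Sm φ)
    (hc : HasCompactSupport φ) : HasCompactSupport (Hs b U φ) := by
  unfold Hs
  exact ((hcs_pd2 hφ hc).add (hcs_pd1 hφ.pd1 (hcs_pd1 hφ hc))).add hc.mul_left

lemma weak_all {b : ℝ} {U : ℝ × ℝ → ℝ} (hU : Continuous U) {E φ : ℝ × ℝ → ℂ} (hE : Sm E)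
    (hφ : Sm φ) (hc : HasCompactSupport φ) (h : ClSol b U E) :
    ∫ x, E x * Hs b U φ x = 0 := by
  have hi : Integrable (fun x => E x * Hs b U φ x) :=
    (hE.continuous.mul (Hs_cont hU hφ)).integrable_of_hasCompactSupport (Hs_cs hφ hc).mul_left
  have hms : MeasurableSet {x : ℝ × ℝ | x.2 ≤ 0} := measurableSet_le measurable_snd measurable_const
  rw [← integral_add_compl hms hi, weak_le hE hφ hc h]
  have : {x : ℝ × ℝ | x.2 ≤ 0}ᶜ = {x : ℝ × ℝ | 0 < x.2} := by ext; simp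
  rw [this, weak_gt hE hφ hc h]; ring

end Part1

section Part2

/-! ### The soliton background -/

/-- the phase -/
def sgm (k1 k2 l : ℝ) (x : ℝ × ℝ) : ℝ := (k2 - k1) * x.1 + (k2 ^ 2 - k1 ^ 2) * x.2 + l

def qa (k1 k2 l : ℝ) (x : ℝ × ℝ) : ℝ := (1 + Real.exp (sgm k1 k2 l x))⁻¹
def qb (k1 k2 l : ℝ) (x : ℝ × ℝ) : ℝ := Real.exp (sgm k1 k2 l x) * (1 + Real.exp (sgm k1 k2 l x))⁻¹

/-- soliton potential -/
def uu (k1 k2 l : ℝ) (x : ℝ × ℝ) : ℝ := 2 * (k2 - k1) ^ 2 * (qa k1 k2 l x * qb k1 k2 l x)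

section
variable (k1 k2 l : ℝ)

lemma opos (x : ℝ × ℝ) : 0 < 1 + Real.exp (sgm k1 k2 l x) := by positivity

lemma qa_pos (x : ℝ × ℝ) : 0 < qa k1 k2 l x := inv_pos.2 (opos k1 k2 l x)
lemma qb_pos (x : ℝ × ℝ) : 0 < qb k1 k2 l x := mul_pos (Real.exp_pos _) (inv_pos.2 (opos k1 k2 l x))
lemma q_add (x : ℝ × ℝ) : qa k1 k2 l x + qb k1 k2 l x = 1 := by
  have := opos k1 k2 l x
  unfold qa qb; field_simp
lemma qa_le (x : ℝ × ℝ) : qa k1 k2 l x ≤ 1 := by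
  have := q_add k1 k2 l x; have := qb_pos k1 k2 l x; linarith
lemma qb_le (x : ℝ × ℝ) : qb k1 k2 l x ≤ 1 := by
  have := q_add k1 k2 l x; have := qa_pos k1 k2 l x; linarith
lemma qb_eq (x : ℝ × ℝ) : qb k1 k2 l x = Real.exp (sgm k1 k2 l x) * qa k1 k2 l x := rfl

lemma sgm_cd : ContDiff ℝ (⊤ : ℕ∞) (sgm k1 k2 l) := by unfold sgm; fun_prop
lemma qa_cd : ContDiff ℝ (⊤ : ℕ∞) (qa k1 k2 l) := by
  unfold qa
  exact (contDiff_const.add (sgm_cd k1 k2 l).exp).inv fun x => (opos k1 k2 l x).ne'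
lemma qb_cd : ContDiff ℝ (⊤ : ℕ∞) (qb k1 k2 l) := (sgm_cd k1 k2 l).exp.mul (qa_cd k1 k2 l)
lemma qa_cont : Continuous (qa k1 k2 l) := (qa_cd k1 k2 l).continuous
lemma qb_cont : Continuous (qb k1 k2 l) := (qb_cd k1 k2 l).continuous
lemma uu_cont : Continuous (uu k1 k2 l) := by
  have := qa_cont k1 k2 l; have := qb_cont k1 k2 l
  unfold uu; fun_prop

lemma ofReal_sm {f : ℝ × ℝ → ℝ} (hf : ContDiff ℝ (⊤ : ℕ∞) f) : Sm (fun x => (f x : ℂ)) :=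
  Complex.ofRealCLM.contDiff.comp hf
lemma qa_sm : Sm (fun x => (qa k1 k2 l x : ℂ)) := ofReal_sm (qa_cd k1 k2 l)
lemma qb_sm : Sm (fun x => (qb k1 k2 l x : ℂ)) := ofReal_sm (qb_cd k1 k2 l)

lemma inv_exp_deriv {f : ℝ → ℝ} {f' y : ℝ} (hf : HasDerivAt f f' y) :
    HasDerivAt (fun y => (1 + Real.exp (f y))⁻¹)
      (-f' * ((1 + Real.exp (f y))⁻¹ * (Real.exp (f y) * (1 + Real.exp (f y))⁻¹))) y := by
  have h : (0:ℝ) < 1 + Real.exp (f y) := by positivity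
  have := (hf.exp.const_add 1).inv h.ne'
  exact this.congr_deriv (by field_simp)

lemma qa_d1 (x : ℝ × ℝ) : HasDerivAt (fun y => qa k1 k2 l (y, x.2))
    (-(k2 - k1) * (qa k1 k2 l x * qb k1 k2 l x)) x.1 := by
  have : HasDerivAt (fun y => sgm k1 k2 l (y, x.2)) (k2 - k1) x.1 := by
    exact ((((hasDerivAt_id x.1).const_mul (k2 - k1)).add_const ((k2 ^ 2 - k1 ^ 2) * x.2)).add_const l).congr_deriv
      (by ring)
  exact inv_exp_deriv this
lemma qa_d2 (x : ℝ × ℝ) : HasDerivAt (fun y => qa k1 k2 l (x.1, y))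
    (-(k2 ^ 2 - k1 ^ 2) * (qa k1 k2 l x * qb k1 k2 l x)) x.2 := by
  have : HasDerivAt (fun y => sgm k1 k2 l (x.1, y)) (k2 ^ 2 - k1 ^ 2) x.2 := by
    exact ((((hasDerivAt_id x.2).const_mul (k2 ^ 2 - k1 ^ 2)).const_add ((k2 - k1) * x.1)).add_const l).congr_deriv
      (by ring)
  exact inv_exp_deriv this
lemma qb_fun : qb k1 k2 l = fun x => 1 - qa k1 k2 l x := by
  ext x; have := q_add k1 k2 l x; linarith
lemma qb_d1 (x : ℝ × ℝ) : HasDerivAt (fun y => qb k1 k2 l (y, x.2))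
    ((k2 - k1) * (qa k1 k2 l x * qb k1 k2 l x)) x.1 := by
  have := (qa_d1 k1 k2 l x).const_sub 1
  conv => enter [1, y]; rw [qb_fun]
  exact this.congr_deriv (by ring)
lemma qb_d2 (x : ℝ × ℝ) : HasDerivAt (fun y => qb k1 k2 l (x.1, y))
    ((k2 ^ 2 - k1 ^ 2) * (qa k1 k2 l x * qb k1 k2 l x)) x.2 := by
  have := (qa_d2 k1 k2 l x).const_sub 1
  conv => enter [1, y]; rw [qb_fun]
  exact this.congr_deriv (by ring)

lemma qa_pd1 : pd1 (fun x => (qa k1 k2 l x : ℂ)) =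
    fun x => (-(k2 - k1) * (qa k1 k2 l x * qb k1 k2 l x) : ℂ) :=
  funext fun x => by
    have := (qa_d1 k1 k2 l x).ofReal_comp.deriv
    push_cast at this; exact this
lemma qa_pd2 : pd2 (fun x => (qa k1 k2 l x : ℂ)) =
    fun x => (-(k2 ^ 2 - k1 ^ 2) * (qa k1 k2 l x * qb k1 k2 l x) : ℂ) :=
  funext fun x => by
    have := (qa_d2 k1 k2 l x).ofReal_comp.deriv
    push_cast at this; exact this
lemma qb_pd1 : pd1 (fun x => (qb k1 k2 l x : ℂ)) =
    fun x => ((k2 - k1) * (qa k1 k2 l x * qb k1 k2 l x) : ℂ) :=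
  funext fun x => by
    have := (qb_d1 k1 k2 l x).ofReal_comp.deriv
    push_cast at this; exact this
lemma qb_pd2 : pd2 (fun x => (qb k1 k2 l x : ℂ)) =
    fun x => ((k2 ^ 2 - k1 ^ 2) * (qa k1 k2 l x * qb k1 k2 l x) : ℂ) :=
  funext fun x => by
    have := (qb_d2 k1 k2 l x).ofReal_comp.deriv
    push_cast at this; exact this

lemma clsol_gen (b ν t' : ℝ) (g1 g1' g2 g2' : ℝ → ℂ)
    (s1 : ContDiff ℝ (⊤ : ℕ∞) g1) (s1' : ContDiff ℝ (⊤ : ℕ∞) g1')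
    (s2 : ContDiff ℝ (⊤ : ℕ∞) g2) (s2' : ContDiff ℝ (⊤ : ℕ∞) g2')
    (d1 : ∀ y, HasDerivAt g1 (g1' y) y) (d1' : ∀ y, HasDerivAt g1' (ν * g1 y) y)
    (d2 : ∀ y, HasDerivAt g2 (g2' y) y) (d2' : ∀ y, HasDerivAt g2' (ν * g2 y) y)
    (hm : ∀ y, g1' y - k2 * g1 y = g2' y - k1 * g2 y) :
    Sm (fun x => (qa k1 k2 l x * g1 x.1 + qb k1 k2 l x * g2 x.1)
        * (Real.exp ((ν + b ^ 2) * (x.2 - t')) : ℂ)) ∧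
    ClSol b (uu k1 k2 l) (fun x => (qa k1 k2 l x * g1 x.1 + qb k1 k2 l x * g2 x.1)
        * (Real.exp ((ν + b ^ 2) * (x.2 - t')) : ℂ)) := by
  have A := qa_sm k1 k2 l
  have B := qb_sm k1 k2 l
  have S1 : Sm (fun x => g1 x.1) := s1.comp contDiff_fst
  have S2 : Sm (fun x => g2 x.1) := s2.comp contDiff_fst
  have S1' : Sm (fun x => g1' x.1) := s1'.comp contDiff_fst
  have S2' : Sm (fun x => g2' x.1) := s2'.comp contDiff_fst
  have SE : Sm (fun x => (Real.exp ((ν + b ^ 2) * (x.2 - t')) : ℂ)) :=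
    ofReal_sm (f := fun x => Real.exp ((ν + b ^ 2) * (x.2 - t'))) (by fun_prop)
  have F : Sm (fun x => qa k1 k2 l x * g1 x.1 + qb k1 k2 l x * g2 x.1) := (A.mul S1).add (B.mul S2)
  have P1 : pd1 (fun x : ℝ × ℝ => g1 x.1) = fun x => g1' x.1 := funext fun x => (d1 x.1).deriv
  have P2 : pd1 (fun x : ℝ × ℝ => g2 x.1) = fun x => g2' x.1 := funext fun x => (d2 x.1).deriv
  have P1' : pd1 (fun x : ℝ × ℝ => g1' x.1) = fun x => ν * g1 x.1 := funext fun x => (d1' x.1).deriv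
  have P2' : pd1 (fun x : ℝ × ℝ => g2' x.1) = fun x => ν * g2 x.1 := funext fun x => (d2' x.1).deriv
  have Q1 : pd2 (fun x : ℝ × ℝ => g1 x.1) = fun x => 0 := funext fun x => by simp [pd1, pd2]
  have Q2 : pd2 (fun x : ℝ × ℝ => g2 x.1) = fun x => 0 := funext fun x => by simp [pd1, pd2]
  have E1 : pd1 (fun x : ℝ × ℝ => (Real.exp ((ν + b ^ 2) * (x.2 - t')) : ℂ)) = fun x => 0 :=
    funext fun x => by simp [pd1, pd2]
  have E2 : pd2 (fun x : ℝ × ℝ => (Real.exp ((ν + b ^ 2) * (x.2 - t')) : ℂ)) =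
      fun x => (ν + b ^ 2) * (Real.exp ((ν + b ^ 2) * (x.2 - t')) : ℂ) := funext fun x => by
    have : HasDerivAt (fun t => Real.exp ((ν + b ^ 2) * (t - t')))
        ((ν + b ^ 2) * Real.exp ((ν + b ^ 2) * (x.2 - t'))) x.2 := by
      have := (((hasDerivAt_id x.2).sub_const t').const_mul (ν + b ^ 2)).exp
      simp only [id] at this
      convert this using 1; ring
    have := this.ofReal_comp.deriv
    push_cast at this
    simpa [pd2] using this
  have QQ : Sm (fun x => (qa k1 k2 l x * qb k1 k2 l x : ℂ)) := A.mul B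
  have C0 : Sm (fun x : ℝ × ℝ => (-(k2 - k1) : ℂ)) := contDiff_const
  have C1 : Sm (fun x : ℝ × ℝ => (k2 - k1 : ℂ)) := contDiff_const
  have C0p : pd1 (fun x : ℝ × ℝ => (-(k2 - k1) : ℂ)) = fun x => 0 := funext fun x => by simp [pd1, pd2]
  have C1p : pd1 (fun x : ℝ × ℝ => (k2 - k1 : ℂ)) = fun x => 0 := funext fun x => by simp [pd1, pd2]
  refine ⟨F.mul SE, fun x => ?_⟩
  have D1 : pd1 (fun x => (qa k1 k2 l x * g1 x.1 + qb k1 k2 l x * g2 x.1)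
        * (Real.exp ((ν + b ^ 2) * (x.2 - t')) : ℂ)) =
      fun x => (-(k2 - k1) * (qa k1 k2 l x * qb k1 k2 l x) * g1 x.1 + qa k1 k2 l x * g1' x.1
        + ((k2 - k1) * (qa k1 k2 l x * qb k1 k2 l x) * g2 x.1 + qb k1 k2 l x * g2' x.1))
        * (Real.exp ((ν + b ^ 2) * (x.2 - t')) : ℂ) := by
    rw [pd1_mul F SE, pd1_add (A.mul S1) (B.mul S2), pd1_mul A S1, pd1_mul B S2, P1, P2,
      qa_pd1, qb_pd1, E1]
    ext x; ring
  rw [D1, pd1_mul ((((C0.mul QQ).mul S1).add (A.mul S1')).add (((C1.mul QQ).mul S2).add (B.mul S2'))) SE,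
    pd1_add (((C0.mul QQ).mul S1).add (A.mul S1')) (((C1.mul QQ).mul S2).add (B.mul S2')),
    pd1_add ((C0.mul QQ).mul S1) (A.mul S1'), pd1_add ((C1.mul QQ).mul S2) (B.mul S2'),
    pd1_mul (C0.mul QQ) S1, pd1_mul (C1.mul QQ) S2, pd1_mul C0 QQ, pd1_mul C1 QQ, pd1_mul A B,
    pd1_mul A S1', pd1_mul B S2', P1', P2', P1, P2, qa_pd1, qb_pd1, E1, C0p, C1p]
  rw [pd2_mul F SE, pd2_add (A.mul S1) (B.mul S2), pd2_mul A S1, pd2_mul B S2, Q1, Q2,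
      qa_pd2, qb_pd2, E2]
  have hq : (qb k1 k2 l x : ℂ) = 1 - qa k1 k2 l x := by
    rw [qb_fun]; push_cast; ring
  have hm' : g1' x.1 = g2' x.1 - k1 * g2 x.1 + k2 * g1 x.1 := by linear_combination hm x.1
  simp only [uu]
  push_cast
  rw [hm', hq]
  ring
end

end Part2

section Part3

/-! ### Explicit classical solutions -/

def Sk (k s Y : ℝ) : ℝ := (s * Real.sin (s * Y) - k * Real.cos (s * Y)) / (s ^ 2 + k ^ 2)

lemma sk_den {s : ℝ} (hs : s ≠ 0) (k : ℝ) : s ^ 2 + k ^ 2 ≠ 0 := by positivity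

lemma cosd (s Y : ℝ) : HasDerivAt (fun Y => Real.cos (s * Y)) (-s * Real.sin (s * Y)) Y := by
  have := ((hasDerivAt_id Y).const_mul s).cos
  exact this.congr_deriv (by simp; ring)
lemma sind (s Y : ℝ) : HasDerivAt (fun Y => Real.sin (s * Y)) (s * Real.cos (s * Y)) Y := by
  have := ((hasDerivAt_id Y).const_mul s).sin
  exact this.congr_deriv (by simp; ring)

lemma Sk_d {s : ℝ} (hs : s ≠ 0) (k Y : ℝ) :
    HasDerivAt (fun Y => Sk k s Y) (k * Sk k s Y + Real.cos (s * Y)) Y := by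
  have h := sk_den hs k
  have := (((sind s Y).const_mul s).sub ((cosd s Y).const_mul k)).div_const (s ^ 2 + k ^ 2)
  exact this.congr_deriv (by unfold Sk; field_simp; ring)

def Es (k1 k2 l b s : ℝ) (x' x : ℝ × ℝ) : ℝ :=
  (Real.cos (s * (x.1 - x'.1)) + (k2 - k1) * (qa k1 k2 l x * qb k1 k2 l x' * Sk k2 s (x.1 - x'.1)
    - qb k1 k2 l x * qa k1 k2 l x' * Sk k1 s (x.1 - x'.1))) * Real.exp (-(s ^ 2 - b ^ 2) * (x.2 - x'.2))

lemma Es_sol (k1 k2 l b : ℝ) {s : ℝ} (hs : s ≠ 0) (x' : ℝ × ℝ) :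
    Sm (fun x => (Es k1 k2 l b s x' x : ℂ)) ∧
      ClSol b (uu k1 k2 l) (fun x => (Es k1 k2 l b s x' x : ℂ)) := by
  set y' := x'.1
  set A := qa k1 k2 l x'
  set B := qb k1 k2 l x'
  have hAB : A + B = 1 := q_add k1 k2 l x'
  let G (k d : ℝ) (Y : ℝ) : ℝ := Real.cos (s * (Y - y')) + d * Sk k s (Y - y')
  let G' (k d : ℝ) (Y : ℝ) : ℝ := -s * Real.sin (s * (Y - y'))
      + d * (k * Sk k s (Y - y') + Real.cos (s * (Y - y')))
  have hG : ∀ k d, ContDiff ℝ (⊤ : ℕ∞) (G k d) := by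
    intro k d
    simp only [G, Sk]
    fun_prop
  have hG' : ∀ k d, ContDiff ℝ (⊤ : ℕ∞) (G' k d) := by
    intro k d
    simp only [G', Sk]
    fun_prop
  have dG : ∀ k d y, HasDerivAt (fun y => (G k d y : ℂ)) (G' k d y : ℂ) y := by
    intro k d y
    have := ((cosd s (y - y')).add ((Sk_d hs k (y - y')).const_mul d)).comp_sub_const y y'
    exact this.ofReal_comp
  have dG' : ∀ k d y, HasDerivAt (fun y => (G' k d y : ℂ)) (((-s ^ 2 : ℝ) : ℂ) * (G k d y : ℂ)) y := by
    intro k d y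
    have := (((sind s (y - y')).const_mul (-s)).add ((((Sk_d hs k (y - y')).const_mul k).add
      (cosd s (y - y'))).const_mul d)).comp_sub_const y y'
    have h2 := this.ofReal_comp
    refine h2.congr_deriv ?_
    rw [← Complex.ofReal_mul]
    congr 1
    simp only [G, Sk]
    have := sk_den hs k
    field_simp
    ring
  have key := clsol_gen k1 k2 l b (-s ^ 2) x'.2 (fun y => (G k2 ((k2 - k1) * B) y : ℂ))
    (fun y => (G' k2 ((k2 - k1) * B) y : ℂ)) (fun y => (G k1 (-(k2 - k1) * A) y : ℂ))
    (fun y => (G' k1 (-(k2 - k1) * A) y : ℂ)) (Complex.ofRealCLM.contDiff.comp (hG _ _))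
    (Complex.ofRealCLM.contDiff.comp (hG' _ _)) (Complex.ofRealCLM.contDiff.comp (hG _ _))
    (Complex.ofRealCLM.contDiff.comp (hG' _ _)) (dG _ _) (dG' _ _) (dG _ _) (dG' _ _)
    (by
      intro y
      norm_cast
      simp only [G, G']
      have : A = 1 - B := by linarith
      rw [this]
      ring)
  have e : (fun x => (Es k1 k2 l b s x' x : ℂ)) = (fun x => (qa k1 k2 l x * (G k2 ((k2 - k1) * B) x.1 : ℂ)
      + qb k1 k2 l x * (G k1 (-(k2 - k1) * A) x.1 : ℂ))
        * (Real.exp ((-s ^ 2 + b ^ 2) * (x.2 - x'.2)) : ℂ)) := by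
    ext x
    norm_cast
    simp only [Es, G]
    have : qb k1 k2 l x = 1 - qa k1 k2 l x := by rw [qb_fun]
    rw [this, show -(s ^ 2 - b ^ 2) = -s ^ 2 + b ^ 2 by ring]
    ring
  rw [e]
  exact key

/-- conjugated Sato eigenfunction -/
def ch0 (k1 k2 l β : ℝ) (lam : ℂ) (x : ℝ × ℝ) : ℂ :=
  Complex.exp (I * β * x.1) * ((I * β - k1) * qa k1 k2 l x + (I * β - k2) * qb k1 k2 l x) / lam

lemma cexpd (z : ℂ) (y : ℝ) : HasDerivAt (fun y : ℝ => Complex.exp (z * y)) (z * Complex.exp (z * y)) y := by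
  have := (((hasDerivAt_id y).ofReal_comp).const_mul z).cexp
  simp only [id, ofReal_one] at this
  exact this.congr_deriv (by ring)

lemma cexp_cd (z : ℂ) : ContDiff ℝ (⊤ : ℕ∞) (fun y : ℝ => Complex.exp (z * y)) :=
  (contDiff_const.mul Complex.ofRealCLM.contDiff).cexp

lemma ch0_sol (k1 k2 l β b : ℝ) (hb : b ^ 2 = β ^ 2) (lam : ℂ) :
    Sm (ch0 k1 k2 l β lam) ∧ ClSol b (uu k1 k2 l) (ch0 k1 k2 l β lam) := by
  have dd : ∀ (w : ℂ) (y : ℝ), HasDerivAt (fun y : ℝ => w * Complex.exp (I * β * y))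
      (w * (I * β) * Complex.exp (I * β * y)) y := fun w y =>
    ((cexpd (I * β) y).const_mul w).congr_deriv (by ring)
  have cc : ∀ w : ℂ, ContDiff ℝ (⊤ : ℕ∞) (fun y : ℝ => w * Complex.exp (I * β * y)) := fun w =>
    contDiff_const.mul (cexp_cd _)
  have key := clsol_gen k1 k2 l b (-β ^ 2) 0 _ _ _ _ (cc ((I * β - k1) / lam))
    (cc ((I * β - k1) / lam * (I * β))) (cc ((I * β - k2) / lam)) (cc ((I * β - k2) / lam * (I * β)))
    (dd _) (fun y => (dd _ y).congr_deriv (by push_cast; linear_combination (β ^ 2 * ((I * β - k1) / lam) * Complex.exp (I * β * y) : ℂ) * I_sq))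
    (dd _) (fun y => (dd _ y).congr_deriv (by push_cast; linear_combination (β ^ 2 * ((I * β - k2) / lam) * Complex.exp (I * β * y) : ℂ) * I_sq))
    (by intro y; ring)
  have e : ch0 k1 k2 l β lam = fun x => (qa k1 k2 l x * ((I * β - k1) / lam * Complex.exp (I * β * x.1))
      + qb k1 k2 l x * ((I * β - k2) / lam * Complex.exp (I * β * x.1)))
        * (Real.exp ((-β ^ 2 + b ^ 2) * (x.2 - 0)) : ℂ) := by
    ext x
    rw [hb]
    simp [ch0]
    ring
  rw [e]
  exact key

lemma ch0_bdd (k1 k2 l β : ℝ) (lam : ℂ) : ∃ B : ℝ, ∀ x, ‖ch0 k1 k2 l β lam x‖ ≤ B := by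
  refine ⟨(‖I * β - k1‖ + ‖I * β - k2‖) / ‖lam‖, fun x => ?_⟩
  unfold ch0
  rw [norm_div, norm_mul]
  have : ‖Complex.exp (I * β * x.1)‖ = 1 := by
    rw [Complex.norm_exp]; simp
  rw [this, one_mul]
  gcongr
  refine (norm_add_le _ _).trans ?_
  rw [norm_mul, norm_mul, Complex.norm_real, Complex.norm_real,
    Real.norm_of_nonneg (qa_pos _ _ _ _).le, Real.norm_of_nonneg (qb_pos _ _ _ _).le]
  have h1 := qa_le k1 k2 l x
  have h2 := qb_le k1 k2 l x
  exact add_le_add (mul_le_of_le_one_right (norm_nonneg _) h1) (mul_le_of_le_one_right (norm_nonneg _) ‹_›)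

/-- bound state -/
def Bs (k1 k2 l b : ℝ) (x : ℝ × ℝ) : ℝ := qb k1 k2 l x * Real.exp (k1 * x.1 + (k1 ^ 2 + b ^ 2) * x.2)

lemma Bs_sol (k1 k2 l b : ℝ) :
    Sm (fun x => (Bs k1 k2 l b x : ℂ)) ∧ ClSol b (uu k1 k2 l) (fun x => (Bs k1 k2 l b x : ℂ)) := by
  have key := clsol_gen k1 k2 l b (k1 ^ 2) 0 (fun _ => 0) (fun _ => 0) _ _ contDiff_const contDiff_const
    (cexp_cd k1) ((contDiff_const (c := (k1 : ℂ))).mul (cexp_cd k1))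
    (fun y => hasDerivAt_const _ _) (fun y => by simpa using hasDerivAt_const y (0:ℂ)) (cexpd k1)
    (fun y => ((cexpd k1 y).const_mul (k1 : ℂ)).congr_deriv (by push_cast; ring))
    (by intro y; simp)
  have e : (fun x => (Bs k1 k2 l b x : ℂ)) = (fun x => (qa k1 k2 l x * (0 : ℂ)
      + qb k1 k2 l x * (Complex.exp (k1 * x.1) : ℂ))
        * (Real.exp ((k1 ^ 2 + b ^ 2) * (x.2 - 0)) : ℂ)) := by
    ext x
    simp only [Bs, Real.exp_add]
    push_cast
    simp
    ring
  rw [e]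
  exact key

end Part3

section Part4

/-! ### Oscillatory integral estimates -/

lemma bv_lemma {h w w' : ℝ → ℝ} {p q M W V : ℝ} (hpq : p ≤ q) (hh : ContinuousOn h (Set.Icc p q))
    (hw : ∀ s ∈ Set.Icc p q, HasDerivAt w (w' s) s) (hw' : ContinuousOn w' (Set.Icc p q))
    (hM : ∀ r ∈ Set.Icc p q, |∫ s in p..r, h s| ≤ M) (hW : |w q| ≤ W)
    (hV : ∫ s in p..q, |w' s| ≤ V) :
    |∫ s in p..q, w s * h s| ≤ M * (W + V) := by
  have hM0 : 0 ≤ M := (abs_nonneg _).trans (hM p ⟨le_rfl, hpq⟩)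
  have hu : Set.uIcc p q = Set.Icc p q := Set.uIcc_of_le hpq
  have hhi : IntervalIntegrable h volume p q := (hu ▸ hh).intervalIntegrable
  have hwi : IntervalIntegrable w' volume p q := (hu ▸ hw').intervalIntegrable
  have hvc : ContinuousOn (fun r => ∫ s in p..r, h s) (Set.uIcc p q) :=
    intervalIntegral.continuousOn_primitive_interval' hhi Set.left_mem_uIcc
  have key := intervalIntegral.integral_mul_deriv_eq_deriv_mul_of_hasDerivAt (a := p) (b := q)
    (u := w) (u' := w') (v := fun r => ∫ s in p..r, h s) (v' := h)
    (fun x hx => (hw x (hu ▸ hx)).continuousAt.continuousWithinAt) hvc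
    (fun x hx => by
      rw [min_eq_left hpq, max_eq_right hpq] at hx
      exact hw x ⟨hx.1.le, hx.2.le⟩)
    (fun x hx => by
      rw [min_eq_left hpq, max_eq_right hpq] at hx
      refine intervalIntegral.integral_hasDerivAt_right (hhi.mono_set ?_) ?_ ?_
      · rw [hu, Set.uIcc_of_le hx.1.le]; exact Set.Icc_subset_Icc_right hx.2.le
      · exact (hh.mono Set.Ioo_subset_Icc_self).stronglyMeasurableAtFilter isOpen_Ioo x hx
      · exact hh.continuousAt (Icc_mem_nhds hx.1 hx.2)) hwi hhi
  rw [key]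
  simp only [intervalIntegral.integral_same, mul_zero, sub_zero]
  have h1 : |w q * ∫ s in p..q, h s| ≤ W * M := by
    rw [abs_mul]; exact mul_le_mul hW (hM q ⟨hpq, le_rfl⟩) (abs_nonneg _) ((abs_nonneg _).trans hW)
  have h2 : |∫ s in p..q, w' s * ∫ s' in p..s, h s'| ≤ V * M := by
    calc |∫ s in p..q, w' s * ∫ s' in p..s, h s'| ≤ ∫ s in p..q, |w' s * ∫ s' in p..s, h s'| :=
          intervalIntegral.abs_integral_le_integral_abs hpq
      _ ≤ ∫ s in p..q, |w' s| * M := by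
          refine intervalIntegral.integral_mono_on hpq ?_ ?_ ?_
          · exact ((hwi.mul_continuousOn hvc)).abs
          · exact hwi.abs.mul_const M
          · intro s hs
            rw [abs_mul]
            exact mul_le_mul_of_nonneg_left (hM s hs) (abs_nonneg _)
      _ = (∫ s in p..q, |w' s|) * M := by rw [intervalIntegral.integral_mul_const]
      _ ≤ V * M := mul_le_mul_of_nonneg_right hV hM0
  calc |w q * (∫ s in p..q, h s) - ∫ s in p..q, w' s * ∫ s' in p..s, h s'|
      ≤ |w q * (∫ s in p..q, h s)| + |∫ s in p..q, w' s * ∫ s' in p..s, h s'| := abs_sub _ _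
    _ ≤ M * (W + V) := by linarith

lemma mono_lemma {h w w' : ℝ → ℝ} {p q M : ℝ} (hpq : p ≤ q) (hh : ContinuousOn h (Set.Icc p q))
    (hw : ∀ s ∈ Set.Icc p q, HasDerivAt w (w' s) s) (hw' : ContinuousOn w' (Set.Icc p q))
    (hM : ∀ r ∈ Set.Icc p q, |∫ s in p..r, h s| ≤ M) (N : ℝ)
    (h0 : ∀ s ∈ Set.Icc p q, 0 ≤ w s) (h1 : ∀ s ∈ Set.Icc p q, w s ≤ N)
    (hs : (∀ s ∈ Set.Icc p q, 0 ≤ w' s) ∨ (∀ s ∈ Set.Icc p q, w' s ≤ 0)) :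
    |∫ s in p..q, w s * h s| ≤ 2 * N * M := by
  have hM0 : 0 ≤ M := (abs_nonneg _).trans (hM p ⟨le_rfl, hpq⟩)
  have hu : Set.uIcc p q = Set.Icc p q := Set.uIcc_of_le hpq
  have hwi : IntervalIntegrable w' volume p q := (hu ▸ hw').intervalIntegrable
  have hi : ∫ s in p..q, w' s = w q - w p :=
    intervalIntegral.integral_eq_sub_of_hasDerivAt (fun x hx => hw x (hu ▸ hx)) hwi
  have p1 := h0 p ⟨le_rfl, hpq⟩
  have p2 := h0 q ⟨hpq, le_rfl⟩
  have p3 := h1 p ⟨le_rfl, hpq⟩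
  have p4 := h1 q ⟨hpq, le_rfl⟩
  have hV : ∫ s in p..q, |w' s| ≤ N := by
    rcases hs with hs | hs
    · have : ∫ s in p..q, |w' s| = ∫ s in p..q, w' s :=
        intervalIntegral.integral_congr fun s hs' => abs_of_nonneg (hs s (hu ▸ hs'))
      rw [this, hi]; linarith
    · have : ∫ s in p..q, |w' s| = ∫ s in p..q, -w' s :=
        intervalIntegral.integral_congr fun s hs' => abs_of_nonpos (hs s (hu ▸ hs'))
      rw [this, intervalIntegral.integral_neg, hi]; linarith
  have := bv_lemma hpq hh hw hw' hM (W := N) (by rw [abs_of_nonneg p2]; exact p4) hV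
  linarith

lemma lim_Ioi {f : ℝ → ℝ} {a K : ℝ} (hf : IntegrableOn f (Set.Ioi a))
    (h : ∀ p q, a < p → p ≤ q → |∫ s in p..q, f s| ≤ K) : |∫ s in Set.Ioi a, f s| ≤ K := by
  have t1 : Filter.Tendsto (fun n : ℕ => a + 1 / ((n : ℝ) + 1)) Filter.atTop (nhds a) := by
    simpa using tendsto_one_div_add_atTop_nhds_zero_nat.const_add a
  have t2 : Filter.Tendsto (fun n : ℕ => a + 1 + (n : ℝ)) Filter.atTop Filter.atTop :=
    Filter.tendsto_atTop_add_const_left _ _ tendsto_natCast_atTop_atTop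
  have c1 : AECover (volume.restrict (Set.Ioi a)) Filter.atTop
      (fun n : ℕ => Set.Ioi (a + 1 / ((n : ℝ) + 1))) := aecover_Ioi_of_Ioi t1
  have c2 : AECover (volume.restrict (Set.Ioi a)) Filter.atTop
      (fun n : ℕ => Set.Iic (a + 1 + (n : ℝ))) := (aecover_Iic t2).restrict
  have := ((c1.inter c2).integral_tendsto_of_countably_generated hf).abs
  refine le_of_tendsto' this fun n => ?_
  have hp : 0 < 1 / ((n : ℝ) + 1) := by positivity
  have hle : a + 1 / ((n : ℝ) + 1) ≤ a + 1 + n := by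
    have : 1 / ((n : ℝ) + 1) ≤ 1 := by
      rw [div_le_one (by positivity)]; linarith [n.cast_nonneg (α := ℝ)]
    linarith [n.cast_nonneg (α := ℝ)]
  rw [Measure.restrict_restrict (measurableSet_Ioi.inter measurableSet_Iic), Set.Ioi_inter_Iic,
    Set.inter_eq_left.2 (fun s hs => by have := hs.1; simp only [Set.mem_Ioi]; linarith),
    ← intervalIntegral.integral_of_le hle]
  exact h _ _ (by linarith) hle

lemma lim_Ioc {f : ℝ → ℝ} {a b K : ℝ} (hK : 0 ≤ K) (hf : IntegrableOn f (Set.Ioc a b))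
    (h : ∀ p q, a < p → p ≤ q → q ≤ b → |∫ s in p..q, f s| ≤ K) : |∫ s in Set.Ioc a b, f s| ≤ K := by
  rcases le_or_gt b a with hab | hab
  · simpa [Set.Ioc_eq_empty (not_lt.2 hab)] using hK
  have t1 : Filter.Tendsto (fun n : ℕ => a + (b - a) * (1 / ((n : ℝ) + 1))) Filter.atTop (nhds a) := by
    simpa using (tendsto_one_div_add_atTop_nhds_zero_nat.const_mul (b - a)).const_add a
  have c1 : AECover (volume.restrict (Set.Ioc a b)) Filter.atTop
      (fun n : ℕ => Set.Ioc (a + (b - a) * (1 / ((n : ℝ) + 1))) b) :=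
    aecover_Ioc_of_Ioc t1 tendsto_const_nhds
  have := (c1.integral_tendsto_of_countably_generated hf).abs
  refine le_of_tendsto' this fun n => ?_
  have hp : 0 < 1 / ((n : ℝ) + 1) := by positivity
  have hp1 : 1 / ((n : ℝ) + 1) ≤ 1 := by
      rw [div_le_one (by positivity)]; linarith [n.cast_nonneg (α := ℝ)]
  have hba : 0 < b - a := by linarith
  have hp2 : 0 < (b - a) * (1 / ((n : ℝ) + 1)) := by positivity
  have hle : a + (b - a) * (1 / ((n : ℝ) + 1)) ≤ b := by nlinarith
  rw [Measure.restrict_restrict measurableSet_Ioc,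
    Set.inter_eq_left.2 (Set.Ioc_subset_Ioc_left (by linarith)),
    ← intervalIntegral.integral_of_le hle]
  exact h _ _ (by linarith) hle le_rfl

lemma cos_osc {Y : ℝ} (hY : Y ≠ 0) (p q : ℝ) : |∫ s in p..q, Real.cos (s * Y)| ≤ 2 / |Y| := by
  rw [intervalIntegral.integral_comp_mul_right _ hY, integral_cos, smul_eq_mul, abs_mul, abs_inv,
    div_eq_mul_inv, mul_comm]
  gcongr
  have h1 := Real.abs_sin_le_one (q * Y)
  have h2 := Real.abs_sin_le_one (p * Y)
  rw [abs_le] at *; constructor <;> linarith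

lemma sin_osc {Y : ℝ} (hY : Y ≠ 0) (p q : ℝ) : |∫ s in p..q, Real.sin (s * Y)| ≤ 2 / |Y| := by
  rw [intervalIntegral.integral_comp_mul_right _ hY, integral_sin, smul_eq_mul, abs_mul, abs_inv,
    div_eq_mul_inv, mul_comm]
  gcongr
  have h1 := Real.abs_cos_le_one (q * Y)
  have h2 := Real.abs_cos_le_one (p * Y)
  rw [abs_le] at *; constructor <;> linarith

/-- the sine integral -/
def Si (r : ℝ) : ℝ := ∫ s in 0..r, Real.sinc s

lemma sinc_tail {p r : ℝ} (hp : 0 < p) (hr : p ≤ r) : |∫ s in p..r, Real.sinc s| ≤ 4 / p := by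
  have e : ∫ s in p..r, Real.sinc s = ∫ s in p..r, s⁻¹ * Real.sin s := by
    refine intervalIntegral.integral_congr fun s hs => ?_
    rw [Set.uIcc_of_le hr] at hs
    simp only [Real.sinc_of_ne_zero (by linarith [hs.1] : s ≠ 0)]
    rw [div_eq_inv_mul]
  rw [e]
  have := mono_lemma (h := Real.sin) (w := fun s => s⁻¹) (w' := fun s => -(s ^ 2)⁻¹) (M := 2) hr
    Real.continuous_sin.continuousOn
    (fun s hs => hasDerivAt_inv (by linarith [hs.1]))
    (by
      refine ContinuousOn.neg (ContinuousOn.inv₀ (by fun_prop) fun s hs => ?_)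
      have : 0 < s := by linarith [hs.1]
      positivity)
    (fun r _ => by simpa using sin_osc one_ne_zero p r) p⁻¹
    (fun s hs => by have : 0 < s := by linarith [hs.1]
                    positivity)
    (fun s hs => inv_anti₀ hp hs.1)
    (Or.inr fun s hs => by simp only [Left.neg_nonpos_iff]; positivity)
  refine this.trans_eq ?_
  field_simp; norm_num

lemma Si_neg (r : ℝ) : Si (-r) = - Si r := by
  unfold Si
  have := intervalIntegral.integral_comp_neg (a := 0) (b := r) (f := Real.sinc)
  simp only [Real.sinc_neg, neg_zero] at this
  rw [this, intervalIntegral.integral_symm]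

lemma sinc_ii (a b : ℝ) : IntervalIntegrable Real.sinc volume a b :=
  Real.continuous_sinc.intervalIntegrable a b

lemma Si_bd_nonneg {r : ℝ} (hr : 0 ≤ r) : |Si r| ≤ 5 := by
  have h1 : ∀ r, 0 ≤ r → r ≤ 1 → |Si r| ≤ 1 := by
    intro r h0 h1
    have := intervalIntegral.norm_integral_le_of_norm_le_const (a := 0) (b := r) (f := Real.sinc) (C := 1)
      (fun s _ => by rw [Real.norm_eq_abs]; exact Real.abs_sinc_le_one s)
    rw [Real.norm_eq_abs] at this
    refine this.trans ?_
    rw [one_mul, sub_zero, abs_of_nonneg h0]; exact h1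
  rcases le_or_gt r 1 with h | h
  · linarith [h1 r hr h]
  · have := intervalIntegral.integral_add_adjacent_intervals (sinc_ii 0 1) (sinc_ii 1 r)
    have h2 := sinc_tail one_pos h.le
    have h3 := h1 1 zero_le_one le_rfl
    unfold Si at *
    rw [← this]
    refine (abs_add_le _ _).trans ?_
    norm_num at h2; linarith

lemma Si_bd (r : ℝ) : |Si r| ≤ 5 := by
  rcases le_total 0 r with h | h
  · exact Si_bd_nonneg h
  · have := Si_bd_nonneg (neg_nonneg.2 h)
    rwa [Si_neg, abs_neg] at this

lemma sinc_int (Y p q : ℝ) : ∫ s in p..q, Y * Real.sinc (s * Y) = Si (q * Y) - Si (p * Y) := by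
  rcases eq_or_ne Y 0 with rfl | hY
  · simp
  rw [intervalIntegral.integral_const_mul, intervalIntegral.integral_comp_mul_right _ hY, smul_eq_mul,
    ← mul_assoc, mul_inv_cancel₀ hY, one_mul, Si, Si,
    intervalIntegral.integral_interval_sub_left (sinc_ii _ _) (sinc_ii _ _)]

lemma sinc_osc (Y p q : ℝ) : |∫ s in p..q, Y * Real.sinc (s * Y)| ≤ 10 := by
  rw [sinc_int]
  have h1 := Si_bd (q * Y)
  have h2 := Si_bd (p * Y)
  rw [abs_le] at *; constructor <;> linarith

end Part4

section Part5

/-! ### The half-line spectral transforms -/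

def Preg (b t : ℝ) : Set ℝ := if 0 < t then Set.Ioi b else Set.Ioc 0 b

def PP (b : ℝ) (f : ℝ → ℝ) (t : ℝ) : ℝ :=
  Real.sign t / Real.pi * ∫ s in Preg b t, f s * Real.exp (-(s ^ 2 - b ^ 2) * t)

lemma Preg_pos {b t : ℝ} (ht : 0 < t) : Preg b t = Set.Ioi b := if_pos ht
lemma Preg_neg {b t : ℝ} (ht : t < 0) : Preg b t = Set.Ioc 0 b := if_neg (not_lt.2 ht.le)

lemma Preg_ms (b t : ℝ) : MeasurableSet (Preg b t) := by
  unfold Preg; split_ifs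
  · exact measurableSet_Ioi
  · exact measurableSet_Ioc

lemma reg_pos {b t s : ℝ} (hb : 0 ≤ b) (hs : s ∈ Preg b t) : 0 < s := by
  unfold Preg at hs; split_ifs at hs
  · exact hb.trans_lt hs
  · exact hs.1

lemma reg_exp {b t s : ℝ} (hb : 0 ≤ b) (hs : s ∈ Preg b t) :
    -(s ^ 2 - b ^ 2) * t ≤ -|t| * (s - b) ^ 2 := by
  unfold Preg at hs; split_ifs at hs with h
  · simp only [Set.mem_Ioi] at hs
    rw [abs_of_pos h]
    have : 0 ≤ t * (b * (s - b)) := by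
      have : 0 ≤ s - b := by linarith
      positivity
    nlinarith
  · have hs1 := hs.1
    have hs2 := hs.2
    rw [abs_of_nonpos (not_lt.1 h)]
    have : 0 ≤ (-t) * (s * (b - s)) :=
      mul_nonneg (by linarith) (mul_nonneg hs1.le (by linarith))
    nlinarith

lemma reg_exp' {b t s : ℝ} (hb : 0 ≤ b) (hs : s ∈ Preg b t) :
    -(s ^ 2 - b ^ 2) * t ≤ -(b * |t|) * |s - b| := by
  unfold Preg at hs; split_ifs at hs with h
  · simp only [Set.mem_Ioi] at hs
    rw [abs_of_pos h, abs_of_pos (by linarith : 0 < s - b)]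
    have : 0 ≤ t * (s * (s - b)) := by
      have : 0 ≤ s - b := by linarith
      have : 0 ≤ s := by linarith
      positivity
    nlinarith
  · have hs1 := hs.1
    have hs2 := hs.2
    rw [abs_of_nonpos (not_lt.1 h), abs_of_nonpos (by linarith : s - b ≤ 0)]
    have : 0 ≤ (-t) * (s * (b - s)) :=
      mul_nonneg (by linarith) (mul_nonneg hs1.le (by linarith))
    nlinarith

lemma gauss_int {t : ℝ} (ht : t ≠ 0) (b : ℝ) :
    Integrable (fun s : ℝ => Real.exp (-|t| * (s - b) ^ 2)) :=
  (integrable_exp_neg_mul_sq (abs_pos.2 ht)).comp_sub_right b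

lemma gauss_val (t b : ℝ) :
    ∫ s : ℝ, Real.exp (-|t| * (s - b) ^ 2) = √(Real.pi / |t|) := by
  rw [integral_sub_right_eq_self (fun s : ℝ => Real.exp (-|t| * s ^ 2)), integral_gaussian]

lemma sign_abs_le (t : ℝ) : |Real.sign t| ≤ 1 := by
  rcases Real.sign_apply_eq t with h | h | h <;> rw [h] <;> simp

lemma exp_contOn (b t : ℝ) (S : Set ℝ) :
    ContinuousOn (fun s : ℝ => Real.exp (-(s ^ 2 - b ^ 2) * t)) S := by fun_prop

lemma Preg_sub {b : ℝ} (hb : 0 ≤ b) (t : ℝ) : Preg b t ⊆ Set.Ioi 0 := fun _ hs => reg_pos hb hs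

lemma PP_meas {b t : ℝ} {f : ℝ → ℝ} (hb : 0 ≤ b) (hf : ContinuousOn f (Set.Ioi 0)) :
    AEStronglyMeasurable (fun s => f s * Real.exp (-(s ^ 2 - b ^ 2) * t))
      (volume.restrict (Preg b t)) :=
  ((hf.mono (Preg_sub hb t)).mul (exp_contOn b t _)).aestronglyMeasurable (Preg_ms b t)

lemma PP_int {b t C : ℝ} {f : ℝ → ℝ} (hb : 0 ≤ b) (ht : t ≠ 0) (hf : ContinuousOn f (Set.Ioi 0))
    (hC : ∀ s ∈ Preg b t, |f s| ≤ C) :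
    IntegrableOn (fun s => f s * Real.exp (-(s ^ 2 - b ^ 2) * t)) (Preg b t) := by
  refine Integrable.mono' ((gauss_int ht b).integrableOn.const_mul C) (PP_meas hb hf) ?_
  refine (ae_restrict_iff' (Preg_ms b t)).2 (Filter.Eventually.of_forall fun s hs => ?_)
  rw [norm_mul, Real.norm_eq_abs, Real.norm_of_nonneg (Real.exp_pos _).le]
  exact mul_le_mul (hC s hs) (Real.exp_le_exp.2 (reg_exp hb hs)) (Real.exp_pos _).le
    ((abs_nonneg _).trans (hC s hs))

lemma PP_abs_le {b t K : ℝ} {f : ℝ → ℝ} (hK : 0 ≤ K)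
    (h : t ≠ 0 → |∫ s in Preg b t, f s * Real.exp (-(s ^ 2 - b ^ 2) * t)| ≤ K) :
    |PP b f t| ≤ K / Real.pi := by
  rcases eq_or_ne t 0 with rfl | ht
  · simp only [PP, Real.sign_zero, zero_div, zero_mul, abs_zero]; positivity
  unfold PP
  rw [abs_mul, abs_div, abs_of_pos Real.pi_pos]
  have := h ht
  have h1 := sign_abs_le t
  calc |t.sign| / Real.pi * _ ≤ 1 / Real.pi * K := by gcongr
    _ = K / Real.pi := by ring

lemma PP_bd {b t C : ℝ} {f : ℝ → ℝ} (hb : 0 ≤ b) (hC0 : 0 ≤ C) (hC : ∀ s ∈ Preg b t, |f s| ≤ C) :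
    |PP b f t| ≤ C / √|t| := by
  rcases eq_or_ne t 0 with rfl | ht
  · simp [PP]
  have h1 : |PP b f t| ≤ (C * √(Real.pi / |t|)) / Real.pi := by
    refine PP_abs_le (by positivity) fun _ => ?_
    rw [← gauss_val t b, ← integral_const_mul]
    refine le_trans ?_ (setIntegral_le_integral (s := Preg b t) ((gauss_int ht b).const_mul C)
      (Filter.Eventually.of_forall fun s => by positivity))
    rw [← Real.norm_eq_abs]
    refine norm_integral_le_of_norm_le ((gauss_int ht b).integrableOn.const_mul C) ?_
    refine (ae_restrict_iff' (Preg_ms b t)).2 (Filter.Eventually.of_forall fun s hs => ?_)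
    rw [norm_mul, Real.norm_eq_abs, Real.norm_of_nonneg (Real.exp_pos _).le]
    exact mul_le_mul (hC s hs) (Real.exp_le_exp.2 (reg_exp hb hs)) (Real.exp_pos _).le hC0
  refine h1.trans ?_
  have hpi : √Real.pi ≤ Real.pi := by
    rw [Real.sqrt_le_left Real.pi_pos.le]; nlinarith [Real.pi_gt_three]
  have ht' : 0 < √|t| := Real.sqrt_pos.2 (abs_pos.2 ht)
  rw [Real.sqrt_div Real.pi_pos.le, mul_div_assoc]
  have : √Real.pi / Real.pi ≤ 1 := (div_le_one Real.pi_pos).2 hpi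
  calc C * (√Real.pi / √|t| / Real.pi) = (√Real.pi / Real.pi) * (C / √|t|) := by ring
    _ ≤ 1 * (C / √|t|) := by gcongr
    _ = _ := by rw [one_mul]

lemma exp_abs_int {a : ℝ} (ha : 0 < a) (b : ℝ) :
    Integrable (fun s : ℝ => Real.exp (-a * |s - b|)) ∧ ∫ s : ℝ, Real.exp (-a * |s - b|) = 2 / a := by
  have h0 : IntegrableOn (fun s : ℝ => Real.exp (-a * s)) (Set.Ioi 0) :=
    integrableOn_exp_mul_Ioi (by linarith) 0
  have h1 : IntegrableOn (fun s : ℝ => Real.exp (-a * |s|)) (Set.Ioi 0) :=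
    h0.congr_fun (fun s hs => by simp only [abs_of_pos (Set.mem_Ioi.1 hs)]) measurableSet_Ioi
  have h2 : Integrable (fun s : ℝ => Real.exp (-a * |s|)) := by
    rw [← integrableOn_univ, ← Set.Iic_union_Ioi (a := 0)]
    refine IntegrableOn.union ?_ h1
    exact (integrableOn_exp_mul_Iic ha 0).congr_fun (fun s hs => by
      simp only [abs_of_nonpos (Set.mem_Iic.1 hs)]; congr 1; ring) measurableSet_Iic
  constructor
  · exact h2.comp_sub_right b
  · rw [integral_sub_right_eq_self (fun s : ℝ => Real.exp (-a * |s|)),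
      integral_comp_abs (f := fun s => Real.exp (-a * s)), integral_exp_mul_Ioi (by linarith)]
    simp; field_simp

lemma PP_bd' {b t C : ℝ} {f : ℝ → ℝ} (hb : 0 < b) (hC0 : 0 ≤ C) (hC : ∀ s ∈ Preg b t, |f s| ≤ C) :
    |PP b f t| ≤ C / (b * |t|) := by
  rcases eq_or_ne t 0 with rfl | ht
  · simp [PP]
  have hbt : 0 < b * |t| := mul_pos hb (abs_pos.2 ht)
  have gi := (exp_abs_int hbt b).1
  have h1 : |PP b f t| ≤ (C * (2 / (b * |t|))) / Real.pi := by
    refine PP_abs_le (by positivity) fun _ => ?_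
    rw [← (exp_abs_int hbt b).2, ← integral_const_mul]
    refine le_trans ?_ (setIntegral_le_integral (s := Preg b t) (gi.const_mul C)
      (Filter.Eventually.of_forall fun s => by positivity))
    rw [← Real.norm_eq_abs]
    refine norm_integral_le_of_norm_le (gi.integrableOn.const_mul C) ?_
    refine (ae_restrict_iff' (Preg_ms b t)).2 (Filter.Eventually.of_forall fun s hs => ?_)
    rw [norm_mul, Real.norm_eq_abs, Real.norm_of_nonneg (Real.exp_pos _).le]
    exact mul_le_mul (hC s hs) (Real.exp_le_exp.2 (reg_exp' hb.le hs)) (Real.exp_pos _).le hC0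
  refine h1.trans ?_
  calc C * (2 / (b * |t|)) / Real.pi = (2 / Real.pi) * (C / (b * |t|)) := by ring
    _ ≤ 1 * (C / (b * |t|)) := by
        gcongr
        rw [div_le_one Real.pi_pos]; linarith [Real.pi_gt_three]
    _ = _ := one_mul _

lemma expw_d (b t s : ℝ) : HasDerivAt (fun s : ℝ => Real.exp (-(s ^ 2 - b ^ 2) * t))
    (-(2 * s) * t * Real.exp (-(s ^ 2 - b ^ 2) * t)) s := by
  have := ((((hasDerivAt_pow 2 s).sub_const (b ^ 2)).neg).mul_const t).exp
  refine this.congr_deriv ?_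
  simp; ring

lemma osc_gen {b t M p q : ℝ} {f : ℝ → ℝ} (hf : ContinuousOn f (Set.Ioi 0)) (hp : 0 < p)
    (hpq : p ≤ q) (N : ℝ) (hN : ∀ s ∈ Set.Icc p q, Real.exp (-(s ^ 2 - b ^ 2) * t) ≤ N)
    (h : ∀ r ∈ Set.Icc p q, |∫ s in p..r, f s| ≤ M) :
    |∫ s in p..q, f s * Real.exp (-(s ^ 2 - b ^ 2) * t)| ≤ 2 * N * M := by
  have := mono_lemma (h := f) (w := fun s => Real.exp (-(s ^ 2 - b ^ 2) * t))
    (w' := fun s => -(2 * s) * t * Real.exp (-(s ^ 2 - b ^ 2) * t)) hpq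
    (hf.mono fun s hs => hp.trans_le hs.1) (fun s _ => expw_d b t s) (by fun_prop) h N
    (fun s _ => (Real.exp_pos _).le) hN
    (by
      rcases le_total 0 t with h | h
      · right; intro s hs
        have : 0 ≤ s := hp.le.trans hs.1
        have : 0 ≤ (2 * s) * t * Real.exp (-(s ^ 2 - b ^ 2) * t) := by positivity
        linarith
      · left; intro s hs
        have : 0 ≤ s := hp.le.trans hs.1
        have : 0 ≤ (2 * s) * (-t) * Real.exp (-(s ^ 2 - b ^ 2) * t) :=
          mul_nonneg (mul_nonneg (by positivity) (by linarith)) (Real.exp_pos _).le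
        linarith)
  simpa only [mul_comm (f _)] using this

/-- oscillatory bound -/
lemma PP_osc {b t C M : ℝ} {f : ℝ → ℝ} (hb : 0 ≤ b) (hM : 0 ≤ M) (hf : ContinuousOn f (Set.Ioi 0))
    (hC : ∀ s ∈ Preg b t, |f s| ≤ C)
    (hpos : 0 < t → ∀ p q, b < p → p ≤ q → |∫ s in p..q, f s| ≤ M)
    (hneg : t < 0 → ∀ p q, 0 < p → p ≤ q → q ≤ b → |∫ s in p..q, f s| ≤ M) :
    |PP b f t| ≤ M := by
  have : |PP b f t| ≤ 2 * 1 * M / Real.pi := by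
    refine PP_abs_le (by positivity) fun ht => ?_
    have hi := PP_int hb ht hf hC
    rcases lt_or_gt_of_ne ht with h | h
    · rw [Preg_neg h] at hi ⊢
      refine lim_Ioc (by positivity) hi fun p q hp hpq hq => ?_
      refine osc_gen hf hp hpq 1 (fun s hs => ?_) (fun r hr => hneg h p r hp hr.1 (hr.2.trans hq))
      rw [Real.exp_le_one_iff]
      refine (reg_exp hb (t := t) (s := s) ?_).trans ?_
      · rw [Preg_neg h]; exact ⟨hp.trans_le hs.1, hs.2.trans hq⟩
      · rw [neg_mul]; simp; positivity
    · rw [Preg_pos h] at hi ⊢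
      refine lim_Ioi hi fun p q hp hpq => ?_
      refine osc_gen hf (hb.trans_lt hp) hpq 1 (fun s hs => ?_) (fun r hr => hpos h p r hp hr.1)
      rw [Real.exp_le_one_iff]
      refine (reg_exp hb (t := t) (s := s) ?_).trans ?_
      · rw [Preg_pos h]; exact hp.trans_le hs.1
      · rw [neg_mul]; simp; positivity
  refine this.trans ?_
  rw [div_le_iff₀ Real.pi_pos]
  nlinarith [Real.pi_gt_three]

lemma PP_osc' {b t C M : ℝ} {f : ℝ → ℝ} (hb : 0 ≤ b) (hM : 0 ≤ M) (hf : ContinuousOn f (Set.Ioi 0))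
    (hC : ∀ s ∈ Preg b t, |f s| ≤ C)
    (h : ∀ p q, 0 < p → p ≤ q → |∫ s in p..q, f s| ≤ M) :
    |PP b f t| ≤ M :=
  PP_osc hb hM hf hC (fun _ p q hp hpq => h p q (hb.trans_lt hp) hpq) (fun _ p q hp hpq _ => h p q hp hpq)

end Part5

section Part6

/-! ### Bounds for `Sk` -/

lemma Sk_contOn (k Y : ℝ) : ContinuousOn (fun s => Sk k s Y) (Set.Ioi 0) := by
  unfold Sk
  refine ContinuousOn.div (by fun_prop) (by fun_prop) fun s hs => ?_
  exact sk_den (ne_of_gt hs) k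

lemma Sk_le_r {k s Y r : ℝ} (hr : 0 < r) (h : r ^ 2 ≤ s ^ 2 + k ^ 2) : |Sk k s Y| ≤ 1 / r := by
  have hD : 0 < s ^ 2 + k ^ 2 := by nlinarith
  unfold Sk
  rw [abs_div, abs_of_pos hD, div_le_div_iff₀ hD hr, one_mul]
  have hN : (s * Real.sin (s * Y) - k * Real.cos (s * Y)) ^ 2 ≤ s ^ 2 + k ^ 2 := by
    have h1 := Real.sin_sq_add_cos_sq (s * Y)
    have : (s * Real.sin (s * Y) - k * Real.cos (s * Y)) ^ 2
      + (s * Real.cos (s * Y) + k * Real.sin (s * Y)) ^ 2 = s ^ 2 + k ^ 2 := by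
      linear_combination (s ^ 2 + k ^ 2) * h1
    nlinarith [sq_nonneg (s * Real.cos (s * Y) + k * Real.sin (s * Y))]
  rw [← abs_of_pos hr, ← abs_mul]
  refine abs_le_of_sq_le_sq ?_ hD.le
  rw [mul_pow, sq (s ^ 2 + k ^ 2)]
  exact mul_le_mul hN h (sq_nonneg _) hD.le

lemma Sk_le_k {k : ℝ} (hk : k ≠ 0) (s Y : ℝ) : |Sk k s Y| ≤ 1 / |k| :=
  Sk_le_r (abs_pos.2 hk) (by rw [sq_abs]; nlinarith)

lemma Sk_le_s {s : ℝ} (hs : 0 < s) (k Y : ℝ) : |Sk k s Y| ≤ 1 / s := Sk_le_r hs (by nlinarith)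

lemma Sk_zero (s Y : ℝ) (hs : s ≠ 0) : Sk 0 s Y = Y * Real.sinc (s * Y) := by
  unfold Sk
  rcases eq_or_ne Y 0 with rfl | hY
  · simp
  rw [Real.sinc_of_ne_zero (mul_ne_zero hs hY)]
  field_simp
  ring

lemma Sk_le {s : ℝ} (hs : 0 < s) (k Y : ℝ) : |Sk k s Y| ≤ |Y| + |k|⁻¹ := by
  rcases eq_or_ne k 0 with rfl | hk
  · rw [Sk_zero s Y hs.ne', abs_mul]
    have := Real.abs_sinc_le_one (s * Y)
    have h2 := abs_nonneg Y
    simp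
    nlinarith
  · have := Sk_le_k hk s Y
    rw [one_div] at this
    linarith [abs_nonneg Y]

lemma Sk_split {s : ℝ} (hs : 0 < s) (k Y : ℝ) : Sk k s Y =
    s ^ 2 / (s ^ 2 + k ^ 2) * (Y * Real.sinc (s * Y)) - k / (s ^ 2 + k ^ 2) * Real.cos (s * Y) := by
  rw [← Sk_zero s Y hs.ne']
  unfold Sk
  have := sk_den hs.ne' k
  field_simp
  ring

lemma arctan_bd {k : ℝ} (hk : 0 < k) (p q : ℝ) : ∫ s in p..q, k / (s ^ 2 + k ^ 2) ≤ Real.pi := by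
  have : ∫ s in p..q, k / (s ^ 2 + k ^ 2) = Real.arctan (q / k) - Real.arctan (p / k) := by
    refine intervalIntegral.integral_eq_sub_of_hasDerivAt (f := fun s => Real.arctan (s / k)) (fun s _ => ?_) ?_
    · have := ((hasDerivAt_id s).div_const k).arctan
      refine this.congr_deriv ?_
      have : 0 < s ^ 2 + k ^ 2 := by positivity
      simp; field_simp; ring
    · refine Continuous.intervalIntegrable (Continuous.div (by fun_prop) (by fun_prop) fun s => ?_) _ _
      positivity
  rw [this]
  linarith [Real.arctan_lt_pi_div_two (q / k), Real.neg_pi_div_two_lt_arctan (p / k)]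

lemma kfrac_cont {k : ℝ} {p q : ℝ} (hp : 0 < p) (f : ℝ → ℝ) (hf : Continuous f) (n : ℕ) :
    ContinuousOn (fun s => f s / (s ^ 2 + k ^ 2) ^ n) (Set.Icc p q) := by
  refine ContinuousOn.div (by fun_prop) (by fun_prop) fun s hs => ?_
  exact pow_ne_zero _ (sk_den (hp.trans_le hs.1).ne' k)

lemma sqfrac_osc (k : ℝ) {h : ℝ → ℝ} {M p q : ℝ} (hp : 0 < p) (hpq : p ≤ q) (hh : Continuous h)
    (hM : ∀ r, |∫ s in p..r, h s| ≤ M) :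
    |∫ s in p..q, s ^ 2 / (s ^ 2 + k ^ 2) * h s| ≤ 2 * M := by
  have := mono_lemma (h := h) (w := fun s => s ^ 2 / (s ^ 2 + k ^ 2))
    (w' := fun s => (2 * s * k ^ 2) / (s ^ 2 + k ^ 2) ^ 2) hpq hh.continuousOn
    (fun s hs => by
      have hs0 : s ≠ 0 := (hp.trans_le hs.1).ne'
      have := (hasDerivAt_pow 2 s).div ((hasDerivAt_pow 2 s).add_const (k ^ 2)) (sk_den hs0 k)
      refine this.congr_deriv ?_
      have := sk_den hs0 k
      simp; field_simp; ring) (kfrac_cont hp _ (by fun_prop) 2) (fun r _ => hM r) 1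
    (fun s hs => by positivity)
    (fun s hs => by
      have : 0 < s := hp.trans_le hs.1
      rw [div_le_one (by positivity)]; nlinarith)
    (Or.inl fun s hs => by
      have : 0 < s := hp.trans_le hs.1
      positivity)
  linarith

lemma Sk_osc (k Y : ℝ) {p q : ℝ} (hp : 0 < p) (hpq : p ≤ q) : |∫ s in p..q, Sk k s Y| ≤ 24 := by
  have hc : Continuous (fun s => Y * Real.sinc (s * Y)) :=
    continuous_const.mul (Real.continuous_sinc.comp (by fun_prop))
  have i1 : IntervalIntegrable (fun s => s ^ 2 / (s ^ 2 + k ^ 2) * (Y * Real.sinc (s * Y))) volume p q := by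
    refine ContinuousOn.intervalIntegrable ?_
    rw [Set.uIcc_of_le hpq]
    have := kfrac_cont (k := k) (q := q) hp (fun s => s ^ 2) (by fun_prop) 1
    simp only [pow_one] at this
    exact this.mul hc.continuousOn
  have i0 : ContinuousOn (fun s => k / (s ^ 2 + k ^ 2)) (Set.Icc p q) := by
    have := kfrac_cont (k := k) (q := q) hp (fun s => k) (by fun_prop) 1
    simpa only [pow_one] using this
  have i2 : IntervalIntegrable (fun s => k / (s ^ 2 + k ^ 2) * Real.cos (s * Y)) volume p q := by
    refine ContinuousOn.intervalIntegrable ?_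
    rw [Set.uIcc_of_le hpq]
    exact i0.mul (by fun_prop)
  have e : ∫ s in p..q, Sk k s Y = (∫ s in p..q, s ^ 2 / (s ^ 2 + k ^ 2) * (Y * Real.sinc (s * Y)))
      - ∫ s in p..q, k / (s ^ 2 + k ^ 2) * Real.cos (s * Y) := by
    rw [← intervalIntegral.integral_sub i1 i2]
    refine intervalIntegral.integral_congr fun s hs => ?_
    rw [Set.uIcc_of_le hpq] at hs
    exact Sk_split (hp.trans_le hs.1) k Y
  have h1 := sqfrac_osc k hp hpq hc (fun r => sinc_osc Y p r)
  have h2 : |∫ s in p..q, k / (s ^ 2 + k ^ 2) * Real.cos (s * Y)| ≤ 4 := by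
    rcases eq_or_ne k 0 with rfl | hk
    · simp
    have hk' := abs_pos.2 hk
    calc _ ≤ ∫ s in p..q, |k / (s ^ 2 + k ^ 2) * Real.cos (s * Y)| :=
          intervalIntegral.abs_integral_le_integral_abs hpq
      _ ≤ ∫ s in p..q, |k| / (s ^ 2 + |k| ^ 2) := by
          refine intervalIntegral.integral_mono_on hpq i2.abs ?_ fun s hs => ?_
          · refine Continuous.intervalIntegrable (Continuous.div (by fun_prop) (by fun_prop) fun s => ?_) _ _
            positivity
          · rw [abs_mul, abs_div, sq_abs, abs_of_nonneg (by positivity : 0 ≤ s ^ 2 + k ^ 2)]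
            exact mul_le_of_le_one_right (by positivity) (Real.abs_cos_le_one _)
      _ ≤ Real.pi := arctan_bd hk' p q
      _ ≤ 4 := Real.pi_le_four
  rw [e]
  refine (abs_sub _ _).trans ?_
  linarith

lemma Sk_oscY {k Y : ℝ} (hk : k ≠ 0) (hY : Y ≠ 0) {p q : ℝ} (hp : 0 < p) (hpq : p ≤ q) :
    |∫ s in p..q, Sk k s Y| ≤ 14 / (|k| * |Y|) := by
  have hk' := abs_pos.2 hk
  have hY' := abs_pos.2 hY
  have c1 : ContinuousOn (fun s => s / (s ^ 2 + k ^ 2)) (Set.Icc p q) := by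
    have := kfrac_cont (k := k) (q := q) hp (fun s => s) (by fun_prop) 1
    simpa only [pow_one] using this
  have c0 : ContinuousOn (fun s => |k| / (s ^ 2 + k ^ 2)) (Set.Icc p q) := by
    have := kfrac_cont (k := k) (q := q) hp (fun s => |k|) (by fun_prop) 1
    simpa only [pow_one] using this
  have i1 : IntervalIntegrable (fun s => s / (s ^ 2 + k ^ 2) * Real.sin (s * Y)) volume p q := by
    refine ContinuousOn.intervalIntegrable ?_
    rw [Set.uIcc_of_le hpq]
    exact c1.mul (by fun_prop)
  have i2 : IntervalIntegrable (fun s => |k| / (s ^ 2 + k ^ 2) * Real.cos (s * Y)) volume p q := by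
    refine ContinuousOn.intervalIntegrable ?_
    rw [Set.uIcc_of_le hpq]
    exact c0.mul (by fun_prop)
  have e : ∫ s in p..q, Sk k s Y = (∫ s in p..q, s / (s ^ 2 + k ^ 2) * Real.sin (s * Y))
      - (k / |k|) * ∫ s in p..q, |k| / (s ^ 2 + k ^ 2) * Real.cos (s * Y) := by
    rw [← intervalIntegral.integral_const_mul, ← intervalIntegral.integral_sub i1 (i2.const_mul _)]
    refine intervalIntegral.integral_congr fun s hs => ?_
    rw [Set.uIcc_of_le hpq] at hs
    simp only [Sk]
    have := sk_den (hp.trans_le hs.1).ne' k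
    field_simp
  have ac : Continuous (fun s => |k| / (s ^ 2 + |k| ^ 2)) :=
    Continuous.div (by fun_prop) (by fun_prop) fun s => by positivity
  have h1 : |∫ s in p..q, s / (s ^ 2 + k ^ 2) * Real.sin (s * Y)| ≤ 2 / |Y| * (1 / |k| + 4 / |k|) := by
    refine bv_lemma (w' := fun s => (k ^ 2 - s ^ 2) / (s ^ 2 + k ^ 2) ^ 2) hpq (by fun_prop)
      (fun s hs => ?_) (kfrac_cont hp _ (by fun_prop) 2) (fun r _ => sin_osc hY p r) ?_ ?_
    · have hs0 : s ≠ 0 := (hp.trans_le hs.1).ne'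
      have := (hasDerivAt_id s).div ((hasDerivAt_pow 2 s).add_const (k ^ 2)) (sk_den hs0 k)
      refine this.congr_deriv ?_
      have := sk_den hs0 k
      simp; field_simp; ring
    · have : 0 < q := hp.trans_le hpq
      rw [abs_div, abs_of_pos this, abs_of_nonneg (by positivity : 0 ≤ q ^ 2 + k ^ 2),
        div_le_div_iff₀ (by positivity) hk', ← sq_abs k]
      nlinarith [sq_nonneg (q - |k|), sq_nonneg q]
    · calc ∫ s in p..q, |(k ^ 2 - s ^ 2) / (s ^ 2 + k ^ 2) ^ 2|
          ≤ ∫ s in p..q, (1 / |k|) * (|k| / (s ^ 2 + |k| ^ 2)) := by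
            refine intervalIntegral.integral_mono_on hpq ?_ ?_ fun s hs => ?_
            · refine ContinuousOn.intervalIntegrable ?_
              rw [Set.uIcc_of_le hpq]
              exact (kfrac_cont hp _ (by fun_prop) 2).abs
            · exact (continuous_const.mul ac).intervalIntegrable _ _
            · have hD : 0 < s ^ 2 + k ^ 2 := by positivity
              rw [sq_abs, abs_div, abs_of_pos (by positivity : 0 < (s ^ 2 + k ^ 2) ^ 2)]
              have e : 1 / |k| * (|k| / (s ^ 2 + k ^ 2)) = (s ^ 2 + k ^ 2) / (s ^ 2 + k ^ 2) ^ 2 := by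
                field_simp
              rw [e]
              gcongr
              rw [abs_le]; constructor <;> nlinarith [sq_nonneg s, sq_nonneg k]
        _ ≤ 1 / |k| * 4 := by
            rw [intervalIntegral.integral_const_mul]
            gcongr
            exact (arctan_bd hk' p q).trans Real.pi_le_four
        _ = 4 / |k| := by ring
  have h2 : |∫ s in p..q, |k| / (s ^ 2 + k ^ 2) * Real.cos (s * Y)| ≤ 2 * (1 / |k|) * (2 / |Y|) := by
    refine mono_lemma (w' := fun s => (-(2 * s * |k|)) / (s ^ 2 + k ^ 2) ^ 2) hpq (by fun_prop)
      (fun s hs => ?_) (kfrac_cont hp _ (by fun_prop) 2) (fun r _ => cos_osc hY p r) (1 / |k|)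
      (fun s hs => by positivity) (fun s hs => ?_) (Or.inr fun s hs => ?_)
    · have hs0 : s ≠ 0 := (hp.trans_le hs.1).ne'
      have := (hasDerivAt_const s |k|).div ((hasDerivAt_pow 2 s).add_const (k ^ 2)) (sk_den hs0 k)
      refine this.congr_deriv ?_
      simp; ring
    · rw [div_le_div_iff₀ (by positivity) hk', ← sq_abs k]; nlinarith
    · have : 0 < s := hp.trans_le hs.1
      rw [neg_div, neg_nonpos]; positivity
  have h3 : |k / abs k| = 1 := by rw [abs_div, abs_abs, div_self hk'.ne']
  rw [e]
  refine (abs_sub _ _).trans ?_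
  rw [abs_mul, h3, one_mul]
  refine (add_le_add h1 h2).trans_eq ?_
  field_simp; norm_num

end Part6

section Part7

/-! ### Fourier inversion in cosine form -/

open FourierTransform in
lemma four_integrable {Ψ Ψ1 Ψ2 : ℝ → ℂ} (h1 : ∀ y, HasDerivAt Ψ (Ψ1 y) y)
    (h2 : ∀ y, HasDerivAt Ψ1 (Ψ2 y) y) (i0 : Integrable Ψ) (i1 : Integrable Ψ1)
    (i2 : Integrable Ψ2) : Integrable (𝓕 Ψ) := by
  have e1 : deriv Ψ = Ψ1 := funext fun y => (h1 y).deriv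
  have e2 : deriv Ψ1 = Ψ2 := funext fun y => (h2 y).deriv
  have f1 := Real.fourier_deriv i0 (fun y => (h1 y).differentiableAt) (by rwa [e1])
  have f2 := Real.fourier_deriv i1 (fun y => (h2 y).differentiableAt) (by rwa [e2])
  rw [e1] at f1
  rw [e2] at f2
  have nb : ∀ (f : ℝ → ℂ) ξ, ‖𝓕 f ξ‖ ≤ ∫ y, ‖f y‖ := fun f ξ =>
    VectorFourier.norm_fourierIntegral_le_integral_norm _ _ _ _ _
  have hc : Continuous (𝓕 Ψ) :=
    VectorFourier.fourierIntegral_continuous Real.continuous_fourierChar (by fun_prop) i0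
  refine Integrable.mono' (integrable_inv_one_add_sq.const_mul ((∫ y, ‖Ψ y‖) + ∫ y, ‖Ψ2 y‖))
    hc.aestronglyMeasurable (Filter.Eventually.of_forall fun ξ => ?_)
  have hb := nb Ψ2 ξ
  rw [f2, f1] at hb
  simp only [norm_smul, ← mul_assoc, norm_mul] at hb
  simp at hb
  have ha := nb Ψ ξ
  have hp := Real.pi_gt_three
  rw [← div_eq_mul_inv, le_div_iff₀ (by positivity)]
  have h0 : 0 ≤ ‖𝓕 Ψ ξ‖ := norm_nonneg _
  rw [abs_of_pos Real.pi_pos] at hb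
  have : ξ ^ 2 * ‖𝓕 Ψ ξ‖ ≤ 2 * Real.pi * |ξ| * (2 * Real.pi * |ξ|) * ‖𝓕 Ψ ξ‖ := by
    refine mul_le_mul_of_nonneg_right ?_ h0
    rw [← sq_abs ξ]
    nlinarith [sq_nonneg |ξ|, mul_nonneg (sq_nonneg |ξ|) (by nlinarith : (0:ℝ) ≤ 4 * Real.pi ^ 2 - 1)]
  nlinarith

open FourierTransform in
lemma cos_inv {Ψ Ψ1 Ψ2 : ℝ → ℂ} (h1 : ∀ y, HasDerivAt Ψ (Ψ1 y) y)
    (h2 : ∀ y, HasDerivAt Ψ1 (Ψ2 y) y) (i0 : Integrable Ψ) (i1 : Integrable Ψ1)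
    (i2 : Integrable Ψ2) (y' : ℝ) :
    IntegrableOn (fun s : ℝ => ∫ y, (Real.cos (s * (y - y')) : ℂ) * Ψ y) (Set.Ioi 0) ∧
    ∫ s in Set.Ioi (0 : ℝ), ∫ y, (Real.cos (s * (y - y')) : ℂ) * Ψ y = Real.pi * Ψ y' := by
  have hF := four_integrable h1 h2 i0 i1 i2
  have hcont : Continuous Ψ := continuous_iff_continuousAt.2 fun y => (h1 y).continuousAt
  have hinv := congrFun (hcont.fourierInv_fourier_eq i0 hF) y'
  set Φ : ℝ → ℂ := fun ξ => Complex.exp (↑(2 * Real.pi * (ξ * y')) * I) * 𝓕 Ψ ξ with hΦ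
  have hΦ1 : ∫ ξ, Φ ξ = Ψ y' := by
    rw [← hinv, Real.fourierInv_eq']
    refine integral_congr_ae (Filter.Eventually.of_forall fun ξ => ?_)
    simp [hΦ, mul_comm]
  have hΦi : Integrable Φ := by
    refine Integrable.mono hF (AEStronglyMeasurable.mul (by fun_prop) hF.1) ?_
    refine Filter.Eventually.of_forall fun ξ => ?_
    simp only [hΦ, norm_mul, Complex.norm_exp_ofReal_mul_I, one_mul, le_refl]
  have hval : ∀ ξ, Φ ξ = ∫ y, Complex.exp (↑(-(2 * Real.pi * ξ * (y - y'))) * I) * Ψ y := by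
    intro ξ
    simp only [hΦ]
    rw [Real.fourier_eq', ← integral_const_mul]
    refine integral_congr_ae (Filter.Eventually.of_forall fun y => ?_)
    simp only [smul_eq_mul, ← mul_assoc, ← Complex.exp_add]
    congr 2
    simp
    ring
  have hp : 0 < 2 * Real.pi := by positivity
  have hei : ∀ r : ℝ, Integrable fun y => Complex.exp (↑(-(r * (y - y'))) * I) * Ψ y := by
    intro r
    refine Integrable.mono i0 (AEStronglyMeasurable.mul (by fun_prop) i0.1) ?_
    refine Filter.Eventually.of_forall fun ξ => ?_
    simp only [norm_mul, Complex.norm_exp_ofReal_mul_I, one_mul, le_refl]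
  have hc : (fun s : ℝ => ∫ y, (Real.cos (s * (y - y')) : ℂ) * Ψ y)
      = fun s => (1/2 : ℂ) * (Φ ((2 * Real.pi)⁻¹ * s) + Φ (-((2 * Real.pi)⁻¹ * s))) := by
    funext s
    have r1 : ∀ z : ℝ, 2 * Real.pi * ((2 * Real.pi)⁻¹ * s) * z = s * z := by
      intro z; field_simp
    have r2 : ∀ z : ℝ, 2 * Real.pi * (-((2 * Real.pi)⁻¹ * s)) * z = (-s) * z := by
      intro z; field_simp
    rw [hval, hval]
    simp only [r1, r2]
    rw [← integral_add (hei s) (hei (-s)), ← integral_const_mul]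
    refine integral_congr_ae (Filter.Eventually.of_forall fun y => ?_)
    simp only
    rw [← add_mul, ← mul_assoc]
    congr 1
    push_cast
    rw [Complex.cos]
    have : ∀ w : ℂ, -(-(s:ℂ) * w) = s * w := fun w => by ring
    rw [this]
    ring_nf
  have A1 : IntegrableOn (fun s => Φ ((2 * Real.pi)⁻¹ * s)) (Set.Ioi 0) := by
    rw [integrableOn_Ioi_comp_mul_left_iff _ _ (by positivity)]
    exact hΦi.integrableOn
  have A2 : IntegrableOn (fun s => Φ (-((2 * Real.pi)⁻¹ * s))) (Set.Ioi 0) := by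
    have := (integrableOn_Ioi_comp_mul_left_iff (fun s => Φ (-s)) 0
      (by positivity : 0 < (2 * Real.pi)⁻¹)).2 hΦi.comp_neg.integrableOn
    exact this
  rw [hc]
  refine ⟨(A1.add A2).const_mul _, ?_⟩
  rw [integral_const_mul, integral_add A1 A2,
    integral_comp_mul_left_Ioi Φ 0 (by positivity : 0 < (2 * Real.pi)⁻¹),
    integral_comp_mul_left_Ioi (fun s => Φ (-s)) 0 (by positivity : 0 < (2 * Real.pi)⁻¹),
    mul_zero, integral_comp_neg_Ioi, neg_zero, ← smul_add, add_comm (∫ x in Set.Ioi 0, Φ x),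
    ← Set.compl_Iic, integral_add_compl measurableSet_Iic hΦi, hΦ1]
  simp
  ring

end Part7

section Part8

/-! ### The transform of `Sk` -/

lemma Sk_contY (k s : ℝ) : Continuous (fun Y => Sk k s Y) := by
  unfold Sk; fun_prop

lemma Sk_inv {k : ℝ} {Ψ g g1 : ℝ → ℂ} (hΨ : ∀ y, HasDerivAt Ψ (-k * Ψ y - g y) y)
    (hg : ∀ y, HasDerivAt g (g1 y) y) (iΨ : Integrable Ψ) (ig : Integrable g)
    (ig1 : Integrable g1) (y' : ℝ) :
    IntegrableOn (fun s : ℝ => ∫ y, (Sk k s (y - y') : ℂ) * g y) (Set.Ioi 0) ∧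
    ∫ s in Set.Ioi (0 : ℝ), ∫ y, (Sk k s (y - y') : ℂ) * g y = Real.pi * Ψ y' := by
  have hΨ2 : ∀ y, HasDerivAt (fun y => -k * Ψ y - g y) (-k * (-k * Ψ y - g y) - g1 y) y :=
    fun y => ((hΨ y).const_mul _).sub (hg y)
  have i1 : Integrable (fun y => -k * Ψ y - g y) := (iΨ.const_mul _).sub ig
  have key := cos_inv hΨ hΨ2 iΨ i1 ((i1.const_mul _).sub ig1) y'
  have heq : ∀ s ∈ Set.Ioi (0:ℝ), ∫ y, (Sk k s (y - y') : ℂ) * g y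
      = ∫ y, (Real.cos (s * (y - y')) : ℂ) * Ψ y := by
    intro s hs
    have hs : 0 < s := hs
    have hcS : Continuous (fun y => (Sk k s (y - y') : ℂ)) :=
      Complex.continuous_ofReal.comp ((Sk_contY k s).comp (by fun_prop))
    have bS : ∀ f : ℝ → ℂ, Integrable f → Integrable (fun y => (Sk k s (y - y') : ℂ) * f y) := by
      intro f hf
      refine hf.bdd_mul hcS.aestronglyMeasurable (c := 1 / s)
        (Filter.Eventually.of_forall fun y => ?_)
      rw [Complex.norm_real]
      exact Sk_le_s hs k _
    have bC : Integrable (fun y => (Real.cos (s * (y - y')) : ℂ) * Ψ y) := by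
      refine iΨ.bdd_mul (Continuous.aestronglyMeasurable (by fun_prop)) (c := 1)
        (Filter.Eventually.of_forall fun y => ?_)
      rw [Complex.norm_real]
      exact Real.abs_cos_le_one _
    have hd : ∀ y, HasDerivAt (fun y => (Sk k s (y - y') : ℂ) * Ψ y)
        ((Real.cos (s * (y - y')) : ℂ) * Ψ y - (Sk k s (y - y') : ℂ) * g y) y := by
      intro y
      have h1 := ((Sk_d hs.ne' k (y - y')).comp y ((hasDerivAt_id y).sub_const y')).ofReal_comp
      refine (h1.mul (hΨ y)).congr_deriv ?_
      simp
      ring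
    have := integral_eq_zero_of_hasDerivAt_of_integrable hd (bC.sub (bS g ig)) (bS Ψ iΨ)
    rw [integral_sub bC (bS g ig)] at this
    exact (sub_eq_zero.1 this).symm
  refine ⟨key.1.congr_fun (fun s hs => (heq s hs).symm) measurableSet_Ioi, ?_⟩
  rw [setIntegral_congr_fun measurableSet_Ioi heq]
  exact key.2

lemma Psi_facts {k : ℝ} {g : ℝ → ℂ} (hg : Continuous g) (hc : HasCompactSupport g) (ι : ℝ)
    (hι : (0 < k ∧ ι = 1) ∨ (k < 0 ∧ ι = 0) ∨ (k = 0 ∧ ∫ y, g y = 0)) :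
    (∀ y, HasDerivAt (fun y : ℝ => (Real.exp (-k * y) : ℂ) * ((∫ w in Set.Ioi y, (Real.exp (k * w) : ℂ) * g w)
      - ι * ∫ w, (Real.exp (k * w) : ℂ) * g w))
      (-k * ((Real.exp (-k * y) : ℂ) * ((∫ w in Set.Ioi y, (Real.exp (k * w) : ℂ) * g w)
      - ι * ∫ w, (Real.exp (k * w) : ℂ) * g w)) - g y) y) ∧
    Integrable (fun y : ℝ => (Real.exp (-k * y) : ℂ) * ((∫ w in Set.Ioi y, (Real.exp (k * w) : ℂ) * g w)
      - ι * ∫ w, (Real.exp (k * w) : ℂ) * g w)) := by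
  set h : ℝ → ℂ := fun w => (Real.exp (k * w) : ℂ) * g w with hh
  have ch : Continuous h := by fun_prop
  have sh : HasCompactSupport h := hc.mul_left
  have ih : Integrable h := ch.integrable_of_hasCompactSupport sh
  have hder : ∀ y, HasDerivAt (fun y : ℝ => ∫ w in Set.Ioi y, h w) (- h y) y := by
    intro y
    have e : (fun y : ℝ => ∫ w in Set.Ioi y, h w) = fun y => (∫ w in Set.Ioi 0, h w) - ∫ w in (0:ℝ)..y, h w := by
      funext y
      rw [eq_sub_iff_add_eq, ← intervalIntegral.integral_Ioi_sub_Ioi' ih.integrableOn ih.integrableOn]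
      ring
    rw [e]
    exact ((intervalIntegral.integral_hasDerivAt_right (ch.intervalIntegrable _ _)
      (ch.stronglyMeasurableAtFilter _ _) ch.continuousAt).const_sub _)
  have D : ∀ y, HasDerivAt (fun y : ℝ => (Real.exp (-k * y) : ℂ) * ((∫ w in Set.Ioi y, h w)
      - ι * ∫ w, h w)) (-k * ((Real.exp (-k * y) : ℂ) * ((∫ w in Set.Ioi y, h w)
      - ι * ∫ w, h w)) - g y) y := by
    intro y
    have h1 : HasDerivAt (fun y : ℝ => (Real.exp (-k * y) : ℂ)) ((Real.exp (-k * y) * -k : ℝ) : ℂ) y := by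
      have := ((hasDerivAt_id y).const_mul (-k)).exp.ofReal_comp
      simpa using this
    refine (h1.mul ((hder y).sub_const _)).congr_deriv ?_
    simp only [hh]
    have : (Real.exp (-k * y) : ℂ) * (Real.exp (k * y) : ℂ) = 1 := by
      rw [← Complex.ofReal_mul, ← Real.exp_add]; simp
    push_cast at this ⊢
    linear_combination (- g y) * this
  refine ⟨D, ?_⟩
  have hcont : Continuous (fun y : ℝ => (Real.exp (-k * y) : ℂ) * ((∫ w in Set.Ioi y, h w)
      - ι * ∫ w, h w)) := continuous_iff_continuousAt.2 fun y => (D y).continuousAt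
  obtain ⟨R, hR⟩ : ∃ R : ℝ, ∀ y, R < |y| → h y = 0 := by
    obtain ⟨R, hR⟩ := sh.isCompact.isBounded.subset_closedBall 0
    refine ⟨R, fun y hy => image_eq_zero_of_notMem_tsupport fun hm => ?_⟩
    have := hR hm
    simp at this
    linarith
  have hR0 : ∀ y, R < y → (∫ w in Set.Ioi y, h w) = 0 := fun y hy => by
    refine setIntegral_eq_zero_of_forall_eq_zero fun w hw => hR w ?_
    exact (hy.trans hw).trans_le (le_abs_self w)
  have hR1 : ∀ y, y < -R → (∫ w in Set.Ioi y, h w) = ∫ w, h w := fun y hy => by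
    rw [← integral_add_compl (measurableSet_Iic (a := y)) ih, Set.compl_Iic, right_eq_add]
    refine setIntegral_eq_zero_of_forall_eq_zero fun w hw => hR w ?_
    have : w ≤ y := hw
    have := neg_le_abs w
    linarith
  set C := (1 + |ι|) * ∫ w, ‖h w‖ with hC
  have hN : 0 ≤ ∫ w, ‖h w‖ := integral_nonneg fun _ => norm_nonneg _
  have hCb : ∀ y, ‖(∫ w in Set.Ioi y, h w) - ι * ∫ w, h w‖ ≤ C := by
    intro y
    refine (norm_sub_le _ _).trans ?_
    rw [norm_mul, Complex.norm_real, hC, add_mul, one_mul]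
    refine add_le_add ?_ (mul_le_mul_of_nonneg_left (norm_integral_le_integral_norm _) (abs_nonneg _))
    exact (norm_integral_le_integral_norm _).trans
      (setIntegral_le_integral ih.norm (Filter.Eventually.of_forall fun _ => norm_nonneg _))
  have hC0 : 0 ≤ C := by positivity
  rcases hι with ⟨hk, rfl⟩ | ⟨hk, rfl⟩ | ⟨rfl, h0⟩
  · refine Integrable.mono' ((exp_abs_int hk 0).1.const_mul (C * Real.exp (2 * k * |R|)))
      hcont.aestronglyMeasurable (Filter.Eventually.of_forall fun y => ?_)
    by_cases hy : y < -R
    · rw [hR1 y hy]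
      simp; positivity
    rw [norm_mul, Complex.norm_real, Real.norm_eq_abs, Real.abs_exp, mul_comm, mul_assoc, ← Real.exp_add]
    refine mul_le_mul (hCb y) (Real.exp_le_exp.2 ?_) (Real.exp_pos _).le hC0
    simp only [sub_zero]
    push Not at hy
    have : -|R| ≤ y := by have := le_abs_self R; linarith
    rcases le_total 0 y with h' | h'
    · rw [abs_of_nonneg h']; nlinarith [abs_nonneg R]
    · rw [abs_of_nonpos h']; nlinarith [abs_nonneg R]
  · refine Integrable.mono' ((exp_abs_int (neg_pos.2 hk) 0).1.const_mul (C * Real.exp (2 * -k * |R|)))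
      hcont.aestronglyMeasurable (Filter.Eventually.of_forall fun y => ?_)
    by_cases hy : R < y
    · rw [hR0 y hy]
      simp; positivity
    rw [norm_mul, Complex.norm_real, Real.norm_eq_abs, Real.abs_exp, mul_comm, mul_assoc, ← Real.exp_add]
    refine mul_le_mul (hCb y) (Real.exp_le_exp.2 ?_) (Real.exp_pos _).le hC0
    simp only [sub_zero]
    push Not at hy
    have : y ≤ |R| := by have := le_abs_self R; linarith
    rcases le_total 0 y with h' | h'
    · rw [abs_of_nonneg h']; nlinarith [abs_nonneg R]
    · rw [abs_of_nonpos h']; nlinarith [abs_nonneg R]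
  · refine hcont.integrable_of_hasCompactSupport (HasCompactSupport.of_support_subset_isCompact
      (isCompact_Icc (a := -R) (b := R)) fun y hy => ?_)
    have h0' : ∫ w, h w = 0 := by simpa [hh] using h0
    by_contra hn
    refine hy ?_
    simp only
    rw [Set.mem_Icc, not_and_or, not_le, not_le] at hn
    rcases hn with hn | hn
    · rw [hR1 y hn, h0']; simp
    · rw [hR0 y hn, h0']; simp

/-- The weight of the half-line contribution. -/
def iot (k : ℝ) : ℝ := if 0 < k then 1 else if k = 0 then 1 / 2 else 0

lemma Sk_transform (k : ℝ) {g g1 : ℝ → ℂ} (hg : ∀ y, HasDerivAt g (g1 y) y)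
    (cg1 : Continuous g1) (hc : HasCompactSupport g) (hc1 : HasCompactSupport g1) (y' : ℝ) :
    IntegrableOn (fun s : ℝ => ∫ y, (Sk k s (y - y') : ℂ) * g y) (Set.Ioi 0) ∧
    ∫ s in Set.Ioi (0 : ℝ), ∫ y, (Sk k s (y - y') : ℂ) * g y
      = Real.pi * ((∫ y in Set.Ioi y', (Real.exp (k * (y - y')) : ℂ) * g y)
        - iot k * ∫ y, (Real.exp (k * (y - y')) : ℂ) * g y) := by
  have cg : Continuous g := continuous_iff_continuousAt.2 fun y => (hg y).continuousAt
  have ig : Integrable g := cg.integrable_of_hasCompactSupport hc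
  have ig1 : Integrable g1 := cg1.integrable_of_hasCompactSupport hc1
  rcases eq_or_ne k 0 with rfl | hk
  · -- odd part
    set go : ℝ → ℂ := fun y => (g y - g (2 * y' - y)) / 2 with hgo
    have ir : Integrable (fun y => g (2 * y' - y)) := ig.comp_sub_left _
    have ego : ∫ y, go y = 0 := by
      simp only [hgo]
      rw [integral_div, integral_sub ig ir, integral_sub_left_eq_self g]
      simp
    have refl : Topology.IsClosedEmbedding (fun y : ℝ => 2 * y' - y) :=
      (Homeomorph.subLeft (2 * y')).isClosedEmbedding
    have cgo : Continuous go := by fun_prop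
    have sgo : HasCompactSupport go := by
      have h2 : HasCompactSupport (fun y => g (2 * y' - y)) := hc.comp_isClosedEmbedding refl
      have := (hc.sub h2).mul_right (f' := fun _ => (2:ℂ)⁻¹)
      exact this
    have hgo1 : ∀ y, HasDerivAt go ((g1 y + g1 (2 * y' - y)) / 2) y := by
      intro y
      have h2 := (hg (2 * y' - y)).scomp y ((hasDerivAt_id y).const_sub (2 * y'))
      refine (((hg y).sub h2).div_const 2).congr_deriv ?_
      simp
    have ir1 : Integrable (fun y => g1 (2 * y' - y)) := ig1.comp_sub_left _
    have F := Psi_facts (k := 0) cgo sgo 0 (Or.inr (Or.inr ⟨rfl, ego⟩))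
    have K := Sk_inv F.1 hgo1 F.2 (cgo.integrable_of_hasCompactSupport sgo)
      ((ig1.add ir1).div_const 2) y'
    have e : ∀ s ∈ Set.Ioi (0:ℝ), ∫ y, (Sk 0 s (y - y') : ℂ) * go y
        = ∫ y, (Sk 0 s (y - y') : ℂ) * g y := by
      intro s hs
      have hcS : Continuous (fun y => (Sk 0 s (y - y') : ℂ)) :=
        Complex.continuous_ofReal.comp ((Sk_contY 0 s).comp (by fun_prop))
      have bS : ∀ f : ℝ → ℂ, Integrable f → Integrable (fun y => (Sk 0 s (y - y') : ℂ) * f y) := by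
        intro f hf
        refine hf.bdd_mul hcS.aestronglyMeasurable (c := 1 / s)
          (Filter.Eventually.of_forall fun y => ?_)
        rw [Complex.norm_real]
        exact Sk_le_s hs 0 _
      have e1 : ∫ y, (Sk 0 s (y - y') : ℂ) * g (2 * y' - y) = - ∫ y, (Sk 0 s (y - y') : ℂ) * g y := by
        rw [← integral_sub_left_eq_self (fun y => (Sk 0 s (y - y') : ℂ) * g y) volume (2 * y'), ← integral_neg]
        refine integral_congr_ae (Filter.Eventually.of_forall fun y => ?_)
        have : Sk 0 s (2 * y' - y - y') = - Sk 0 s (y - y') := by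
          rw [show 2 * y' - y - y' = -(y - y') by ring]
          unfold Sk
          rw [mul_neg, Real.sin_neg, Real.cos_neg]
          ring
        simp only [this]
        push_cast; ring
      have e2 : (fun y => (Sk 0 s (y - y') : ℂ) * go y) = fun y => ((Sk 0 s (y - y') : ℂ) * g y
          - (Sk 0 s (y - y') : ℂ) * g (2 * y' - y)) / 2 := by
        funext y; simp only [hgo]; ring
      rw [e2, integral_div, integral_sub (bS g ig) (bS _ ir), e1]
      ring
    refine ⟨K.1.congr_fun e measurableSet_Ioi, ?_⟩
    rw [← setIntegral_congr_fun measurableSet_Ioi e, K.2]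
    congr 1
    have e3 : ∫ y in Set.Ioi y', g (2 * y' - y) = ∫ y in Set.Iic y', g y := by
      have hm : MeasurePreserving (fun y : ℝ => 2 * y' - y) volume volume :=
        Measure.measurePreserving_sub_left volume (2 * y')
      rw [integral_Iic_eq_integral_Iio, ← hm.setIntegral_preimage_emb refl.measurableEmbedding g (Set.Iio y')]
      congr 2
      ext y; simp; constructor <;> intro h <;> linarith
    have e4 : ∫ y, g y = (∫ y in Set.Iic y', g y) + ∫ y in Set.Ioi y', g y := by
      rw [← integral_add_compl (measurableSet_Iic (a := y')) ig, Set.compl_Iic]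
    have e5 : ∫ y in Set.Ioi y', go y = ((∫ y in Set.Ioi y', g y) - ∫ y in Set.Iic y', g y) / 2 := by
      simp only [hgo]
      rw [integral_div, integral_sub ig.integrableOn ir.integrableOn, e3]
    simp [iot, e4, e5]
    ring
  · have hi : (0 < k ∧ iot k = 1) ∨ (k < 0 ∧ iot k = 0) ∨ (k = 0 ∧ ∫ y, g y = 0) := by
      rcases lt_or_gt_of_ne hk with h | h
      · right; left; exact ⟨h, by simp [iot, h.not_gt, hk]⟩
      · left; exact ⟨h, by simp [iot, h]⟩
    have F := Psi_facts cg hc (iot k) hi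
    have K := Sk_inv F.1 hg F.2 ig ig1 y'
    refine ⟨K.1, ?_⟩
    rw [K.2]
    congr 1
    have ee : ∀ y, (Real.exp (k * (y - y')) : ℂ) * g y
        = (Real.exp (-k * y') : ℂ) * ((Real.exp (k * y) : ℂ) * g y) := by
      intro y
      rw [← mul_assoc, ← Complex.ofReal_mul, ← Real.exp_add]
      congr 3; ring
    simp only [ee, integral_const_mul]
    ring

end Part8

section Part9

/-! ### The Dirichlet integral -/

lemma Si_sub (p r : ℝ) : Si r - Si p = ∫ s in p..r, Real.sinc s := by
  unfold Si
  rw [intervalIntegral.integral_interval_sub_left (sinc_ii _ _) (sinc_ii _ _)]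

lemma Si_cont : Continuous Si := by
  unfold Si
  exact intervalIntegral.continuous_primitive (fun a b => sinc_ii a b) 0

lemma Si_exlim : ∃ L, Filter.Tendsto Si Filter.atTop (nhds L) := by
  apply cauchySeq_tendsto_of_complete
  rw [Metric.cauchySeq_iff']
  intro ε hε
  refine ⟨8 / ε, fun n hn => ?_⟩
  have h8 : 0 < 8 / ε := by positivity
  rw [Real.dist_eq, Si_sub]
  refine (sinc_tail h8 hn).trans_lt ?_
  rw [div_lt_iff₀ h8, mul_div_cancel₀ _ hε.ne']
  norm_num

lemma Si_lim : Filter.Tendsto Si Filter.atTop (nhds (Real.pi / 2)) := by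
  obtain ⟨L, hL⟩ := Si_exlim
  suffices L = Real.pi / 2 by rwa [this] at hL
  let f : ContDiffBump (2:ℝ) := ⟨1/2, 1, by norm_num, by norm_num⟩
  set g : ℝ → ℂ := fun y => (f y : ℂ) with hg
  have sf : HasCompactSupport f := f.hasCompactSupport
  have df : ∀ y, HasDerivAt f (deriv f y) y := fun y =>
    ((f.contDiff (n := 1)).differentiable (by norm_num) y).hasDerivAt
  have cdf : Continuous (deriv f) := (f.contDiff (n := 1)).continuous_deriv (by norm_num)
  have sg : HasCompactSupport g := sf.comp_left (g := fun r : ℝ => (r : ℂ)) (by simp)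
  have sg1 : HasCompactSupport (fun y => ((deriv f y : ℝ) : ℂ)) :=
    sf.deriv.comp_left (g := fun r : ℝ => (r : ℂ)) (by simp)
  have cg : Continuous g := Complex.continuous_ofReal.comp f.continuous
  have ig : Integrable g := cg.integrable_of_hasCompactSupport sg
  have T := Sk_transform 0 (g := g) (fun y => (df y).ofReal_comp)
    (Complex.continuous_ofReal.comp cdf) sg sg1 0
  have hz : ∀ y, y ≤ 1 → f y = 0 := fun y hy => by
    apply f.zero_of_le_dist
    rw [Real.dist_eq]
    show (1:ℝ) ≤ _
    have := neg_le_abs (y - 2)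
    linarith
  set J : ℂ := ∫ y, g y with hJ
  have hJ0 : J ≠ 0 := by
    have : J = ((∫ y, f y : ℝ) : ℂ) := integral_ofReal
    rw [this]
    exact_mod_cast f.integral_pos.ne'
  have hhalf : ∫ y in Set.Ioi (0:ℝ), g y = J := by
    rw [hJ, ← integral_add_compl (measurableSet_Iic (a := (0:ℝ))) ig, Set.compl_Iic, right_eq_add]
    refine setIntegral_eq_zero_of_forall_eq_zero fun w hw => ?_
    have : w ≤ 0 := hw
    simp [hg, hz w (by linarith)]
  have hT : ∫ s in Set.Ioi (0 : ℝ), ∫ y, (Sk 0 s (y - 0) : ℂ) * g y = (Real.pi / 2) * J := by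
    rw [T.2]
    simp [iot, hhalf, ← hJ]
    ring
  have hlim := intervalIntegral_tendsto_integral_Ioi (0:ℝ) T.1 Filter.tendsto_id
  rw [hT] at hlim
  have hev : ∀ n : ℝ, 0 < n → ∫ s in (0:ℝ)..n, ∫ y, (Sk 0 s (y - 0) : ℂ) * g y
      = ∫ y, (Si (n * y) : ℂ) * g y := by
    intro n hn
    rw [intervalIntegral.integral_of_le hn.le]
    have e1 : ∫ s in Set.Ioc 0 n, ∫ y, (Sk 0 s (y - 0) : ℂ) * g y
        = ∫ s in Set.Ioc 0 n, ∫ y, ((y * Real.sinc (s * y) : ℝ) : ℂ) * g y := by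
      refine setIntegral_congr_fun measurableSet_Ioc fun s hs => ?_
      congr 1
      funext y
      rw [sub_zero, Sk_zero s y hs.1.ne']
    rw [e1, integral_integral_swap]
    · congr 1
      funext y
      rw [integral_mul_const]
      congr 1
      have := sinc_int y 0 n
      rw [intervalIntegral.integral_of_le hn.le] at this
      rw [integral_complex_ofReal, this]
      simp [Si]
    · have iy : Integrable (fun y : ℝ => (y : ℂ) * g y) :=
        Continuous.integrable_of_hasCompactSupport (by fun_prop) sg.mul_left
      have : Integrable (fun z : ℝ × ℝ => (1:ℂ) * ((z.2 : ℂ) * g z.2))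
        ((volume.restrict (Set.Ioc 0 n)).prod volume) := (integrable_const (1:ℂ)).mul_prod iy
      refine this.mono (Continuous.aestronglyMeasurable ?_) (Filter.Eventually.of_forall fun z => ?_)
      · have := Real.continuous_sinc
        unfold Function.uncurry
        fun_prop
      · simp only [Function.uncurry, one_mul]
        rw [norm_mul, norm_mul, Complex.norm_real, Complex.norm_real z.2]
        refine mul_le_mul_of_nonneg_right ?_ (norm_nonneg _)
        rw [norm_mul, Real.norm_eq_abs (Real.sinc _)]
        exact mul_le_of_le_one_right (norm_nonneg _) (Real.abs_sinc_le_one _)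
  have hlim2 : Filter.Tendsto (fun n : ℝ => ∫ y, (Si (n * y) : ℂ) * g y) Filter.atTop
      (nhds ((Real.pi / 2) * J)) := by
    refine hlim.congr' ?_
    filter_upwards [Filter.eventually_gt_atTop 0] with n hn
    exact hev n hn
  have hlim3 : Filter.Tendsto (fun n : ℝ => ∫ y, (Si (n * y) : ℂ) * g y) Filter.atTop
      (nhds (∫ y, (L : ℂ) * g y)) := by
    refine tendsto_integral_filter_of_dominated_convergence (fun y => 5 * ‖g y‖) ?_ ?_ (ig.norm.const_mul 5) ?_
    · refine Filter.Eventually.of_forall fun n => Continuous.aestronglyMeasurable ?_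
      have := Si_cont
      fun_prop
    · refine Filter.Eventually.of_forall fun n => Filter.Eventually.of_forall fun y => ?_
      rw [norm_mul, Complex.norm_real]
      exact mul_le_mul_of_nonneg_right (Si_bd _) (norm_nonneg _)
    · refine Filter.Eventually.of_forall fun y => ?_
      by_cases hy : y ≤ 1
      · simp [hg, hz y hy]
      · push Not at hy
        refine Filter.Tendsto.mul_const _ ((Complex.continuous_ofReal.tendsto L).comp ?_)
        exact hL.comp (Filter.tendsto_id.atTop_mul_const (by linarith))
  have := tendsto_nhds_unique hlim3 hlim2
  rw [integral_const_mul] at this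
  have := mul_right_cancel₀ hJ0 this
  exact_mod_cast this

lemma Si_tail {r : ℝ} (hr : 0 < r) : |Si r - Real.pi / 2| ≤ 4 / r := by
  have h : Filter.Tendsto (fun n => |Si r - Si n|) Filter.atTop (nhds |Si r - Real.pi / 2|) :=
    (tendsto_const_nhds.sub Si_lim).abs
  refine le_of_tendsto h ?_
  filter_upwards [Filter.eventually_ge_atTop r] with n hn
  rw [abs_sub_comm, Si_sub]
  exact sinc_tail hr hn

end Part9

section Part10

/-! ### Scalar kernels -/

def G0 (b Y t : ℝ) : ℝ := PP b (fun s => Real.cos (s * Y)) t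
def Ak (b k Y t : ℝ) : ℝ := PP b (fun s => Sk k s Y) t

lemma cos_cOn (Y : ℝ) : ContinuousOn (fun s => Real.cos (s * Y)) (Set.Ioi 0) := by fun_prop

lemma G0_t {b : ℝ} (hb : 0 ≤ b) (Y t : ℝ) : |G0 b Y t| ≤ 1 / √|t| :=
  PP_bd hb zero_le_one fun _ _ => Real.abs_cos_le_one _

lemma G0_bt {b : ℝ} (hb : 0 < b) (Y t : ℝ) : |G0 b Y t| ≤ 1 / (b * |t|) :=
  PP_bd' hb zero_le_one fun _ _ => Real.abs_cos_le_one _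

lemma G0_Y {b Y : ℝ} (hb : 0 ≤ b) (hY : Y ≠ 0) (t : ℝ) : |G0 b Y t| ≤ 2 / |Y| :=
  PP_osc' hb (by positivity) (cos_cOn Y) (fun _ _ => Real.abs_cos_le_one _)
    fun p q _ _ => cos_osc hY p q

lemma Ak_bd {b : ℝ} (hb : 0 ≤ b) (k Y t : ℝ) : |Ak b k Y t| ≤ 24 :=
  PP_osc' hb (by norm_num) (Sk_contOn k Y) (fun s hs => Sk_le (reg_pos hb hs) _ _)
    fun p q hp hpq => Sk_osc k Y hp hpq

lemma Ak_t {b k : ℝ} (hb : 0 ≤ b) (hk : k ≠ 0) (Y t : ℝ) : |Ak b k Y t| ≤ (1 / |k|) / √|t| :=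
  PP_bd hb (by positivity) fun s _ => Sk_le_k hk s Y

lemma Ak_Y {b k Y : ℝ} (hb : 0 ≤ b) (hk : k ≠ 0) (hY : Y ≠ 0) (t : ℝ) :
    |Ak b k Y t| ≤ 14 / (|k| * |Y|) :=
  PP_osc' hb (by positivity) (Sk_contOn k Y) (fun s hs => Sk_le (reg_pos hb hs) _ _)
    fun p q hp hpq => Sk_oscY hk hY hp hpq

lemma Si_abs (Y : ℝ) : ∃ e : ℝ, |e| = 1 ∧ ∀ r, Si (r * Y) = e * Si (r * |Y|) := by
  rcases le_total 0 Y with h | h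
  · exact ⟨1, by simp, fun r => by rw [abs_of_nonneg h, one_mul]⟩
  · refine ⟨-1, by simp, fun r => ?_⟩
    rw [abs_of_nonpos h, ← neg_neg (r * Y), Si_neg, mul_neg]; ring

lemma Sk0_osc (Y : ℝ) {p q : ℝ} (hp : 0 < p) (hpq : p ≤ q) :
    ∫ s in p..q, Sk 0 s Y = Si (q * Y) - Si (p * Y) := by
  rw [← sinc_int]
  refine intervalIntegral.integral_congr fun s hs => ?_
  rw [Set.uIcc_of_le hpq] at hs
  exact Sk_zero s Y (hp.trans_le hs.1).ne'

lemma A0_pos_t {b t : ℝ} (hb : 0 < b) (ht : 0 < t) (Y : ℝ) : |Ak b 0 Y t| ≤ (1 / b) / √|t| := by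
  refine PP_bd hb.le (by positivity) fun s hs => ?_
  rw [Preg_pos ht] at hs
  exact (Sk_le_s (hb.trans hs) 0 Y).trans (one_div_le_one_div_of_le hb (le_of_lt hs))

lemma A0_pos_Y {b t Y : ℝ} (hb : 0 < b) (ht : 0 < t) (hY : Y ≠ 0) : |Ak b 0 Y t| ≤ 4 / (b * |Y|) := by
  have hY' := abs_pos.2 hY
  refine PP_osc hb.le (by positivity) (Sk_contOn 0 Y) (fun s hs => Sk_le (reg_pos hb.le hs) _ _) ?_
    fun h => absurd h ht.not_gt
  intro _ p q hp hpq
  have hp0 := hb.trans hp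
  rw [Sk0_osc Y hp0 hpq]
  obtain ⟨e, he, hS⟩ := Si_abs Y
  rw [hS, hS, ← mul_sub, abs_mul, he, one_mul, Si_sub]
  refine (sinc_tail (by positivity) (by gcongr)).trans ?_
  gcongr

lemma mul_exp_le {δ T : ℝ} (hδ : 0 < δ) : T * Real.exp (-δ * T) ≤ 1 / δ := by
  rw [neg_mul, Real.exp_neg, ← div_eq_mul_inv, div_le_div_iff₀ (Real.exp_pos _) hδ]
  have := Real.add_one_le_exp (δ * T)
  nlinarith

lemma sqrt_exp_le {δ T : ℝ} (hδ : 0 < δ) (hT : 0 ≤ T) : √T * Real.exp (-δ * T) ≤ 1 + 1 / δ := by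
  have h1 : √T ≤ 1 + T := by
    rw [Real.sqrt_le_left (by linarith)]; nlinarith
  have h2 := mul_exp_le (T := T) hδ
  have h3 : Real.exp (-δ * T) ≤ 1 := Real.exp_le_one_iff.2 (by nlinarith)
  nlinarith [mul_le_mul_of_nonneg_right h1 (Real.exp_pos (-δ * T)).le]

lemma A0_neg_t {b t : ℝ} (hb : 0 < b) (ht : t < 0) (Y : ℝ) :
    |Ak b 0 Y t| * √|t| ≤ 20 * (1 + 1 / (3 * b ^ 2 / 4)) + 2 / b := by
  have hT := abs_pos.2 ht.ne
  have hi := PP_int hb.le ht.ne (Sk_contOn 0 Y) (fun s hs => Sk_le (reg_pos hb.le hs) _ _) (t := t)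
  rw [Preg_neg ht] at hi
  have hsp : Set.Ioc 0 b = Set.Ioc 0 (b/2) ∪ Set.Ioc (b/2) b :=
    (Set.Ioc_union_Ioc_eq_Ioc (by linarith) (by linarith)).symm
  have hi1 := hi.mono_set (show Set.Ioc 0 (b/2) ⊆ _ by rw [hsp]; exact Set.subset_union_left)
  have hi2 := hi.mono_set (show Set.Ioc (b/2) b ⊆ _ by rw [hsp]; exact Set.subset_union_right)
  have e1 : |∫ s in Set.Ioc 0 (b/2), Sk 0 s Y * Real.exp (-(s ^ 2 - b ^ 2) * t)|
      ≤ 2 * Real.exp (-(3 * b ^ 2 / 4) * |t|) * 10 := by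
    refine lim_Ioc (by positivity) hi1 fun p q hp hpq hq => ?_
    refine osc_gen (Sk_contOn 0 Y) hp hpq _ (fun s hs => Real.exp_le_exp.2 ?_) fun r hr => ?_
    · rw [abs_of_neg ht]
      have h1 : s ≤ b/2 := hs.2.trans hq
      have h0 : 0 < s := hp.trans_le hs.1
      nlinarith [mul_nonneg (neg_nonneg.2 ht.le) (by nlinarith : 0 ≤ b^2/4 - s^2)]
    · rw [Sk0_osc Y hp hr.1, ← sinc_int]; exact sinc_osc _ _ _
  have e2 : |∫ s in Set.Ioc (b/2) b, Sk 0 s Y * Real.exp (-(s ^ 2 - b ^ 2) * t)|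
      ≤ (2 / b) * √(Real.pi / |t|) := by
    rw [← gauss_val t b, ← integral_const_mul]
    refine le_trans ?_ (setIntegral_le_integral (s := Set.Ioc (b/2) b) ((gauss_int ht.ne b).const_mul _)
      (Filter.Eventually.of_forall fun s => by positivity))
    rw [← Real.norm_eq_abs]
    refine norm_integral_le_of_norm_le ((gauss_int ht.ne b).const_mul _).integrableOn ?_
    refine (ae_restrict_iff' measurableSet_Ioc).2 (Filter.Eventually.of_forall fun s hs => ?_)
    have hs0 : 0 < s := by linarith [hs.1]
    have hm : s ∈ Preg b t := by rw [Preg_neg ht]; exact ⟨hs0, hs.2⟩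
    rw [norm_mul, Real.norm_eq_abs, Real.norm_of_nonneg (Real.exp_pos _).le]
    refine mul_le_mul ?_ (Real.exp_le_exp.2 (reg_exp hb.le hm)) (Real.exp_pos _).le (by positivity)
    refine (Sk_le_s hs0 0 Y).trans ?_
    rw [div_le_div_iff₀ hs0 hb]; linarith [hs.1]
  have e3 : |Ak b 0 Y t| ≤ (2 * Real.exp (-(3 * b ^ 2 / 4) * |t|) * 10 + (2 / b) * √(Real.pi / |t|)) / Real.pi := by
    refine PP_abs_le (by positivity) fun _ => ?_
    rw [Preg_neg ht, hsp, setIntegral_union ?_ measurableSet_Ioc hi1 hi2]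
    · exact (abs_add_le _ _).trans (add_le_add e1 e2)
    · rw [Set.disjoint_left]; intro s h1 h2; exact absurd h1.2 (not_le.2 h2.1)
  have hp := Real.pi_gt_three
  have s1 := sqrt_exp_le (by positivity : 0 < 3 * b ^ 2 / 4) hT.le
  have s2 : √(Real.pi / |t|) * √|t| = √Real.pi := by
    rw [← Real.sqrt_mul (by positivity), div_mul_cancel₀ _ hT.ne']
  have s3 : √Real.pi ≤ Real.pi := by
    rw [Real.sqrt_le_left (by linarith)]; nlinarith
  have h0 : 0 ≤ √|t| := Real.sqrt_nonneg _
  calc _ ≤ (2 * Real.exp (-(3 * b ^ 2 / 4) * |t|) * 10 + (2 / b) * √(Real.pi / |t|)) / Real.pi * √|t| :=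
        mul_le_mul_of_nonneg_right e3 h0
    _ = (20 * (√|t| * Real.exp (-(3 * b ^ 2 / 4) * |t|)) + (2 / b) * (√(Real.pi / |t|) * √|t|)) / Real.pi := by ring
    _ ≤ (20 * (1 + 1 / (3 * b ^ 2 / 4)) + (2 / b) * Real.pi) / Real.pi := by
        rw [s2]; gcongr
    _ ≤ _ := by
        rw [add_div, mul_div_cancel_right₀ _ Real.pi_ne_zero]
        gcongr
        exact div_le_self (by positivity) (by linarith)

lemma Sk0_neg (s Y : ℝ) : Sk 0 s (-Y) = - Sk 0 s Y := by
  unfold Sk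
  rw [mul_neg, Real.sin_neg, Real.cos_neg]; ring

lemma A0_odd (b Y t : ℝ) : Ak b 0 (-Y) t = - Ak b 0 Y t := by
  unfold Ak PP
  simp only [Sk0_neg, neg_mul]
  rw [integral_neg]; ring

lemma A0_neg_Y {b t Y : ℝ} (hb : 0 < b) (ht : t < 0) (hY : 0 < Y) :
    |Ak b 0 Y t + 1 / 2 * Real.exp (b ^ 2 * t)| ≤ 20 / (b * Y) := by
  have hT : 0 < -t := by linarith
  set w : ℝ → ℝ := fun s => Real.exp (-(s ^ 2 - b ^ 2) * t) with hw
  set w' : ℝ → ℝ := fun s => -(2 * s) * t * Real.exp (-(s ^ 2 - b ^ 2) * t) with hw'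
  have dF : ∀ s : ℝ, HasDerivAt (fun s => Si (s * Y) - Real.pi / 2) (Y * Real.sinc (s * Y)) s := by
    intro s
    have h1 : HasDerivAt Si (Real.sinc (s * Y)) (s * Y) :=
      intervalIntegral.integral_hasDerivAt_right (sinc_ii _ _)
        (Real.continuous_sinc.stronglyMeasurableAtFilter _ _) Real.continuous_sinc.continuousAt
    have := (h1.comp s ((hasDerivAt_id s).mul_const Y)).sub_const (Real.pi / 2)
    refine this.congr_deriv ?_
    simp; ring
  have cw' : Continuous w' := by fun_prop
  have cs : Continuous (fun s : ℝ => Y * Real.sinc (s * Y)) :=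
    continuous_const.mul (Real.continuous_sinc.comp (by fun_prop))
  have ibp := intervalIntegral.integral_mul_deriv_eq_deriv_mul (a := 0) (b := b)
    (u := w) (u' := w') (v := fun s => Si (s * Y) - Real.pi / 2) (v' := fun s => Y * Real.sinc (s * Y))
    (fun s _ => expw_d b t s) (fun s _ => dF s) (cw'.intervalIntegrable _ _) (cs.intervalIntegrable _ _)
  have hA : Ak b 0 Y t = -1 / Real.pi * ∫ s in (0:ℝ)..b, w s * (Y * Real.sinc (s * Y)) := by
    unfold Ak PP
    rw [Real.sign_of_neg ht, Preg_neg ht, intervalIntegral.integral_of_le hb.le]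
    congr 1
    refine setIntegral_congr_fun measurableSet_Ioc fun s hs => ?_
    simp only [hw]
    rw [Sk_zero s Y hs.1.ne']; ring
  have hw0 : w 0 = Real.exp (b ^ 2 * t) := by simp [hw]
  have hwb : w b = 1 := by simp [hw]
  have hI : Ak b 0 Y t + 1 / 2 * Real.exp (b ^ 2 * t) = -1 / Real.pi * ((Si (b * Y) - Real.pi / 2)
      - ∫ s in (0:ℝ)..b, w' s * (Si (s * Y) - Real.pi / 2)) := by
    rw [hA, ibp, hw0, hwb]
    have : Si (0 * Y) = 0 := by simp [Si]
    rw [this]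
    field_simp
    ring
  have gi := exp_abs_int (mul_pos hb hT) b
  have hJ : |∫ s in (0:ℝ)..b, w' s * (Si (s * Y) - Real.pi / 2)| ≤ 16 / (b * Y) := by
    rw [intervalIntegral.integral_of_le hb.le]
    have : 16 / (b * Y) = ∫ s : ℝ, (8 * (-t) / Y) * Real.exp (-(b * -t) * |s - b|) := by
      rw [integral_const_mul, gi.2]
      have := hT.ne'
      have : t ≠ 0 := ht.ne
      field_simp; norm_num
    rw [this]
    refine le_trans ?_ (setIntegral_le_integral (s := Set.Ioc 0 b) (gi.1.const_mul (8 * (-t) / Y))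
      (Filter.Eventually.of_forall fun s => by positivity))
    rw [← Real.norm_eq_abs]
    refine norm_integral_le_of_norm_le (gi.1.const_mul (8 * (-t) / Y)).integrableOn ?_
    refine (ae_restrict_iff' measurableSet_Ioc).2 (Filter.Eventually.of_forall fun s hs => ?_)
    have hs0 : 0 < s := hs.1
    have hm : s ∈ Preg b t := by rw [Preg_neg ht]; exact hs
    have r1 := reg_exp' hb.le hm
    rw [abs_of_neg ht] at r1
    have r2 := Si_tail (mul_pos hs0 hY)
    simp only [hw']
    rw [norm_mul, norm_mul, Real.norm_eq_abs (Si _ - _), Real.norm_of_nonneg (Real.exp_pos _).le,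
      Real.norm_of_nonneg (by nlinarith)]
    calc _ ≤ -(2 * s) * t * Real.exp (-(b * -t) * |s - b|) * (4 / (s * Y)) := by
          have : 0 ≤ -(2 * s) * t := by nlinarith
          gcongr
      _ = _ := by field_simp; ring
  have hB := Si_tail (mul_pos hb hY)
  have hp := Real.pi_gt_three
  rw [hI, abs_mul]
  have h1 : |-1 / Real.pi| ≤ 1 := by
    rw [abs_div, abs_neg, abs_one, abs_of_pos Real.pi_pos, div_le_one Real.pi_pos]; linarith
  have h2 : |(Si (b * Y) - Real.pi / 2) - ∫ s in (0:ℝ)..b, w' s * (Si (s * Y) - Real.pi / 2)| ≤ 20 / (b * Y) := by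
    refine (abs_sub _ _).trans ((add_le_add hB hJ).trans (le_of_eq ?_))
    rw [← add_div]; norm_num
  calc _ ≤ 1 * (20 / (b * Y)) := mul_le_mul h1 h2 (abs_nonneg _) zero_le_one
    _ = _ := one_mul _

lemma A0_neg_Y' {b t Y : ℝ} (hb : 0 < b) (ht : t < 0) (hY : Y < 0) :
    |Ak b 0 Y t - 1 / 2 * Real.exp (b ^ 2 * t)| ≤ 20 / (b * |Y|) := by
  have := A0_neg_Y hb ht (neg_pos.2 hY)
  rw [A0_odd] at this
  rw [abs_of_neg hY, ← abs_neg]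
  convert this using 2
  ring

end Part10

section Part11

/-! ### The Green function: bounds and decay -/

def Bt (k1 k2 l b : ℝ) (x x' : ℝ × ℝ) : ℝ :=
  if x.2 - x'.2 < 0 then qa k1 k2 l x * qb k1 k2 l x'
    * Real.exp (k2 * (x.1 - x'.1) + (k2 ^ 2 + b ^ 2) * (x.2 - x'.2)) else 0

def GG (k1 k2 l b : ℝ) (x x' : ℝ × ℝ) : ℝ :=
  G0 b (x.1 - x'.1) (x.2 - x'.2)
  + (k2 - k1) * (qa k1 k2 l x * qb k1 k2 l x' * Ak b k2 (x.1 - x'.1) (x.2 - x'.2)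
    - qb k1 k2 l x * qa k1 k2 l x' * Ak b k1 (x.1 - x'.1) (x.2 - x'.2))
  - (k2 - k1) * (iot k2 - iot k1) * Bt k1 k2 l b x x'

lemma B_id (k1 k2 l b : ℝ) (x x' : ℝ × ℝ) : qa k1 k2 l x * qb k1 k2 l x'
    * Real.exp (k2 * (x.1 - x'.1) + (k2 ^ 2 + b ^ 2) * (x.2 - x'.2))
    = qb k1 k2 l x * qa k1 k2 l x'
    * Real.exp (k1 * (x.1 - x'.1) + (k1 ^ 2 + b ^ 2) * (x.2 - x'.2)) := by
  rw [qb_eq, qb_eq]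
  have : Real.exp (sgm k1 k2 l x') * Real.exp (k2 * (x.1 - x'.1) + (k2 ^ 2 + b ^ 2) * (x.2 - x'.2))
    = Real.exp (sgm k1 k2 l x) * Real.exp (k1 * (x.1 - x'.1) + (k1 ^ 2 + b ^ 2) * (x.2 - x'.2)) := by
    rw [← Real.exp_add, ← Real.exp_add]
    congr 1
    unfold sgm; ring
  linear_combination (qa k1 k2 l x * qa k1 k2 l x') * this

lemma qq_le1 (k1 k2 l : ℝ) (x x' : ℝ × ℝ) : qa k1 k2 l x * qb k1 k2 l x' ≤ 1 :=
  mul_le_one₀ (qa_le ..) (qb_pos ..).le (qb_le ..)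
lemma qq_le2 (k1 k2 l : ℝ) (x x' : ℝ × ℝ) : qb k1 k2 l x * qa k1 k2 l x' ≤ 1 :=
  mul_le_one₀ (qb_le ..) (qa_pos ..).le (qa_le ..)
lemma qq_pos1 (k1 k2 l : ℝ) (x x' : ℝ × ℝ) : 0 < qa k1 k2 l x * qb k1 k2 l x' :=
  mul_pos (qa_pos ..) (qb_pos ..)
lemma qq_pos2 (k1 k2 l : ℝ) (x x' : ℝ × ℝ) : 0 < qb k1 k2 l x * qa k1 k2 l x' :=
  mul_pos (qb_pos ..) (qa_pos ..)

lemma Bt_nonneg (k1 k2 l b : ℝ) (x x' : ℝ × ℝ) : 0 ≤ Bt k1 k2 l b x x' := by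
  unfold Bt
  split_ifs
  · exact (mul_pos (qq_pos1 ..) (Real.exp_pos _)).le
  · exact le_rfl

lemma Bt_le {k1 k2 : ℝ} (h : k1 < k2) (h1 : k1 ≤ 0) (h2 : 0 ≤ k2) (l b : ℝ) (x x' : ℝ × ℝ) :
    Bt k1 k2 l b x x' ≤ Real.exp ((b ^ 2 - k1 * k2) * (x.2 - x'.2)) := by
  unfold Bt
  split_ifs with ht
  swap
  · exact (Real.exp_pos _).le
  set X := qa k1 k2 l x * qb k1 k2 l x'
    * Real.exp (k2 * (x.1 - x'.1) + (k2 ^ 2 + b ^ 2) * (x.2 - x'.2)) with hX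
  have hX0 : 0 < X := mul_pos (qq_pos1 ..) (Real.exp_pos _)
  have a1 : Real.log X ≤ k2 * (x.1 - x'.1) + (k2 ^ 2 + b ^ 2) * (x.2 - x'.2) := by
    rw [Real.log_le_iff_le_exp hX0]
    exact mul_le_of_le_one_left (Real.exp_pos _).le (qq_le1 ..)
  have a2 : Real.log X ≤ k1 * (x.1 - x'.1) + (k1 ^ 2 + b ^ 2) * (x.2 - x'.2) := by
    rw [Real.log_le_iff_le_exp hX0, hX, B_id]
    exact mul_le_of_le_one_left (Real.exp_pos _).le (qq_le2 ..)
  rw [← Real.log_le_iff_le_exp hX0]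
  have h3 := mul_le_mul_of_nonneg_left a1 (neg_nonneg.2 h1)
  have h4 := mul_le_mul_of_nonneg_left a2 h2
  have : (k2 - k1) * Real.log X ≤ (k2 - k1) * ((b ^ 2 - k1 * k2) * (x.2 - x'.2)) := by linarith
  exact le_of_mul_le_mul_left this (by linarith)

lemma Bt_le_one {k1 k2 : ℝ} (h : k1 < k2) (h1 : k1 ≤ 0) (h2 : 0 ≤ k2) (l b : ℝ) (x x' : ℝ × ℝ) :
    Bt k1 k2 l b x x' ≤ 1 := by
  by_cases ht : x.2 - x'.2 < 0
  · refine (Bt_le h h1 h2 l b x x').trans (Real.exp_le_one_iff.2 ?_)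
    nlinarith [mul_nonneg (neg_nonneg.2 h1) h2, mul_nonneg (neg_nonneg.2 ht.le) (by nlinarith [mul_nonneg (neg_nonneg.2 h1) h2] : 0 ≤ b ^ 2 - k1 * k2)]
  · simp [Bt, ht]

lemma iot_cases {k1 k2 : ℝ} (h : k1 < k2) : iot k1 = iot k2 ∨ (k1 ≤ 0 ∧ 0 ≤ k2) := by
  by_cases h1 : 0 < k1
  · left; simp [iot, h1, h1.trans h]
  by_cases h2 : k2 < 0
  · left; simp [iot, h1, h2.not_gt, h2.ne, (h.trans h2).ne]
  · right; exact ⟨not_lt.1 h1, not_lt.1 h2⟩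

lemma iot_bd (k : ℝ) : 0 ≤ iot k ∧ iot k ≤ 1 := by
  unfold iot; split_ifs <;> norm_num

lemma GG_bd {k1 k2 b : ℝ} (h : k1 ≤ k2) (hb : 0 ≤ b) (l : ℝ) (x x' : ℝ × ℝ) :
    |GG k1 k2 l b x x'| ≤ 1 / √|x.2 - x'.2| + 49 * (k2 - k1) := by
  have hc : 0 ≤ k2 - k1 := by linarith
  have a0 := G0_t hb (x.1 - x'.1) (x.2 - x'.2)
  have a1 : |qa k1 k2 l x * qb k1 k2 l x' * Ak b k2 (x.1 - x'.1) (x.2 - x'.2)| ≤ 24 := by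
    rw [abs_mul, abs_of_pos (qq_pos1 ..)]
    exact (mul_le_of_le_one_left (abs_nonneg _) (qq_le1 ..)).trans (Ak_bd hb _ _ _)
  have a2 : |qb k1 k2 l x * qa k1 k2 l x' * Ak b k1 (x.1 - x'.1) (x.2 - x'.2)| ≤ 24 := by
    rw [abs_mul, abs_of_pos (qq_pos2 ..)]
    exact (mul_le_of_le_one_left (abs_nonneg _) (qq_le2 ..)).trans (Ak_bd hb _ _ _)
  have a3 : |(k2 - k1) * (iot k2 - iot k1) * Bt k1 k2 l b x x'| ≤ k2 - k1 := by
    rcases h.eq_or_lt with rfl | h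
    · simp
    rcases iot_cases h with he | ⟨h1, h2⟩
    · rw [he]; simpa using hc
    · rw [mul_assoc, abs_mul, abs_of_nonneg hc, abs_mul, abs_of_nonneg (Bt_nonneg ..)]
      refine mul_le_of_le_one_right hc (mul_le_one₀ ?_ (Bt_nonneg ..) (Bt_le_one h h1 h2 ..))
      rw [abs_le]
      have := iot_bd k1; have := iot_bd k2
      constructor <;> linarith
  have a4 : |(k2 - k1) * (qa k1 k2 l x * qb k1 k2 l x' * Ak b k2 (x.1 - x'.1) (x.2 - x'.2)
    - qb k1 k2 l x * qa k1 k2 l x' * Ak b k1 (x.1 - x'.1) (x.2 - x'.2))| ≤ (k2 - k1) * 48 := by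
    rw [abs_mul, abs_of_nonneg hc]
    refine mul_le_mul_of_nonneg_left ((abs_sub _ _).trans ?_) hc
    linarith
  unfold GG
  refine (abs_sub _ _).trans ?_
  have := abs_add_le (G0 b (x.1 - x'.1) (x.2 - x'.2)) ((k2 - k1) * (qa k1 k2 l x * qb k1 k2 l x' * Ak b k2 (x.1 - x'.1) (x.2 - x'.2)
    - qb k1 k2 l x * qa k1 k2 l x' * Ak b k1 (x.1 - x'.1) (x.2 - x'.2)))
  linarith

lemma PP_zero (b : ℝ) (f : ℝ → ℝ) : PP b f 0 = 0 := by simp [PP]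

lemma GG_zero {k1 k2 l b : ℝ} {x x' : ℝ × ℝ} (h : x.2 = x'.2) : GG k1 k2 l b x x' = 0 := by
  simp [GG, G0, Ak, Bt, h, PP_zero]

/-- decay at infinity -/
def DecP (x' : ℝ × ℝ) (f : ℝ × ℝ → ℝ) : Prop :=
  ∃ C, ∀ x, √|x.2 - x'.2| * |f x| ≤ C ∧ |x.1 - x'.1| * |f x| ≤ C

lemma DecP.add {x' : ℝ × ℝ} {f g : ℝ × ℝ → ℝ} (hf : DecP x' f) (hg : DecP x' g) :
    DecP x' (fun x => f x + g x) := by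
  obtain ⟨C, hC⟩ := hf
  obtain ⟨D, hD⟩ := hg
  refine ⟨C + D, fun x => ?_⟩
  have h1 := abs_add_le (f x) (g x)
  have h2 := hC x
  have h3 := hD x
  constructor
  · have := mul_le_mul_of_nonneg_left h1 (Real.sqrt_nonneg |x.2 - x'.2|); linarith
  · have := mul_le_mul_of_nonneg_left h1 (abs_nonneg (x.1 - x'.1)); linarith

lemma DecP.mul {x' : ℝ × ℝ} {f g : ℝ × ℝ → ℝ} (hf : DecP x' f) {K : ℝ} (hK : ∀ x, |g x| ≤ K) :
    DecP x' (fun x => g x * f x) := by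
  obtain ⟨C, hC⟩ := hf
  refine ⟨K * C, fun x => ?_⟩
  have hK0 : 0 ≤ K := (abs_nonneg _).trans (hK x)
  rw [abs_mul]
  have h0 := hC x
  constructor
  · calc √|x.2 - x'.2| * (|g x| * |f x|) = |g x| * (√|x.2 - x'.2| * |f x|) := by ring
      _ ≤ K * C := mul_le_mul (hK x) h0.1 (by positivity) hK0
  · calc |x.1 - x'.1| * (|g x| * |f x|) = |g x| * (|x.1 - x'.1| * |f x|) := by ring
      _ ≤ K * C := mul_le_mul (hK x) h0.2 (by positivity) hK0

lemma DecP.congr' {x' : ℝ × ℝ} {f g : ℝ × ℝ → ℝ} (hf : DecP x' f) (h : ∀ x, g x = f x) : DecP x' g := by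
  obtain rfl : g = f := funext h
  exact hf

lemma DecP.tendsto {x' : ℝ × ℝ} {f : ℝ × ℝ → ℝ} (hf : DecP x' f) :
    Filter.Tendsto f (Filter.cocompact (ℝ × ℝ)) (nhds 0) := by
  obtain ⟨C, hC⟩ := hf
  rw [Metric.tendsto_nhds]
  intro ε hε
  set M := |C| / ε + 1 with hM
  have hM0 : 0 < M := by positivity
  have hM1 : C < M * ε := by
    rw [hM, add_mul, div_mul_cancel₀ _ hε.ne']; have := le_abs_self C; linarith
  have hK : IsCompact (Set.Icc (x'.1 - M) (x'.1 + M) ×ˢ Set.Icc (x'.2 - M ^ 2) (x'.2 + M ^ 2)) :=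
    isCompact_Icc.prod isCompact_Icc
  filter_upwards [hK.compl_mem_cocompact] with x hx
  rw [dist_zero_right, Real.norm_eq_abs]
  by_contra hn
  push Not at hn
  refine hx ⟨?_, ?_⟩
  · have : |x.1 - x'.1| ≤ M := by
      by_contra h; push Not at h
      have := mul_le_mul h.le hn hε.le (abs_nonneg _)
      linarith [(hC x).2]
    rw [abs_le] at this
    constructor <;> linarith
  · have : √|x.2 - x'.2| ≤ M := by
      by_contra h; push Not at h
      have := mul_le_mul h.le hn hε.le (Real.sqrt_nonneg _)
      linarith [(hC x).1]
    rw [Real.sqrt_le_left hM0.le, abs_le] at this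
    constructor <;> linarith

lemma sqrt_mul_le {t a C : ℝ} (hC : 0 ≤ C) (h : a ≤ C / √|t|) : √|t| * a ≤ C := by
  rcases eq_or_ne t 0 with rfl | ht
  · simpa using hC
  have : 0 < √|t| := Real.sqrt_pos.2 (abs_pos.2 ht)
  rw [mul_comm]; rwa [le_div_iff₀ this] at h

lemma abs_mul_le {Y a C : ℝ} (hC : 0 ≤ C) (h : Y ≠ 0 → a ≤ C / |Y|) : |Y| * a ≤ C := by
  rcases eq_or_ne Y 0 with rfl | hY
  · simpa using hC
  have h := h hY
  rw [mul_comm]; rwa [le_div_iff₀ (abs_pos.2 hY)] at h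

lemma G0_dec {b : ℝ} (hb : 0 ≤ b) (x' : ℝ × ℝ) :
    DecP x' (fun x => G0 b (x.1 - x'.1) (x.2 - x'.2)) := by
  refine ⟨2, fun x => ⟨?_, abs_mul_le (by norm_num) fun hY => G0_Y hb hY _⟩⟩
  exact (sqrt_mul_le zero_le_one (G0_t hb _ _)).trans (by norm_num)

lemma Ak_dec {b k : ℝ} (hb : 0 ≤ b) (hk : k ≠ 0) (x' : ℝ × ℝ) :
    DecP x' (fun x => Ak b k (x.1 - x'.1) (x.2 - x'.2)) := by
  have hk' := abs_pos.2 hk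
  refine ⟨14 / |k|, fun x => ⟨?_, abs_mul_le (by positivity) fun hY => ?_⟩⟩
  · refine (sqrt_mul_le (by positivity) (Ak_t hb hk _ _)).trans ?_
    gcongr; norm_num
  · rw [div_div]; exact Ak_Y hb hk hY _

lemma Bt_dec {k1 k2 : ℝ} (h1 : k1 < 0) (h2 : 0 < k2) (l b : ℝ) (x' : ℝ × ℝ) :
    DecP x' (fun x => Bt k1 k2 l b x x') := by
  have hd : 0 < b ^ 2 - k1 * k2 := by nlinarith [mul_pos (neg_pos.2 h1) h2, sq_nonneg b]
  have i1 : 0 < 1 / -k1 := one_div_pos.2 (neg_pos.2 h1)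
  have i2 : 0 < 1 / k2 := one_div_pos.2 h2
  have i3 : 0 < 1 / (b ^ 2 - k1 * k2) := one_div_pos.2 hd
  refine ⟨1 + 1 / (b ^ 2 - k1 * k2) + 1 / k2 + 1 / (-k1), fun x => ?_⟩
  simp only [abs_of_nonneg (Bt_nonneg k1 k2 l b x x')]
  by_cases ht : x.2 - x'.2 < 0
  swap
  · simp only [Bt, ht, if_false, mul_zero]
    constructor <;> linarith
  constructor
  · have := sqrt_exp_le hd (abs_nonneg (x.2 - x'.2))
    have hB := Bt_le (h1.trans h2) h1.le h2.le l b x x'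
    have e : -(b ^ 2 - k1 * k2) * |x.2 - x'.2| = (b ^ 2 - k1 * k2) * (x.2 - x'.2) := by
      rw [abs_of_neg ht]; ring
    rw [e] at this
    have := mul_le_mul_of_nonneg_left hB (Real.sqrt_nonneg |x.2 - x'.2|)
    linarith
  · rcases le_total 0 (x.1 - x'.1) with hY | hY
    · have : Bt k1 k2 l b x x' ≤ Real.exp (-(-k1) * (x.1 - x'.1)) := by
        unfold Bt
        rw [if_pos ht, B_id]
        refine (mul_le_of_le_one_left (Real.exp_pos _).le (qq_le2 ..)).trans (Real.exp_le_exp.2 ?_)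
        nlinarith [sq_nonneg k1, sq_nonneg b, mul_nonneg (by positivity : 0 ≤ k1 ^ 2 + b ^ 2) (neg_nonneg.2 ht.le)]
      have h3 := mul_le_mul_of_nonneg_left this hY
      have h4 := mul_exp_le (T := x.1 - x'.1) (neg_pos.2 h1)
      rw [abs_of_nonneg hY]; linarith
    · have : Bt k1 k2 l b x x' ≤ Real.exp (-k2 * (-(x.1 - x'.1))) := by
        unfold Bt
        rw [if_pos ht]
        refine (mul_le_of_le_one_left (Real.exp_pos _).le (qq_le1 ..)).trans (Real.exp_le_exp.2 ?_)
        nlinarith [sq_nonneg k2, sq_nonneg b, mul_nonneg (by positivity : 0 ≤ k2 ^ 2 + b ^ 2) (neg_nonneg.2 ht.le)]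
      have h3 := mul_le_mul_of_nonneg_left this (neg_nonneg.2 hY)
      have h4 := mul_exp_le (T := -(x.1 - x'.1)) h2
      rw [abs_of_nonpos hY]; linarith

/-- common estimate for the degenerate case -/
lemma deg_dec {b : ℝ} (hb : 0 < b) (x' : ℝ × ℝ) (e c K : ℝ) (he : |e| = 1) (hc : 0 < c) (hK : 0 ≤ K)
    (q : ℝ × ℝ → ℝ) (q0 : ∀ x, 0 ≤ q x) (q1 : ∀ x, q x ≤ 1)
    (hq : ∀ x, x.2 - x'.2 < 0 → 0 < -e * (x.1 - x'.1) → q x ≤ K * Real.exp (-c * |x.1 - x'.1|)) :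
    DecP x' (fun x => q x * (Ak b 0 (x.1 - x'.1) (x.2 - x'.2)
      + e * (1 / 2) * (if x.2 - x'.2 < 0 then Real.exp (b ^ 2 * (x.2 - x'.2)) else 0))) := by
  set D1 := 20 * (1 + 1 / (3 * b ^ 2 / 4)) + 2 / b with hD1
  have hD10 : 0 ≤ D1 := by positivity
  refine ⟨D1 + (1 + 1 / b ^ 2) + 20 / b + K / c, fun x => ?_⟩
  have p1 : 0 ≤ 1 + 1 / b ^ 2 := by positivity
  have p2 : 0 ≤ 20 / b := by positivity
  have p3 : 0 ≤ K / c := by positivity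
  rw [abs_mul, abs_of_nonneg (q0 x)]
  set Y := x.1 - x'.1 with hY
  set t := x.2 - x'.2 with ht
  rcases lt_trichotomy t 0 with h | h | h
  · rw [if_pos h]
    constructor
    · have e1 : |Ak b 0 Y t + e * (1 / 2) * Real.exp (b ^ 2 * t)| ≤ |Ak b 0 Y t| + Real.exp (b ^ 2 * t) := by
        refine (abs_add_le _ _).trans ?_
        rw [abs_mul, abs_mul, he, abs_of_pos (Real.exp_pos _)]
        have := Real.exp_pos (b ^ 2 * t)
        norm_num
        linarith
      have e2 := A0_neg_t hb h Y
      have e3 := sqrt_exp_le (by positivity : 0 < b ^ 2) (abs_nonneg t)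
      rw [show -b ^ 2 * |t| = b ^ 2 * t by rw [abs_of_neg h]; ring] at e3
      calc _ ≤ √|t| * (1 * (|Ak b 0 Y t| + Real.exp (b ^ 2 * t))) := by
            gcongr
            exact q1 x
        _ = |Ak b 0 Y t| * √|t| + √|t| * Real.exp (b ^ 2 * t) := by ring
        _ ≤ _ := by linarith
    · -- good side or bad side
      have he' : e = 1 ∨ e = -1 := by
        rcases abs_cases e with ⟨h1, _⟩ | ⟨h1, _⟩
        · left; linarith
        · right; linarith
      have ex1 : Real.exp (b ^ 2 * t) ≤ 1 := Real.exp_le_one_iff.2 (by nlinarith [sq_nonneg b])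
      have main : ∀ σ : ℝ, |σ| = 1 → 0 < σ * Y →
          |Ak b 0 Y t + σ * (1 / 2) * Real.exp (b ^ 2 * t)| ≤ 20 / b / |Y| := by
        intro σ hσ hσY
        rw [div_div]
        rcases lt_trichotomy Y 0 with hy | hy | hy
        · have : σ = -1 := by
            rcases abs_cases σ with ⟨h1, _⟩ | ⟨h1, _⟩
            · nlinarith
            · linarith
          rw [this]
          convert A0_neg_Y' hb h hy using 2; ring
        · rw [hy] at hσY; simp at hσY
        · have : σ = 1 := by
            rcases abs_cases σ with ⟨h1, _⟩ | ⟨h1, _⟩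
            · linarith
            · nlinarith
          rw [this, abs_of_pos hy]
          convert A0_neg_Y hb h hy using 2; ring
      rcases eq_or_ne Y 0 with hy | hy
      · rw [hy, abs_zero, zero_mul]; linarith
      have hYp := abs_pos.2 hy
      by_cases hs : 0 < e * Y
      · have := main e he hs
        rw [le_div_iff₀ hYp] at this
        calc _ ≤ |Y| * (1 * |Ak b 0 Y t + e * (1 / 2) * Real.exp (b ^ 2 * t)|) := by
              gcongr; exact q1 x
          _ ≤ _ := by linarith
      · have hs' : 0 < -e * Y := by
          have : e * Y ≠ 0 := mul_ne_zero (by intro h0; simp [h0] at he) hy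
          have : e * Y < 0 := lt_of_le_of_ne (not_lt.1 hs) this
          linarith
        have m := main (-e) (by rwa [abs_neg]) hs'
        rw [le_div_iff₀ hYp] at m
        have hqx := hq x h hs'
        have s1 : |Ak b 0 Y t + e * (1 / 2) * Real.exp (b ^ 2 * t)|
            ≤ |Ak b 0 Y t + -e * (1 / 2) * Real.exp (b ^ 2 * t)| + 1 := by
          have : Ak b 0 Y t + e * (1 / 2) * Real.exp (b ^ 2 * t)
            = (Ak b 0 Y t + -e * (1 / 2) * Real.exp (b ^ 2 * t)) + e * Real.exp (b ^ 2 * t) := by ring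
          rw [this]
          refine (abs_add_le _ _).trans ?_
          rw [abs_mul e, he, one_mul, abs_of_pos (Real.exp_pos _)]
          linarith
        have s2 := mul_exp_le (T := |Y|) hc
        calc _ ≤ |Y| * (q x * (|Ak b 0 Y t + -e * (1 / 2) * Real.exp (b ^ 2 * t)| + 1)) := by
              have := q0 x
              gcongr
          _ = q x * (|Ak b 0 Y t + -e * (1 / 2) * Real.exp (b ^ 2 * t)| * |Y|) + |Y| * q x := by ring
          _ ≤ 1 * (20 / b) + |Y| * (K * Real.exp (-c * |Y|)) := by
              refine add_le_add (mul_le_mul (q1 x) m (by positivity) zero_le_one) ?_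
              exact mul_le_mul_of_nonneg_left hqx hYp.le
          _ = 20 / b + K * (|Y| * Real.exp (-c * |Y|)) := by ring
          _ ≤ 20 / b + K * (1 / c) := by gcongr
          _ = 20 / b + K / c := by ring
          _ ≤ _ := by linarith
  · rw [h]; simp [Ak, PP_zero]; positivity
  · rw [if_neg h.not_gt, mul_zero, add_zero]
    have q1x := q1 x
    have q0x := q0 x
    constructor
    · have e1 := sqrt_mul_le (by positivity) (A0_pos_t hb h Y)
      have e2 : 1 / b ≤ 20 / b := by gcongr; norm_num
      calc _ ≤ √|t| * (1 * |Ak b 0 Y t|) := by gcongr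
        _ ≤ _ := by linarith
    · have e1 : |Y| * |Ak b 0 Y t| ≤ 4 / b := abs_mul_le (by positivity) fun hY => by
        rw [div_div]; exact A0_pos_Y hb h hY
      have e2 : 4 / b ≤ 20 / b := by gcongr; norm_num
      calc _ ≤ |Y| * (1 * |Ak b 0 Y t|) := by gcongr
        _ ≤ _ := by linarith

lemma GG_dec {k1 k2 b : ℝ} (h : k1 ≤ k2) (hb : 0 ≤ b) (n1 : k1 = 0 → 0 < b) (n2 : k2 = 0 → 0 < b)
    (l : ℝ) (x' : ℝ × ℝ) : DecP x' (fun x => GG k1 k2 l b x x') := by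
  have hG := G0_dec hb x'
  rcases h.eq_or_lt with rfl | h
  · simpa [GG] using hG
  have ba : ∀ r x, |r * (qa k1 k2 l x * qb k1 k2 l x')| ≤ |r| := fun r x => by
    rw [abs_mul, abs_of_pos (qq_pos1 ..)]
    exact mul_le_of_le_one_right (abs_nonneg _) (qq_le1 ..)
  have bb : ∀ r x, |r * (qb k1 k2 l x * qa k1 k2 l x')| ≤ |r| := fun r x => by
    rw [abs_mul, abs_of_pos (qq_pos2 ..)]
    exact mul_le_of_le_one_right (abs_nonneg _) (qq_le2 ..)
  rcases eq_or_ne k2 0 with h2 | h2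
  · have hb0 := n2 h2
    have A1 := (Ak_dec hb (by linarith : k1 ≠ 0) x').mul (bb (-(k2 - k1)))
    have A2 := deg_dec hb0 x' (-1) (k2 - k1) (Real.exp (-sgm k1 k2 l x')) (by simp) (by linarith)
      (Real.exp_pos _).le (fun x => qa k1 k2 l x * qb k1 k2 l x') (fun x => (qq_pos1 ..).le)
      (fun x => qq_le1 ..) (by
        intro x ht hY
        refine (mul_le_of_le_one_right (qa_pos ..).le (qb_le ..)).trans ?_
        rw [← Real.exp_add]
        have : qa k1 k2 l x ≤ Real.exp (-sgm k1 k2 l x) := by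
          unfold qa
          rw [Real.exp_neg]
          exact inv_anti₀ (Real.exp_pos _) (by linarith)
        refine this.trans (Real.exp_le_exp.2 ?_)
        have hY : 0 < x.1 - x'.1 := by linarith
        rw [abs_of_pos hY]
        unfold sgm
        rw [h2]
        nlinarith [sq_nonneg k1])
    have A3 := (A2.mul (g := fun _ => k2 - k1) (K := |k2 - k1|) fun _ => le_rfl)
    refine ((hG.add A1).add A3).congr' fun x => ?_
    have i2 : iot k2 = 1 / 2 := by simp [iot, h2]
    have i1 : iot k1 = 0 := by simp [iot, (by linarith : ¬ 0 < k1), (by linarith : k1 ≠ 0)]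
    simp only [GG, i1, i2, Bt]
    rw [h2]
    split_ifs <;> ring_nf
  rcases eq_or_ne k1 0 with h1 | h1
  · have hb0 := n1 h1
    have A1 := (Ak_dec hb h2 x').mul (ba (k2 - k1))
    have A2 := deg_dec hb0 x' 1 (k2 - k1) (Real.exp (sgm k1 k2 l x')) (by simp) (by linarith)
      (Real.exp_pos _).le (fun x => qb k1 k2 l x * qa k1 k2 l x') (fun x => (qq_pos2 ..).le)
      (fun x => qq_le2 ..) (by
        intro x ht hY
        refine (mul_le_of_le_one_right (qb_pos ..).le (qa_le ..)).trans ?_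
        rw [← Real.exp_add]
        have : qb k1 k2 l x ≤ Real.exp (sgm k1 k2 l x) := by
          rw [qb_eq]
          exact mul_le_of_le_one_right (Real.exp_pos _).le (qa_le ..)
        refine this.trans (Real.exp_le_exp.2 ?_)
        have hY : x.1 - x'.1 < 0 := by linarith
        rw [abs_of_neg hY]
        unfold sgm
        rw [h1]
        nlinarith [sq_nonneg k2])
    have A3 := (A2.mul (g := fun _ => -(k2 - k1)) (K := |-(k2 - k1)|) fun _ => le_rfl)
    refine ((hG.add A1).add A3).congr' fun x => ?_
    have i1 : iot k1 = 1 / 2 := by simp [iot, h1]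
    have i2 : iot k2 = 1 := by simp [iot, (by linarith : 0 < k2)]
    simp only [GG, i1, i2, Bt, B_id]
    rw [h1]
    split_ifs <;> ring_nf
  · have A1 := (Ak_dec hb h1 x').mul (bb (-(k2 - k1)))
    have A2 := (Ak_dec hb h2 x').mul (ba (k2 - k1))
    have A3 : DecP x' (fun x => -((k2 - k1) * (iot k2 - iot k1)) * Bt k1 k2 l b x x') := by
      rcases iot_cases h with he | ⟨g1, g2⟩
      · refine ⟨0, fun x => ?_⟩
        simp [he]
      · exact (Bt_dec (lt_of_le_of_ne g1 h1) (lt_of_le_of_ne g2 h2.symm) l b x').mul (fun _ => le_rfl)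
    refine ((hG.add A1).add (A2.add A3)).congr' fun x => ?_
    simp only [GG]
    ring

end Part11

section Part12

/-! ### Joint continuity of the Green function off the diagonal times -/

lemma PP_contAt {b : ℝ} (hb : 0 ≤ b) {f : ℝ → ℝ → ℝ} (hfs : ∀ Y, ContinuousOn (fun s => f s Y) (Set.Ioi 0))
    (hfY : ∀ s, Continuous (f s)) {K : ℝ} (hK : ∀ s Y, 0 < s → |f s Y| ≤ |Y| + K) (Y0 t0 : ℝ) (ht : t0 ≠ 0) :
    ContinuousAt (fun p : ℝ × ℝ => PP b (fun s => f s p.1) p.2) (Y0, t0) := by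
  have hev : ∀ᶠ p : ℝ × ℝ in nhds (Y0, t0), |t0| / 2 < |p.2| ∧ |p.1| < |Y0| + 1 ∧ 0 < t0 * p.2 := by
    have c2 : ContinuousAt (fun p : ℝ × ℝ => |p.2|) (Y0, t0) := by fun_prop
    have c1 : ContinuousAt (fun p : ℝ × ℝ => |p.1|) (Y0, t0) := by fun_prop
    have c3 : ContinuousAt (fun p : ℝ × ℝ => t0 * p.2) (Y0, t0) := by fun_prop
    have e1 := c2.eventually (lt_mem_nhds (a := |t0| / 2) (b := |t0|) (by have := abs_pos.2 ht; linarith))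
    have e2 := c1.eventually (gt_mem_nhds (show |Y0| < |Y0| + 1 by linarith))
    have e3 := c3.eventually (lt_mem_nhds (a := 0) (b := t0 * t0) (mul_self_pos.2 ht))
    filter_upwards [e1, e2, e3] with p h1 h2 h3 using ⟨h1, h2, h3⟩
  have hPr : ∀ p : ℝ × ℝ, 0 < t0 * p.2 → Preg b p.2 = Preg b t0 ∧ Real.sign p.2 = Real.sign t0 := by
    intro p hp
    rcases lt_or_gt_of_ne ht with h | h
    · have : p.2 < 0 := by
        by_contra hc
        push Not at hc
        nlinarith
      rw [Preg_neg h, Preg_neg this, Real.sign_of_neg h, Real.sign_of_neg this]; simp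
    · have : 0 < p.2 := by
        by_contra hc
        push Not at hc
        nlinarith
      rw [Preg_pos h, Preg_pos this, Real.sign_of_pos h, Real.sign_of_pos this]; simp
  have key : ContinuousAt (fun p : ℝ × ℝ => ∫ s in Preg b t0, f s p.1 * Real.exp (-(s ^ 2 - b ^ 2) * p.2)) (Y0, t0) := by
    refine continuousAt_of_dominated (bound := fun s => (|Y0| + 1 + |K|) * Real.exp (-|t0 / 2| * (s - b) ^ 2)) ?_ ?_ ?_ ?_
    · filter_upwards [hev] with p hp
      rw [← (hPr p hp.2.2).1]
      exact PP_meas hb (hfs p.1)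
    · filter_upwards [hev] with p hp
      refine (ae_restrict_iff' (Preg_ms b t0)).2 (Filter.Eventually.of_forall fun s hs => ?_)
      have h1 := hK s p.1 (reg_pos hb hs)
      have hs' : s ∈ Preg b p.2 := by rw [(hPr p hp.2.2).1]; exact hs
      have h2 := reg_exp hb hs'
      rw [Real.norm_eq_abs, abs_mul, abs_of_pos (Real.exp_pos _)]
      refine mul_le_mul (by linarith [hp.2.1, le_abs_self K]) (Real.exp_le_exp.2 (h2.trans ?_)) (Real.exp_pos _).le (by positivity)
      have : |t0 / 2| = |t0| / 2 := by rw [abs_div]; simp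
      rw [this]
      nlinarith [sq_nonneg (s - b), hp.1]
    · exact ((gauss_int (div_ne_zero ht two_ne_zero) b).const_mul _).integrableOn
    · refine Filter.Eventually.of_forall fun s => ?_
      have := hfY s
      fun_prop
  refine ((continuousAt_const (y := Real.sign t0 / Real.pi)).mul key).congr ?_
  filter_upwards [hev] with p hp
  unfold PP
  rw [(hPr p hp.2.2).1, (hPr p hp.2.2).2]; rfl

lemma G0_contAt {b : ℝ} (hb : 0 ≤ b) (Y0 t0 : ℝ) (ht : t0 ≠ 0) :
    ContinuousAt (fun p : ℝ × ℝ => G0 b p.1 p.2) (Y0, t0) :=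
  PP_contAt hb (f := fun s Y => Real.cos (s * Y)) (fun Y => by fun_prop) (fun s => by fun_prop) (K := 1)
    (fun s Y _ => by have := Real.abs_cos_le_one (s * Y); have := abs_nonneg Y; linarith) Y0 t0 ht

lemma Ak_contAt {b : ℝ} (hb : 0 ≤ b) (k Y0 t0 : ℝ) (ht : t0 ≠ 0) :
    ContinuousAt (fun p : ℝ × ℝ => Ak b k p.1 p.2) (Y0, t0) :=
  PP_contAt hb (f := fun s Y => Sk k s Y) (fun Y => Sk_contOn k Y) (fun s => Sk_contY k s) (K := |k|⁻¹)
    (fun s Y hs => Sk_le hs k Y) Y0 t0 ht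

lemma GG_contAt {b : ℝ} (hb : 0 ≤ b) (k1 k2 l : ℝ) (z : (ℝ × ℝ) × (ℝ × ℝ)) (hz : z.1.2 ≠ z.2.2) :
    ContinuousAt (fun z : (ℝ × ℝ) × (ℝ × ℝ) => GG k1 k2 l b z.1 z.2) z := by
  have hz' : z.1.2 - z.2.2 ≠ 0 := sub_ne_zero.2 hz
  have hd : ContinuousAt (fun z : (ℝ × ℝ) × (ℝ × ℝ) => (z.1.1 - z.2.1, z.1.2 - z.2.2)) z := by fun_prop
  have c0 : ContinuousAt (fun z : (ℝ × ℝ) × (ℝ × ℝ) => G0 b (z.1.1 - z.2.1) (z.1.2 - z.2.2)) z :=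
    ContinuousAt.comp (g := fun p : ℝ × ℝ => G0 b p.1 p.2) (f := fun z : (ℝ × ℝ) × (ℝ × ℝ) => (z.1.1 - z.2.1, z.1.2 - z.2.2)) (G0_contAt hb _ _ hz') hd
  have ca : ∀ k, ContinuousAt (fun z : (ℝ × ℝ) × (ℝ × ℝ) => Ak b k (z.1.1 - z.2.1) (z.1.2 - z.2.2)) z := fun k =>
    ContinuousAt.comp (g := fun p : ℝ × ℝ => Ak b k p.1 p.2) (f := fun z : (ℝ × ℝ) × (ℝ × ℝ) => (z.1.1 - z.2.1, z.1.2 - z.2.2)) (Ak_contAt hb k _ _ hz') hd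
  have qA := qa_cont k1 k2 l
  have qB := qb_cont k1 k2 l
  have a1 : ContinuousAt (fun z : (ℝ × ℝ) × (ℝ × ℝ) => qa k1 k2 l z.1 * qb k1 k2 l z.2) z := by fun_prop
  have a2 : ContinuousAt (fun z : (ℝ × ℝ) × (ℝ × ℝ) => qb k1 k2 l z.1 * qa k1 k2 l z.2) z := by fun_prop
  have cB : ContinuousAt (fun z : (ℝ × ℝ) × (ℝ × ℝ) => Bt k1 k2 l b z.1 z.2) z := by
    have cs : ContinuousAt (fun z : (ℝ × ℝ) × (ℝ × ℝ) => z.1.2 - z.2.2) z := by fun_prop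
    rcases lt_or_gt_of_ne hz' with h | h
    · have : ContinuousAt (fun z : (ℝ × ℝ) × (ℝ × ℝ) => qa k1 k2 l z.1 * qb k1 k2 l z.2
        * Real.exp (k2 * (z.1.1 - z.2.1) + (k2 ^ 2 + b ^ 2) * (z.1.2 - z.2.2))) z := by fun_prop
      refine this.congr ?_
      filter_upwards [cs.eventually (gt_mem_nhds h)] with w hw
      simp only [Bt, if_pos hw]
    · refine (continuousAt_const (y := (0:ℝ))).congr ?_
      filter_upwards [cs.eventually (lt_mem_nhds h)] with w hw
      simp only [Bt, if_neg (not_lt.2 (le_of_lt hw))]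
  exact (c0.add (continuousAt_const.mul ((a1.mul (ca k2)).sub (a2.mul (ca k1))))).sub (continuousAt_const.mul cB)

/-- abstract kernels -/
structure Ker (G : ℝ × ℝ → ℝ × ℝ → ℝ) (K : ℝ) : Prop where
  bd : ∀ x x', |G x x'| ≤ K * (1 / √|x.2 - x'.2| + 1)
  zero : ∀ x x' : ℝ × ℝ, x.2 = x'.2 → G x x' = 0
  cont : ∀ z : (ℝ × ℝ) × (ℝ × ℝ), z.1.2 ≠ z.2.2 → ContinuousAt (fun z : (ℝ × ℝ) × (ℝ × ℝ) => G z.1 z.2) z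
  dec : ∀ x', Filter.Tendsto (fun x => G x x') (Filter.cocompact (ℝ × ℝ)) (nhds 0)

lemma GG_ker {k1 k2 b : ℝ} (h : k1 ≤ k2) (hb : 0 ≤ b) (n1 : k1 = 0 → 0 < b) (n2 : k2 = 0 → 0 < b)
    (l : ℝ) : Ker (GG k1 k2 l b) (1 + 49 * (k2 - k1)) where
  bd x x' := by
    refine (GG_bd h hb l x x').trans ?_
    have : 0 ≤ 1 / √|x.2 - x'.2| := by positivity
    nlinarith
  zero _ _ h := GG_zero h
  cont z hz := GG_contAt hb k1 k2 l z hz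
  dec x' := (GG_dec h hb n1 n2 l x').tendsto

variable {G : ℝ × ℝ → ℝ × ℝ → ℝ} {K : ℝ}

lemma Ker.Kn (hG : Ker G K) : 0 ≤ K := by
  have := (abs_nonneg _).trans (hG.bd 0 0)
  simpa using this

lemma Ker.meas (hG : Ker G K) : Measurable (fun z : (ℝ × ℝ) × (ℝ × ℝ) => G z.1 z.2) := by
  have hS : MeasurableSet {z : (ℝ × ℝ) × (ℝ × ℝ) | z.1.2 ≠ z.2.2} :=
    (isOpen_ne_fun (by fun_prop) (by fun_prop)).measurableSet
  have h1 : ContinuousOn (fun z : (ℝ × ℝ) × (ℝ × ℝ) => G z.1 z.2) {z : (ℝ × ℝ) × (ℝ × ℝ) | z.1.2 ≠ z.2.2} :=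
    fun z hz => (hG.cont z hz).continuousWithinAt
  classical
  have h2 := h1.measurable_piecewise (g := fun _ => (0:ℝ)) continuousOn_const hS
  convert h2 using 1
  funext z
  by_cases hz : z.1.2 = z.2.2
  · rw [Set.piecewise_eq_of_notMem _ _ _ (by simpa using hz)]; exact hG.zero _ _ hz
  · rw [Set.piecewise_eq_of_mem _ _ _ (by simpa using hz)]

/-- time weight -/
def wt (t : ℝ) : ℝ := 1 + |t| ^ (-(2/3) : ℝ)

lemma wt_one (t : ℝ) : 1 ≤ wt t := by unfold wt; have := Real.rpow_nonneg (abs_nonneg t) (-(2/3)); linarith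

lemma wt_meas : Measurable wt := by unfold wt; fun_prop

lemma sqrt_wt1 (t : ℝ) : 1 / √|t| ≤ wt t := by
  rcases eq_or_ne t 0 with rfl | ht
  · simpa using zero_le_one.trans (wt_one 0)
  have h0 := abs_pos.2 ht
  have : 1 / √|t| = |t| ^ (-(1/2) : ℝ) := by rw [Real.rpow_neg h0.le, ← Real.sqrt_eq_rpow, one_div]
  rw [this]
  unfold wt
  rcases le_total |t| 1 with h | h
  · have := Real.rpow_le_rpow_of_exponent_ge h0 h (by norm_num : (-(2/3) : ℝ) ≤ -(1/2)); linarith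
  · have := Real.rpow_le_one_of_one_le_of_nonpos h (by norm_num : (-(1/2) : ℝ) ≤ 0)
    have := Real.rpow_nonneg h0.le (-(2/3)); linarith

lemma sqrt_wt2 {t η : ℝ} (ht : t ≠ 0) (h : |t| ≤ η) (hη : η ≤ 1) : 1 / √|t| + 1 ≤ 2 * η ^ (1/6 : ℝ) * wt t := by
  have h0 := abs_pos.2 ht
  have : 1 / √|t| = |t| ^ (-(1/2) : ℝ) := by rw [Real.rpow_neg h0.le, ← Real.sqrt_eq_rpow, one_div]
  rw [this]
  have e1 : |t| ^ (-(1/2) : ℝ) = |t| ^ (1/6 : ℝ) * |t| ^ (-(2/3) : ℝ) := by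
    rw [← Real.rpow_add h0]; norm_num
  have e2 : (1:ℝ) ≤ |t| ^ (-(1/2) : ℝ) := Real.one_le_rpow_of_pos_of_le_one_of_nonpos h0 (h.trans hη) (by norm_num)
  have e3 : |t| ^ (1/6 : ℝ) ≤ η ^ (1/6:ℝ) := Real.rpow_le_rpow h0.le h (by norm_num)
  have e4 := Real.rpow_nonneg h0.le (-(2/3))
  have e5 : |t| ^ (1/6 : ℝ) * |t| ^ (-(2/3) : ℝ) ≤ η ^ (1/6:ℝ) * wt t := by
    refine mul_le_mul e3 ?_ e4 ((Real.rpow_nonneg h0.le _).trans e3)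
    unfold wt; linarith
  linarith

lemma Ker.bdw (hG : Ker G K) (x x' : ℝ × ℝ) : |G x x'| ≤ 2 * K * wt (x.2 - x'.2) := by
  refine (hG.bd x x').trans ?_
  have := sqrt_wt1 (x.2 - x'.2)
  have := wt_one (x.2 - x'.2)
  nlinarith [hG.Kn]

lemma null_line (t : ℝ) : ∀ᵐ x' : ℝ × ℝ, t ≠ x'.2 := by
  have h : volume ({x' : ℝ × ℝ | x'.2 = t}) = 0 := by
    have : {x' : ℝ × ℝ | x'.2 = t} = Set.univ ×ˢ {t} := by ext x; simp
    rw [this, Measure.volume_eq_prod, Measure.prod_prod]; simp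
  rw [ae_iff]
  convert h using 3
  simp [eq_comm]

/-- data for sources -/
structure Src (f : ℝ × ℝ → ℂ) (D : ℝ) : Prop where
  cont : Continuous f
  int : ∀ t : ℝ, Integrable (fun x' : ℝ × ℝ => wt (t - x'.2) * ‖f x'‖)
  le : ∀ t : ℝ, ∫ x' : ℝ × ℝ, wt (t - x'.2) * ‖f x'‖ ≤ D

def op (G : ℝ × ℝ → ℝ × ℝ → ℝ) (f : ℝ × ℝ → ℂ) (x : ℝ × ℝ) : ℂ := ∫ x', (G x x' : ℂ) * f x'

variable {f : ℝ × ℝ → ℂ} {D : ℝ}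

lemma Src.norm_int (hf : Src f D) : Integrable (fun x => ‖f x‖) := by
  refine (hf.int 0).mono' hf.cont.norm.aestronglyMeasurable (Filter.Eventually.of_forall fun x => ?_)
  rw [norm_norm]
  exact le_mul_of_one_le_left (norm_nonneg _) (wt_one _)

lemma Ker.measx (hG : Ker G K) (x : ℝ × ℝ) : Measurable (fun x' => G x x') :=
  hG.meas.comp (measurable_const.prodMk measurable_id)

lemma Ker.aesm (hG : Ker G K) (hf : Continuous f) (x : ℝ × ℝ) : AEStronglyMeasurable (fun x' => (G x x' : ℂ) * f x') volume :=
  (Complex.measurable_ofReal.comp (hG.measx x)).aestronglyMeasurable.mul hf.aestronglyMeasurable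

lemma op_int (hG : Ker G K) (hf : Src f D) (x : ℝ × ℝ) : Integrable (fun x' => (G x x' : ℂ) * f x') := by
  refine ((hf.int x.2).const_mul (2 * K)).mono' (hG.aesm hf.cont x) (Filter.Eventually.of_forall fun x' => ?_)
  rw [norm_mul, norm_real, ← mul_assoc]
  exact mul_le_mul_of_nonneg_right (hG.bdw x x') (norm_nonneg _)

lemma op_bd (hG : Ker G K) (hf : Src f D) (x : ℝ × ℝ) : ‖op G f x‖ ≤ 2 * K * D := by
  refine (norm_integral_le_of_norm_le ((hf.int x.2).const_mul (2 * K)) (Filter.Eventually.of_forall fun x' => ?_)).trans ?_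
  · rw [norm_mul, norm_real, ← mul_assoc]
    exact mul_le_mul_of_nonneg_right (hG.bdw x x') (norm_nonneg _)
  · rw [integral_const_mul]
    exact mul_le_mul_of_nonneg_left (hf.le x.2) (by have := hG.Kn; linarith)

/-- truncation -/
def cut (η t : ℝ) : ℝ := min 1 (|t| / η)

lemma cut_cont (η : ℝ) : Continuous (cut η) := by unfold cut; fun_prop
lemma cut_nn {η : ℝ} (h : 0 < η) (t : ℝ) : 0 ≤ cut η t := by unfold cut; positivity
lemma cut_le (η t : ℝ) : cut η t ≤ 1 := min_le_left _ _

lemma cut_bd (hG : Ker G K) {η : ℝ} (h : 0 < η) (h1 : η ≤ 1) (x x' : ℝ × ℝ) :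
    |cut η (x.2 - x'.2) * G x x'| ≤ 2 * K / η := by
  rw [abs_mul, abs_of_nonneg (cut_nn h _)]
  set t := x.2 - x'.2 with ht
  refine (mul_le_mul_of_nonneg_left (hG.bd x x') (cut_nn h _)).trans ?_
  have hK := hG.Kn
  have a1 : cut η t * (1 / √|t|) ≤ 1 / η := by
    rcases eq_or_ne t 0 with h0 | h0
    · rw [h0]; simp; exact h.le
    have hp := abs_pos.2 h0
    rcases le_total |t| 1 with h2 | h2
    · calc cut η t * (1 / √|t|) ≤ |t| / η * (1 / √|t|) := by
            refine mul_le_mul_of_nonneg_right (min_le_right _ _) (by positivity)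
        _ = √|t| / η := by
            have := Real.mul_self_sqrt hp.le
            have h3 := Real.sqrt_pos.2 hp
            rw [div_mul_div_comm, mul_one, div_eq_div_iff (by positivity) h.ne']
            linear_combination (-η) * this
        _ ≤ 1 / η := by
            refine div_le_div_of_nonneg_right (Real.sqrt_le_one.2 h2) h.le
    · have : (1:ℝ) ≤ √|t| := Real.one_le_sqrt.2 h2
      calc cut η t * (1 / √|t|) ≤ 1 * 1 := mul_le_mul (cut_le _ _) ((div_le_one (by linarith)).2 this) (by positivity) zero_le_one
        _ ≤ 1 / η := by rw [one_mul, le_div_iff₀ h]; linarith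
  have a2 : cut η t ≤ 1 / η := (cut_le _ _).trans (by rw [le_div_iff₀ h]; linarith)
  calc cut η t * (K * (1 / √|t| + 1)) = K * (cut η t * (1 / √|t|) + cut η t) := by ring
    _ ≤ K * (1 / η + 1 / η) := mul_le_mul_of_nonneg_left (by linarith) hK
    _ = _ := by ring

lemma cut_rem (hG : Ker G K) {η : ℝ} (h : 0 < η) (h1 : η ≤ 1) (x x' : ℝ × ℝ) :
    |G x x' - cut η (x.2 - x'.2) * G x x'| ≤ K * (2 * η ^ (1/6 : ℝ)) * wt (x.2 - x'.2) := by
  have hK := hG.Kn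
  have hw := wt_one (x.2 - x'.2)
  have hr : 0 ≤ K * (2 * η ^ (1/6 : ℝ)) * wt (x.2 - x'.2) := by positivity
  have e : G x x' - cut η (x.2 - x'.2) * G x x' = (1 - cut η (x.2 - x'.2)) * G x x' := by ring
  rw [e]
  rcases eq_or_ne (x.2 - x'.2) 0 with h0 | h0
  · rw [hG.zero x x' (sub_eq_zero.1 h0)]; simpa using hr
  rcases le_total |x.2 - x'.2| η with h2 | h2
  · rw [abs_mul]
    calc _ ≤ 1 * |G x x'| := by
          refine mul_le_mul_of_nonneg_right ?_ (abs_nonneg _)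
          rw [abs_le]; constructor <;> linarith [cut_nn h (x.2 - x'.2), cut_le η (x.2 - x'.2)]
      _ ≤ K * (1 / √|x.2 - x'.2| + 1) := by rw [one_mul]; exact hG.bd x x'
      _ ≤ K * (2 * η ^ (1/6 : ℝ) * wt (x.2 - x'.2)) := mul_le_mul_of_nonneg_left (sqrt_wt2 h0 h2 h1) hK
      _ = _ := by ring
  · have : cut η (x.2 - x'.2) = 1 := by
      unfold cut; rw [min_eq_left]; rwa [le_div_iff₀ h, one_mul]
    rw [this]; simpa using hr

def opc (η : ℝ) (G : ℝ × ℝ → ℝ × ℝ → ℝ) (f : ℝ × ℝ → ℂ) (x : ℝ × ℝ) : ℂ :=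
  ∫ x', ((cut η (x.2 - x'.2) * G x x' : ℝ) : ℂ) * f x'

lemma opc_aesm (hG : Ker G K) (hf : Src f D) (η : ℝ) (x : ℝ × ℝ) :
    AEStronglyMeasurable (fun x' : ℝ × ℝ => ((cut η (x.2 - x'.2) * G x x' : ℝ) : ℂ) * f x') volume := by
  refine (Complex.measurable_ofReal.comp (Measurable.mul ?_ (hG.measx x))).aestronglyMeasurable.mul hf.cont.aestronglyMeasurable
  exact ((cut_cont η).comp (by fun_prop)).measurable

lemma opc_dom (hG : Ker G K) {η : ℝ} (h : 0 < η) (h1 : η ≤ 1) (x x' : ℝ × ℝ) :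
    ‖((cut η (x.2 - x'.2) * G x x' : ℝ) : ℂ) * f x'‖ ≤ 2 * K / η * ‖f x'‖ := by
  rw [norm_mul, norm_real]
  exact mul_le_mul_of_nonneg_right (cut_bd hG h h1 x x') (norm_nonneg _)

lemma opc_approx (hG : Ker G K) (hf : Src f D) {η : ℝ} (h : 0 < η) (h1 : η ≤ 1) (x : ℝ × ℝ) :
    ‖op G f x - opc η G f x‖ ≤ K * (2 * η ^ (1/6 : ℝ)) * D := by
  have i2 : Integrable (fun x' : ℝ × ℝ => ((cut η (x.2 - x'.2) * G x x' : ℝ) : ℂ) * f x') :=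
    (hf.norm_int.const_mul _).mono' (opc_aesm hG hf η x) (Filter.Eventually.of_forall fun x' => opc_dom hG h h1 x x')
  unfold op opc
  rw [← integral_sub (op_int hG hf x) i2]
  refine (norm_integral_le_of_norm_le ((hf.int x.2).const_mul (K * (2 * η ^ (1/6 : ℝ)))) (Filter.Eventually.of_forall fun x' => ?_)).trans ?_
  · rw [← sub_mul, ← ofReal_sub, norm_mul, norm_real, ← mul_assoc]
    exact mul_le_mul_of_nonneg_right (cut_rem hG h h1 x x') (norm_nonneg _)
  · rw [integral_const_mul]
    exact mul_le_mul_of_nonneg_left (hf.le x.2) (by have := hG.Kn; positivity)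

lemma eta_ex (C : ℝ) {ε : ℝ} (hε : 0 < ε) : ∃ η : ℝ, 0 < η ∧ η ≤ 1 ∧ K * (2 * η ^ (1/6 : ℝ)) * C < ε := by
  have h : Filter.Tendsto (fun η : ℝ => K * (2 * η ^ (1/6 : ℝ)) * C) (nhdsWithin 0 (Set.Ioi 0)) (nhds 0) := by
    have h1 : ContinuousAt (fun η : ℝ => K * (2 * η ^ (1/6 : ℝ)) * C) 0 := by
      have := Real.continuousAt_rpow_const 0 (1/6 : ℝ) (Or.inr (by norm_num))
      fun_prop
    have h2 := h1.tendsto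
    rw [Real.zero_rpow (by norm_num), mul_zero, mul_zero, zero_mul] at h2
    exact h2.mono_left nhdsWithin_le_nhds
  have h3 := h.eventually (gt_mem_nhds hε)
  have h4 : ∀ᶠ η : ℝ in nhdsWithin 0 (Set.Ioi 0), η ∈ Set.Ioc (0:ℝ) 1 := Ioc_mem_nhdsGT zero_lt_one
  obtain ⟨η, h5, h6⟩ := (h3.and h4).exists
  exact ⟨η, h6.1, h6.2, h5⟩

lemma op_cont (hG : Ker G K) (hf : Src f D) : Continuous (op G f) := by
  refine continuous_of_uniform_approx_of_continuous fun u hu => ?_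
  obtain ⟨ε, hε, hu⟩ := Metric.mem_uniformity_dist.1 hu
  obtain ⟨η, h0, h1, h2⟩ := eta_ex (K := K) D hε
  refine ⟨opc η G f, ?_, fun x => hu ?_⟩
  · rw [continuous_iff_continuousAt]
    intro x0
    refine continuousAt_of_dominated (bound := fun x' => 2 * K / η * ‖f x'‖) (Filter.Eventually.of_forall fun x => opc_aesm hG hf η x)
      (Filter.Eventually.of_forall fun x => Filter.Eventually.of_forall fun x' => opc_dom hG h0 h1 x x')
      (hf.norm_int.const_mul _) ?_
    filter_upwards [null_line x0.2] with x' hx'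
    have c1 : ContinuousAt (fun x => G x x') x0 :=
      ContinuousAt.comp (f := fun x : ℝ × ℝ => (x, x')) (hG.cont (x0, x') hx') (by fun_prop)
    have c2 : ContinuousAt (fun x : ℝ × ℝ => cut η (x.2 - x'.2)) x0 :=
      ((cut_cont η).comp (by fun_prop)).continuousAt
    exact (Complex.continuous_ofReal.continuousAt.comp (c2.mul c1)).mul continuousAt_const
  · rw [dist_eq_norm]
    exact (opc_approx hG hf h0 h1 x).trans_lt h2

lemma op_tendsto (hG : Ker G K) (hf : Src f D) : Filter.Tendsto (op G f) (Filter.cocompact (ℝ × ℝ)) (nhds 0) := by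
  rw [Metric.tendsto_nhds]
  intro ε hε
  obtain ⟨η, h0, h1, h2⟩ := eta_ex (K := K) D (half_pos hε)
  haveI : (Filter.cocompact (ℝ × ℝ)).IsCountablyGenerated := by
    rw [← Metric.cobounded_eq_cocompact, ← comap_norm_atTop]; infer_instance
  have h3 : Filter.Tendsto (opc η G f) (Filter.cocompact (ℝ × ℝ)) (nhds (∫ _ : ℝ × ℝ, (0:ℂ))) := by
    refine tendsto_integral_filter_of_dominated_convergence (bound := fun x' => 2 * K / η * ‖f x'‖) (Filter.Eventually.of_forall fun x => opc_aesm hG hf η x)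
      (Filter.Eventually.of_forall fun x => Filter.Eventually.of_forall fun x' => opc_dom hG h0 h1 x x')
      (hf.norm_int.const_mul _) ?_
    refine Filter.Eventually.of_forall fun x' => ?_
    rw [tendsto_zero_iff_norm_tendsto_zero]
    have := (hG.dec x').abs.mul_const ‖f x'‖
    rw [abs_zero, zero_mul] at this
    refine squeeze_zero (fun _ => norm_nonneg _) (fun x => ?_) this
    rw [norm_mul, norm_real, Real.norm_eq_abs, abs_mul, abs_of_nonneg (cut_nn h0 _)]
    refine mul_le_mul_of_nonneg_right (mul_le_of_le_one_left (abs_nonneg _) (cut_le _ _)) (norm_nonneg _)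
  rw [integral_zero, Metric.tendsto_nhds] at h3
  filter_upwards [h3 _ (half_pos hε)] with x hx
  rw [dist_zero_right] at hx ⊢
  have := norm_le_norm_add_norm_sub' (op G f x) (opc η G f x)
  have := opc_approx hG hf h0 h1 x
  linarith

end Part12

section Part13

/-! ### Local integrability in time, Fubini in the spectral parameter -/

def hr (r t : ℝ) : ℝ := (Set.Ioo (-1 : ℝ) 1).indicator (fun t => |t| ^ r) t

lemma hr_int {r : ℝ} (h1 : -1 < r) (h0 : r < 0) : Integrable (hr r) := by
  have hg : Integrable ((Set.Ioo (0:ℝ) 1).indicator (fun t : ℝ => t ^ r)) := by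
    rw [integrable_indicator_iff measurableSet_Ioo]
    exact (intervalIntegral.integrableOn_Ioo_rpow_iff zero_lt_one).2 h1
  refine (hg.add hg.comp_neg).mono' ?_ (Filter.Eventually.of_forall fun t => ?_)
  · unfold hr
    exact ((by fun_prop : Measurable (fun t : ℝ => |t| ^ r)).indicator measurableSet_Ioo).aestronglyMeasurable
  · unfold hr
    have nn : ∀ s : ℝ, 0 ≤ (Set.Ioo (0:ℝ) 1).indicator (fun t : ℝ => t ^ r) s := fun s =>
      Set.indicator_nonneg (fun u hu => Real.rpow_nonneg hu.1.le _) s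
    have n1 := nn t
    have n2 := nn (-t)
    simp only [Pi.add_apply]
    by_cases ht : t ∈ Set.Ioo (-1:ℝ) 1
    · rw [Set.indicator_of_mem ht, Real.norm_of_nonneg (Real.rpow_nonneg (abs_nonneg t) r)]
      rcases lt_trichotomy t 0 with h | h | h
      · have : -t ∈ Set.Ioo (0:ℝ) 1 := ⟨by linarith, by linarith [ht.1]⟩
        rw [Set.indicator_of_mem this, abs_of_neg h]; linarith
      · rw [h, abs_zero, Real.zero_rpow h0.ne]; rw [h] at n1 n2; linarith
      · have : t ∈ Set.Ioo (0:ℝ) 1 := ⟨h, ht.2⟩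
        rw [Set.indicator_of_mem this, abs_of_pos h]; linarith
    · rw [Set.indicator_of_notMem ht]; simp; linarith

lemma hr_nn (r t : ℝ) : 0 ≤ hr r t := Set.indicator_nonneg (fun _ _ => Real.rpow_nonneg (abs_nonneg _) _) t

lemma hr_meas (r : ℝ) : Measurable (hr r) :=
  (by fun_prop : Measurable (fun t : ℝ => |t| ^ r)).indicator measurableSet_Ioo

lemma wt_le (t : ℝ) : wt t ≤ 2 + hr (-(2/3)) t := by
  unfold wt hr
  by_cases ht : t ∈ Set.Ioo (-1:ℝ) 1
  · rw [Set.indicator_of_mem ht]; linarith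
  · rw [Set.indicator_of_notMem ht]
    have : 1 ≤ |t| := by
      by_contra h
      push Not at h
      exact ht (abs_lt.1 h)
    have := Real.rpow_le_one_of_one_le_of_nonpos this (by norm_num : (-(2/3) : ℝ) ≤ 0)
    linarith

lemma cs_wt_int {F : ℝ × ℝ → ℝ} (hF : Continuous F) (hc : HasCompactSupport F) (t' : ℝ) :
    Integrable (fun x : ℝ × ℝ => wt (t' - x.2) * |F x|) := by
  obtain ⟨M, hM⟩ := hc.exists_bound_of_continuous hF
  obtain ⟨R, hR⟩ := hc.isCompact.isBounded.subset_closedBall 0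
  have i1 : Integrable (fun x : ℝ × ℝ => 2 * |F x|) := (hF.integrable_of_hasCompactSupport hc).abs.const_mul 2
  have i2 : Integrable (fun x : ℝ × ℝ => (Set.Icc (-R) R).indicator (fun _ => M) x.1 * hr (-(2/3)) (t' - x.2)) := by
    have a : Integrable ((Set.Icc (-R) R).indicator (fun _ : ℝ => M)) :=
      (integrable_indicator_iff measurableSet_Icc).2 (integrableOn_const (by simp))
    have b : Integrable (fun t => hr (-(2/3)) (t' - t)) := (hr_int (by norm_num) (by norm_num)).comp_sub_left t'
    exact a.mul_prod b
  refine (i1.add i2).mono' ?_ (Filter.Eventually.of_forall fun x => ?_)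
  · exact ((wt_meas.comp (by fun_prop)).mul hF.abs.measurable).aestronglyMeasurable
  · have h1 := wt_le (t' - x.2)
    have h3 := hr_nn (-(2/3)) (t' - x.2)
    have h2 : |F x| ≤ (Set.Icc (-R) R).indicator (fun _ => M) x.1 := by
      by_cases hx : x ∈ tsupport F
      · have := hR hx
        rw [mem_closedBall_zero_iff] at this
        have : |x.1| ≤ R := (norm_fst_le x).trans this
        rw [Set.indicator_of_mem (show x.1 ∈ Set.Icc (-R) R from abs_le.1 this)]
        exact hM x
      · rw [image_eq_zero_of_notMem_tsupport hx, abs_zero]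
        exact Set.indicator_nonneg (fun _ _ => (norm_nonneg _).trans (hM 0)) _
    have h4 := wt_one (t' - x.2)
    rw [Real.norm_eq_abs, abs_mul, abs_abs, abs_of_nonneg (by linarith)]
    simp only [Pi.add_apply]
    calc wt (t' - x.2) * |F x| ≤ (2 + hr (-(2/3)) (t' - x.2)) * |F x| := by gcongr
      _ = 2 * |F x| + |F x| * hr (-(2/3)) (t' - x.2) := by ring
      _ ≤ _ := by gcongr

lemma fub {S : Set (ℝ × ℝ)} {P : Set ℝ} (hS : MeasurableSet S) (hP : MeasurableSet P) {b t' : ℝ}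
    {e : ℝ × ℝ → ℝ → ℂ} (he : ContinuousOn (fun p : (ℝ × ℝ) × ℝ => e p.1 p.2) (S ×ˢ P))
    {M : ℝ × ℝ → ℝ} (hM : Continuous M) (hMc : HasCompactSupport M)
    (hb : ∀ x ∈ S, ∀ s ∈ P, x.2 ≠ t' → ‖e x s‖ ≤ |M x| * Real.exp (-|x.2 - t'| * (s - b) ^ 2)) :
    ∫ x in S, ∫ s in P, e x s = ∫ s in P, ∫ x in S, e x s := by
  refine integral_integral_swap ?_
  have hm : AEStronglyMeasurable (fun p : (ℝ × ℝ) × ℝ => e p.1 p.2) ((volume.restrict S).prod (volume.restrict P)) := by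
    rw [Measure.prod_restrict]
    exact he.aestronglyMeasurable (hS.prod hP)
  refine (integrable_prod_iff hm).2 ⟨?_, ?_⟩
  · filter_upwards [ae_restrict_of_ae (null_line t'), ae_restrict_mem hS] with x hx hxS
    refine Integrable.mono' (((gauss_int (sub_ne_zero.2 hx.symm) b).integrableOn).const_mul |M x|) ?_ ?_
    · have : ContinuousOn (fun s => e x s) P :=
        he.comp (f := fun s => (x, s)) (by fun_prop) (fun s hs => ⟨hxS, hs⟩)
      exact this.aestronglyMeasurable hP
    · exact (ae_restrict_iff' hP).2 (Filter.Eventually.of_forall fun s hs => hb x hxS s hs hx.symm)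
  · have hmn : AEStronglyMeasurable (fun x => ∫ s in P, ‖e x s‖) (volume.restrict S) := hm.norm.integral_prod_right'
    refine Integrable.mono' (((cs_wt_int hM hMc t').integrableOn (s := S)).const_mul (√Real.pi)) hmn ?_
    filter_upwards [ae_restrict_of_ae (null_line t'), ae_restrict_mem hS] with x hx hxS
    have ht := sub_ne_zero.2 hx.symm
    rw [Real.norm_of_nonneg (integral_nonneg fun _ => norm_nonneg _)]
    calc ∫ s in P, ‖e x s‖ ≤ ∫ s in P, |M x| * Real.exp (-|x.2 - t'| * (s - b) ^ 2) := by
          refine integral_mono_of_nonneg (Filter.Eventually.of_forall fun _ => norm_nonneg _) ((gauss_int ht b).integrableOn.const_mul _) ?_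
          exact (ae_restrict_iff' hP).2 (Filter.Eventually.of_forall fun s hs => hb x hxS s hs hx.symm)
      _ ≤ ∫ s, |M x| * Real.exp (-|x.2 - t'| * (s - b) ^ 2) :=
          setIntegral_le_integral ((gauss_int ht b).const_mul _) (Filter.Eventually.of_forall fun s => by positivity)
      _ = √Real.pi * (1 / √|t' - x.2| * |M x|) := by
          rw [integral_const_mul, gauss_val, Real.sqrt_div Real.pi_pos.le, abs_sub_comm t']; ring
      _ ≤ _ := by
          have := sqrt_wt1 (t' - x.2)
          gcongr

end Part13

section Part14

/-! ### GG is a fundamental solution -/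

lemma int_comb {α : Type*} [MeasurableSpace α] {𝕜 : Type*} [RCLike 𝕜] {μ : Measure α} {f g h : α → 𝕜} (hf : Integrable f μ) (hg : Integrable g μ)
    (hh : Integrable h μ) (c d : 𝕜) : Integrable (fun x => f x + (c * g x - d * h x)) μ ∧
    ∫ x, (f x + (c * g x - d * h x)) ∂μ = (∫ x, f x ∂μ) + (c * (∫ x, g x ∂μ) - d * ∫ x, h x ∂μ) := by
  have h2 : Integrable (fun x => c * g x - d * h x) μ := (hg.const_mul c).sub (hh.const_mul d)
  refine ⟨hf.add h2, ?_⟩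
  rw [integral_add hf h2, integral_sub (hg.const_mul c) (hh.const_mul d), integral_const_mul, integral_const_mul]

def Gp (k1 k2 l b : ℝ) (x x' : ℝ × ℝ) : ℝ :=
  G0 b (x.1 - x'.1) (x.2 - x'.2)
  + (k2 - k1) * (qa k1 k2 l x * qb k1 k2 l x' * Ak b k2 (x.1 - x'.1) (x.2 - x'.2)
    - qb k1 k2 l x * qa k1 k2 l x' * Ak b k1 (x.1 - x'.1) (x.2 - x'.2))

lemma Gp_eq {b : ℝ} (hb : 0 ≤ b) (k1 k2 l : ℝ) (x x' : ℝ × ℝ) :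
    Gp k1 k2 l b x x' = Real.sign (x.2 - x'.2) / Real.pi * ∫ s in Preg b (x.2 - x'.2), Es k1 k2 l b s x' x := by
  rcases eq_or_ne (x.2 - x'.2) 0 with h0 | h0
  · simp [Gp, G0, Ak, h0, PP_zero]
  set Y := x.1 - x'.1
  set t := x.2 - x'.2
  have i0 := PP_int (b := b) (C := 1) hb h0 (f := fun s => Real.cos (s * Y)) (by fun_prop) (fun s _ => Real.abs_cos_le_one _)
  have ik : ∀ k, IntegrableOn (fun s => Sk k s Y * Real.exp (-(s ^ 2 - b ^ 2) * t)) (Preg b t) := fun k => PP_int (b := b) (C := |Y| + |k|⁻¹) hb h0 (f := fun s => Sk k s Y) (Sk_contOn k Y) (fun s hs => Sk_le (reg_pos hb hs) k Y)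
  unfold Gp G0 Ak PP
  have : (fun s => Es k1 k2 l b s x' x) = fun s => Real.cos (s * Y) * Real.exp (-(s ^ 2 - b ^ 2) * t)
      + (((k2 - k1) * (qa k1 k2 l x * qb k1 k2 l x')) * (Sk k2 s Y * Real.exp (-(s ^ 2 - b ^ 2) * t))
      - ((k2 - k1) * (qb k1 k2 l x * qa k1 k2 l x')) * (Sk k1 s Y * Real.exp (-(s ^ 2 - b ^ 2) * t))) := by
    funext s; unfold Es; ring
  rw [this, (int_comb i0 (ik k2) (ik k1) _ _).2]
  ring

lemma Es_bd {s : ℝ} (hs : 0 < s) (k1 k2 l b : ℝ) (x x' : ℝ × ℝ) :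
    |Es k1 k2 l b s x' x| ≤ (1 + |k2 - k1| * (2 * |x.1 - x'.1| + |k2|⁻¹ + |k1|⁻¹)) * Real.exp (-(s ^ 2 - b ^ 2) * (x.2 - x'.2)) := by
  unfold Es
  rw [abs_mul, abs_of_pos (Real.exp_pos _)]
  refine mul_le_mul_of_nonneg_right ((abs_add_le _ _).trans (add_le_add (Real.abs_cos_le_one _) ?_)) (Real.exp_pos _).le
  rw [abs_mul]
  refine mul_le_mul_of_nonneg_left ((abs_sub _ _).trans ?_) (abs_nonneg _)
  have a1 : |qa k1 k2 l x * qb k1 k2 l x' * Sk k2 s (x.1 - x'.1)| ≤ |x.1 - x'.1| + |k2|⁻¹ := by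
    rw [abs_mul, abs_of_pos (qq_pos1 ..)]
    exact (mul_le_of_le_one_left (abs_nonneg _) (qq_le1 ..)).trans (Sk_le hs _ _)
  have a2 : |qb k1 k2 l x * qa k1 k2 l x' * Sk k1 s (x.1 - x'.1)| ≤ |x.1 - x'.1| + |k1|⁻¹ := by
    rw [abs_mul, abs_of_pos (qq_pos2 ..)]
    exact (mul_le_of_le_one_left (abs_nonneg _) (qq_le2 ..)).trans (Sk_le hs _ _)
  linarith

lemma Es_cont (k1 k2 l b : ℝ) (x' : ℝ × ℝ) :
    ContinuousOn (fun p : (ℝ × ℝ) × ℝ => Es k1 k2 l b p.2 x' p.1) {p | 0 < p.2} := by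
  have hk : ∀ k, ContinuousOn (fun p : (ℝ × ℝ) × ℝ => Sk k p.2 (p.1.1 - x'.1)) {p | 0 < p.2} := fun k => by
    unfold Sk
    exact ContinuousOn.div (by fun_prop) (by fun_prop) fun p hp => sk_den (ne_of_gt hp) k
  have := qa_cont k1 k2 l
  have := qb_cont k1 k2 l
  have := hk k1
  have := hk k2
  unfold Es
  fun_prop

lemma Es_fub {b : ℝ} (hb : 0 ≤ b) (k1 k2 l : ℝ) (x' : ℝ × ℝ) {F : ℝ × ℝ → ℂ} (hF : Continuous F) (hc : HasCompactSupport F)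
    {S : Set (ℝ × ℝ)} {P : Set ℝ} (hS : MeasurableSet S) (hP : MeasurableSet P)
    (h : ∀ x ∈ S, x.2 ≠ x'.2 → Preg b (x.2 - x'.2) = P) (hP0 : P ⊆ Set.Ioi 0) :
    ∫ x in S, ∫ s in P, (Es k1 k2 l b s x' x : ℂ) * F x = ∫ s in P, ∫ x in S, (Es k1 k2 l b s x' x : ℂ) * F x := by
  refine fub hS hP (b := b) (t' := x'.2) (M := fun x => (1 + |k2 - k1| * (2 * |x.1 - x'.1| + |k2|⁻¹ + |k1|⁻¹)) * ‖F x‖) ?_ (by fun_prop) hc.norm.mul_left ?_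
  · have h1 : ContinuousOn (fun p : (ℝ × ℝ) × ℝ => Es k1 k2 l b p.2 x' p.1) (S ×ˢ P) :=
      (Es_cont k1 k2 l b x').mono fun p hp => hP0 hp.2
    exact (Complex.continuous_ofReal.comp_continuousOn h1).mul (hF.comp continuous_fst).continuousOn
  · intro x hx s hs hne
    rw [norm_mul, norm_real, Real.norm_eq_abs, abs_of_nonneg (by positivity : 0 ≤ (1 + |k2 - k1| * (2 * |x.1 - x'.1| + |k2|⁻¹ + |k1|⁻¹)) * ‖F x‖)]
    have h1 := Es_bd (hP0 hs) k1 k2 l b x x'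
    have h2 := Real.exp_le_exp.2 (reg_exp hb (show s ∈ Preg b (x.2 - x'.2) by rw [h x hx hne]; exact hs))
    calc _ ≤ ((1 + |k2 - k1| * (2 * |x.1 - x'.1| + |k2|⁻¹ + |k1|⁻¹)) * Real.exp (-|x.2 - x'.2| * (s - b) ^ 2)) * ‖F x‖ := by
          refine mul_le_mul_of_nonneg_right (h1.trans ?_) (norm_nonneg _)
          exact mul_le_mul_of_nonneg_left h2 (by positivity)
      _ = _ := by ring

/-- the inverse transform at the initial time -/
lemma J_inv (k1 k2 l b : ℝ) (x' : ℝ × ℝ) {φ : ℝ × ℝ → ℂ} (hφ : Sm φ) (hc : HasCompactSupport φ) :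
    IntegrableOn (fun s : ℝ => ∫ y, (Es k1 k2 l b s x' (y, x'.2) : ℂ) * φ (y, x'.2)) (Set.Ioi 0) ∧
    ∫ s in Set.Ioi (0:ℝ), ∫ y, (Es k1 k2 l b s x' (y, x'.2) : ℂ) * φ (y, x'.2)
      = Real.pi * (φ x' - (k2 - k1) * (iot k2 - iot k1) * ∫ y, ((qa k1 k2 l (y, x'.2) * qb k1 k2 l x' * Real.exp (k2 * (y - x'.1)) : ℝ) : ℂ) * φ (y, x'.2)) := by
  set t' := x'.2
  set y' := x'.1
  obtain ⟨sψ, cψ⟩ := slice1_cs hφ hc t'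
  have hg1 : Sm (fun x => (qa k1 k2 l x : ℂ) * φ x) := (qa_sm k1 k2 l).mul hφ
  have hg2 : Sm (fun x => (qb k1 k2 l x : ℂ) * φ x) := (qb_sm k1 k2 l).mul hφ
  obtain ⟨s1, c1⟩ := slice1_cs hg1 hc.mul_left t'
  obtain ⟨s2, c2⟩ := slice1_cs hg2 hc.mul_left t'
  have gen : ∀ {g : ℝ → ℂ}, ContDiff ℝ (⊤ : ℕ∞) g → HasCompactSupport g →
      (∀ y, HasDerivAt g (deriv g y) y) ∧ ContDiff ℝ (⊤ : ℕ∞) (deriv g) ∧ HasCompactSupport (deriv g) := by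
    intro g hg hgc
    refine ⟨fun y => (hg.differentiable (by simp) y).hasDerivAt, ?_, hgc.deriv⟩
    exact hg.deriv'
  have hψ := gen sψ cψ
  have hψ2 := gen hψ.2.1 hψ.2.2
  have A := cos_inv hψ.1 hψ2.1 (sψ.continuous.integrable_of_hasCompactSupport cψ)
    (hψ.2.1.continuous.integrable_of_hasCompactSupport hψ.2.2) (hψ2.2.1.continuous.integrable_of_hasCompactSupport hψ2.2.2) y'
  have B2 := Sk_transform k2 (gen s1 c1).1 (gen s1 c1).2.1.continuous c1 (gen s1 c1).2.2 y'
  have B1 := Sk_transform k1 (gen s2 c2).1 (gen s2 c2).2.1.continuous c2 (gen s2 c2).2.2 y'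
  set C2 : ℂ := (k2 - k1) * qb k1 k2 l x' with hC2
  set C1 : ℂ := (k2 - k1) * qa k1 k2 l x' with hC1
  have e : ∀ s ∈ Set.Ioi (0:ℝ), ∫ y, (Es k1 k2 l b s x' (y, t') : ℂ) * φ (y, t') =
      (∫ y, (Real.cos (s * (y - y')) : ℂ) * φ (y, t')) + (C2 * (∫ y, (Sk k2 s (y - y') : ℂ) * ((qa k1 k2 l (y, t') : ℂ) * φ (y, t')))
      - C1 * ∫ y, (Sk k1 s (y - y') : ℂ) * ((qb k1 k2 l (y, t') : ℂ) * φ (y, t'))) := by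
    intro s hs
    have j0 : Integrable (fun y => (Real.cos (s * (y - y')) : ℂ) * φ (y, t')) :=
      (Continuous.mul (by fun_prop) sψ.continuous).integrable_of_hasCompactSupport cψ.mul_left
    have cS : ∀ k, Continuous (fun y => (Sk k s (y - y') : ℂ)) := fun k =>
      Complex.continuous_ofReal.comp ((Sk_contY k s).comp (by fun_prop))
    have j2 := ((cS k2).mul s1.continuous).integrable_of_hasCompactSupport (c1.mul_left (f := fun y => (Sk k2 s (y - y') : ℂ))) (μ := volume)
    have j1 := ((cS k1).mul s2.continuous).integrable_of_hasCompactSupport (c2.mul_left (f := fun y => (Sk k1 s (y - y') : ℂ))) (μ := volume)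
    refine Eq.trans ?_ (int_comb j0 j2 j1 C2 C1).2
    refine integral_congr_ae (Filter.Eventually.of_forall fun y => ?_)
    simp only [Es, hC1, hC2, Pi.mul_apply]
    have : t' - x'.2 = 0 := sub_self _
    rw [this]
    push_cast
    rw [mul_zero, Complex.exp_zero]
    ring
  refine ⟨(integrableOn_congr_fun e measurableSet_Ioi).2 (int_comb A.1 B2.1 B1.1 C2 C1).1, ?_⟩
  rw [setIntegral_congr_fun measurableSet_Ioi e, (int_comb A.1 B2.1 B1.1 C2 C1).2,
    A.2, B2.2, B1.2]
  have bid : ∀ y, (Real.exp (k2 * (y - y')) : ℂ) * ((qa k1 k2 l (y, t') : ℂ) * φ (y, t')) * qb k1 k2 l x' = ((qa k1 k2 l (y, t') * qb k1 k2 l x' * Real.exp (k2 * (y - y')) : ℝ) : ℂ) * φ (y, t') := by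
    intro y; push_cast; ring
  have bid' : ∀ y, (Real.exp (k1 * (y - y')) : ℂ) * ((qb k1 k2 l (y, t') : ℂ) * φ (y, t')) * qa k1 k2 l x' = ((qa k1 k2 l (y, t') * qb k1 k2 l x' * Real.exp (k2 * (y - y')) : ℝ) : ℂ) * φ (y, t') := by
    intro y
    have h := B_id k1 k2 l 0 (y, t') x'
    have h0 : (y, t').2 - x'.2 = 0 := sub_self _
    simp only [h0, mul_zero, add_zero] at h
    rw [show (k2 * (y - y')) = k2 * ((y, t').1 - x'.1) from rfl, h]
    push_cast; ring
  have E2 : (∫ y in Set.Ioi y', (Real.exp (k2 * (y - y')) : ℂ) * ((qa k1 k2 l (y, t') : ℂ) * φ (y, t'))) * qb k1 k2 l x'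
      = ∫ y in Set.Ioi y', ((qa k1 k2 l (y, t') * qb k1 k2 l x' * Real.exp (k2 * (y - y')) : ℝ) : ℂ) * φ (y, t') := by
    rw [← integral_mul_const]; simp_rw [bid]
  have E2' : (∫ y, (Real.exp (k2 * (y - y')) : ℂ) * ((qa k1 k2 l (y, t') : ℂ) * φ (y, t'))) * qb k1 k2 l x'
      = ∫ y, ((qa k1 k2 l (y, t') * qb k1 k2 l x' * Real.exp (k2 * (y - y')) : ℝ) : ℂ) * φ (y, t') := by
    rw [← integral_mul_const]; simp_rw [bid]
  have E1 : (∫ y in Set.Ioi y', (Real.exp (k1 * (y - y')) : ℂ) * ((qb k1 k2 l (y, t') : ℂ) * φ (y, t'))) * qa k1 k2 l x'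
      = ∫ y in Set.Ioi y', ((qa k1 k2 l (y, t') * qb k1 k2 l x' * Real.exp (k2 * (y - y')) : ℝ) : ℂ) * φ (y, t') := by
    rw [← integral_mul_const]; simp_rw [bid']
  have E1' : (∫ y, (Real.exp (k1 * (y - y')) : ℂ) * ((qb k1 k2 l (y, t') : ℂ) * φ (y, t'))) * qa k1 k2 l x'
      = ∫ y, ((qa k1 k2 l (y, t') * qb k1 k2 l x' * Real.exp (k2 * (y - y')) : ℝ) : ℂ) * φ (y, t') := by
    rw [← integral_mul_const]; simp_rw [bid']
  have hx : φ (y', t') = φ x' := rfl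
  rw [hx, hC1, hC2]
  linear_combination ((Real.pi : ℂ) * (k2 - k1)) * (E2 - iot k2 * E2' - E1 + iot k1 * E1')

end Part14

section Part15

def B0 (k1 k2 l b : ℝ) (x' x : ℝ × ℝ) : ℝ :=
  qa k1 k2 l x * qb k1 k2 l x' * Real.exp (k2 * (x.1 - x'.1) + (k2 ^ 2 + b ^ 2) * (x.2 - x'.2))

lemma B0_eq (k1 k2 l b : ℝ) (x' x : ℝ × ℝ) : B0 k1 k2 l b x' x
    = qa k1 k2 l x' * Real.exp (-(k1 * x'.1 + (k1 ^ 2 + b ^ 2) * x'.2)) * Bs k1 k2 l b x := by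
  unfold B0 Bs
  rw [B_id]
  have : Real.exp (k1 * (x.1 - x'.1) + (k1 ^ 2 + b ^ 2) * (x.2 - x'.2)) =
    Real.exp (-(k1 * x'.1 + (k1 ^ 2 + b ^ 2) * x'.2)) * Real.exp (k1 * x.1 + (k1 ^ 2 + b ^ 2) * x.2) := by
    rw [← Real.exp_add]; congr 1; ring
  rw [this]; ring

lemma clsol_smul {b : ℝ} {U : ℝ × ℝ → ℝ} {E : ℝ × ℝ → ℂ} (h : ClSol b U E) (c : ℂ) :
    ClSol b U (fun x => c * E x) := by
  have h1 : pd1 (fun x => c * E x) = fun x => c * pd1 E x := by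
    funext x; simp [pd1, deriv_const_mul_field]
  have h11 : pd1 (fun x => c * pd1 E x) = fun x => c * pd1 (pd1 E) x := by
    funext x; simp [pd1, deriv_const_mul_field]
  have h2 : pd2 (fun x => c * E x) = fun x => c * pd2 E x := by
    funext x; simp [pd2, deriv_const_mul_field]
  intro x
  rw [h1, h11, h2]
  simp only
  rw [h x]; ring

lemma B0_sol (k1 k2 l b : ℝ) (x' : ℝ × ℝ) :
    Sm (fun x => (B0 k1 k2 l b x' x : ℂ)) ∧ ClSol b (uu k1 k2 l) (fun x => (B0 k1 k2 l b x' x : ℂ)) := by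
  have e : (fun x => (B0 k1 k2 l b x' x : ℂ)) = fun x => ((qa k1 k2 l x' * Real.exp (-(k1 * x'.1 + (k1 ^ 2 + b ^ 2) * x'.2)) : ℝ) : ℂ) * (Bs k1 k2 l b x : ℂ) := by
    funext x; rw [B0_eq]; push_cast; ring
  rw [e]
  exact ⟨contDiff_const.mul (Bs_sol k1 k2 l b).1, clsol_smul (Bs_sol k1 k2 l b).2 _⟩

theorem fund {k1 k2 l b K : ℝ} (hb : 0 ≤ b) (hG : Ker (GG k1 k2 l b) K) {φ : ℝ × ℝ → ℂ} (hφ : Sm φ) (hc : HasCompactSupport φ) (x' : ℝ × ℝ) :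
    ∫ x, (GG k1 k2 l b x x' : ℂ) * Hs b (uu k1 k2 l) φ x = - φ x' := by
  set F := Hs b (uu k1 k2 l) φ with hFd
  have hF : Continuous F := Hs_cont (uu_cont k1 k2 l) hφ
  have hFc : HasCompactSupport F := Hs_cs hφ hc
  set Sp := {x : ℝ × ℝ | x'.2 < x.2}
  set Sm' := {x : ℝ × ℝ | x.2 ≤ x'.2}
  have mp : MeasurableSet Sp := measurableSet_lt measurable_const measurable_snd
  have mm : MeasurableSet Sm' := measurableSet_le measurable_snd measurable_const
  have hcompl : Sm'ᶜ = Sp := by ext x; simp [Sm', Sp]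
  -- Bt
  have hBt : ∀ᵐ x : ℝ × ℝ, (Bt k1 k2 l b x x' : ℂ) * F x = Sm'.indicator (fun x => (B0 k1 k2 l b x' x : ℂ) * F x) x := by
    filter_upwards [null_line x'.2] with x hx
    by_cases h : x ∈ Sm'
    · rw [Set.indicator_of_mem h]
      have : x.2 - x'.2 < 0 := by
        rcases lt_or_eq_of_le (show x.2 ≤ x'.2 from h) with h | h
        · linarith
        · exact absurd h.symm hx
      simp only [Bt, if_pos this, B0]
    · rw [Set.indicator_of_notMem h]
      have : ¬ (x.2 - x'.2 < 0) := fun h' => h (show x.2 ≤ x'.2 by linarith)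
      rw [Bt, if_neg this]; simp
  have hB0i : Integrable (fun x => (B0 k1 k2 l b x' x : ℂ) * F x) :=
    ((B0_sol k1 k2 l b x').1.continuous.mul hF).integrable_of_hasCompactSupport hFc.mul_left
  have iBt : Integrable (fun x => (Bt k1 k2 l b x x' : ℂ) * F x) := (hB0i.indicator mm).congr (by filter_upwards [hBt] with x hx using hx.symm)
  have vBt : ∫ x, (Bt k1 k2 l b x x' : ℂ) * F x = ∫ y, (B0 k1 k2 l b x' (y, x'.2) : ℂ) * φ (y, x'.2) := by
    rw [integral_congr_ae hBt, integral_indicator mm]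
    exact weak_le (B0_sol k1 k2 l b x').1 hφ hc (B0_sol k1 k2 l b x').2 x'.2
  -- GG integrable
  have iGG : Integrable (fun x => (GG k1 k2 l b x x' : ℂ) * F x) := by
    refine ((cs_wt_int hF.norm hFc.norm x'.2).const_mul (2 * K)).mono' ?_ (Filter.Eventually.of_forall fun x => ?_)
    · exact (Complex.measurable_ofReal.comp (hG.meas.comp (measurable_id.prodMk measurable_const))).aestronglyMeasurable.mul hF.aestronglyMeasurable
    · rw [norm_mul, norm_real, abs_norm, ← mul_assoc]
      refine mul_le_mul_of_nonneg_right ((hG.bdw x x').trans ?_) (norm_nonneg _)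
      unfold wt; rw [abs_sub_comm]
  set C := (k2 - k1) * (iot k2 - iot k1) with hC
  have iGp : Integrable (fun x => (Gp k1 k2 l b x x' : ℂ) * F x) := by
    refine (iGG.add (iBt.const_mul (C : ℂ))).congr (Filter.Eventually.of_forall fun x => ?_)
    simp only [Pi.add_apply, GG, Gp, hC]; push_cast; ring
  -- Gp
  have vp : ∫ x in Sp, (Gp k1 k2 l b x x' : ℂ) * F x = -(1 / Real.pi) * ∫ s in Set.Ioi b, ∫ y, (Es k1 k2 l b s x' (y, x'.2) : ℂ) * φ (y, x'.2) := by
    have e1 : ∀ x ∈ Sp, (Gp k1 k2 l b x x' : ℂ) * F x = (1 / Real.pi : ℂ) * ∫ s in Set.Ioi b, (Es k1 k2 l b s x' x : ℂ) * F x := by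
      intro x hx
      have : 0 < x.2 - x'.2 := sub_pos.2 hx
      rw [Gp_eq hb, Preg_pos this, Real.sign_of_pos this, integral_mul_const, integral_complex_ofReal]
      push_cast; ring
    rw [setIntegral_congr_fun mp e1, integral_const_mul, Es_fub hb k1 k2 l x' hF hFc mp measurableSet_Ioi (fun x hx _ => Preg_pos (sub_pos.2 hx))
      (Set.Ioi_subset_Ioi hb), neg_mul, ← mul_neg, ← integral_neg]
    congr 1
    refine setIntegral_congr_fun measurableSet_Ioi fun s hs => ?_
    have hs0 : s ≠ 0 := (hb.trans_lt hs).ne'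
    exact weak_gt (Es_sol k1 k2 l b hs0 x').1 hφ hc (Es_sol k1 k2 l b hs0 x').2 x'.2
  have vm : ∫ x in Sm', (Gp k1 k2 l b x x' : ℂ) * F x = -(1 / Real.pi) * ∫ s in Set.Ioc 0 b, ∫ y, (Es k1 k2 l b s x' (y, x'.2) : ℂ) * φ (y, x'.2) := by
    have e1 : ∀ᵐ x : ℝ × ℝ, x ∈ Sm' → (Gp k1 k2 l b x x' : ℂ) * F x = (-(1 / Real.pi) : ℂ) * ∫ s in Set.Ioc 0 b, (Es k1 k2 l b s x' x : ℂ) * F x := by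
      filter_upwards [null_line x'.2] with x hx hxm
      have : x.2 - x'.2 < 0 := by
        rcases lt_or_eq_of_le (show x.2 ≤ x'.2 from hxm) with h | h
        · linarith
        · exact absurd h.symm hx
      rw [Gp_eq hb, Preg_neg this, Real.sign_of_neg this, integral_mul_const, integral_complex_ofReal]
      push_cast; ring
    rw [setIntegral_congr_ae mm e1, integral_const_mul, Es_fub hb k1 k2 l x' hF hFc mm measurableSet_Ioc
      (fun x hx hne => Preg_neg (sub_neg.2 (lt_of_le_of_ne hx hne))) (fun s hs => hs.1)]
    congr 1
    refine setIntegral_congr_fun measurableSet_Ioc fun s hs => ?_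
    have hs0 : s ≠ 0 := hs.1.ne'
    exact weak_le (Es_sol k1 k2 l b hs0 x').1 hφ hc (Es_sol k1 k2 l b hs0 x').2 x'.2
  obtain ⟨J1, J2⟩ := J_inv k1 k2 l b x' hφ hc
  have hun : Set.Ioc 0 b ∪ Set.Ioi b = Set.Ioi 0 := Set.Ioc_union_Ioi_eq_Ioi hb
  have vJ : (∫ s in Set.Ioc 0 b, ∫ y, (Es k1 k2 l b s x' (y, x'.2) : ℂ) * φ (y, x'.2)) + (∫ s in Set.Ioi b, ∫ y, (Es k1 k2 l b s x' (y, x'.2) : ℂ) * φ (y, x'.2))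
      = ∫ s in Set.Ioi 0, ∫ y, (Es k1 k2 l b s x' (y, x'.2) : ℂ) * φ (y, x'.2) := by
    rw [← hun, setIntegral_union (Set.Ioc_disjoint_Ioi le_rfl) measurableSet_Ioi (J1.mono_set (by rw [← hun]; exact Set.subset_union_left))
      (J1.mono_set (by rw [← hun]; exact Set.subset_union_right))]
  have vGp : ∫ x, (Gp k1 k2 l b x x' : ℂ) * F x = -(1 / Real.pi) * ∫ s in Set.Ioi 0, ∫ y, (Es k1 k2 l b s x' (y, x'.2) : ℂ) * φ (y, x'.2) := by
    rw [← integral_add_compl mm iGp, hcompl, vm, vp, ← vJ]; ring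
  have hB : ∫ y, ((qa k1 k2 l (y, x'.2) * qb k1 k2 l x' * Real.exp (k2 * (y - x'.1)) : ℝ) : ℂ) * φ (y, x'.2)
      = ∫ y, (B0 k1 k2 l b x' (y, x'.2) : ℂ) * φ (y, x'.2) := by
    simp [B0]
  have hsplit : ∫ x, (GG k1 k2 l b x x' : ℂ) * F x = (∫ x, (Gp k1 k2 l b x x' : ℂ) * F x) - C * ∫ x, (Bt k1 k2 l b x x' : ℂ) * F x := by
    rw [← integral_const_mul, ← integral_sub iGp (iBt.const_mul _)]
    refine integral_congr_ae (Filter.Eventually.of_forall fun x => ?_)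
    simp only [GG, Gp, hC]; push_cast; ring
  rw [hsplit, vGp, J2, vBt, hB, hC]
  have : (Real.pi : ℂ) ≠ 0 := ofReal_ne_zero.2 Real.pi_ne_zero
  push_cast
  field_simp
  ring

end Part15

section Part16
open scoped BoundedContinuousFunction

/-! ### Abstract existence and uniqueness -/

variable {G : ℝ × ℝ → ℝ × ℝ → ℝ} {K : ℝ} {f : ℝ × ℝ → ℂ} {D : ℝ}

lemma op_adj (hG : Ker G K) (hf : Src f D) {F : ℝ × ℝ → ℂ} (hF : Continuous F) (hFc : HasCompactSupport F) :
    ∫ x, op G f x * F x = ∫ x', f x' * ∫ x, (G x x' : ℂ) * F x := by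
  have h1 : ∀ x, op G f x * F x = ∫ x', (G x x' : ℂ) * f x' * F x := fun x => by
    rw [integral_mul_const]; rfl
  have h2 : ∀ x', f x' * ∫ x, (G x x' : ℂ) * F x = ∫ x, (G x x' : ℂ) * f x' * F x := fun x' => by
    rw [← integral_const_mul]
    exact integral_congr_ae (Filter.Eventually.of_forall fun x => by ring)
  simp_rw [h1, h2]
  refine integral_integral_swap ?_
  have hm : AEStronglyMeasurable (fun p : (ℝ × ℝ) × (ℝ × ℝ) => (G p.1 p.2 : ℂ) * f p.2 * F p.1) (volume.prod volume) := by
    refine AEStronglyMeasurable.mul (AEStronglyMeasurable.mul ?_ ?_) ?_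
    · exact (Complex.measurable_ofReal.comp hG.meas).aestronglyMeasurable
    · exact (hf.cont.comp continuous_snd).aestronglyMeasurable
    · exact (hF.comp continuous_fst).aestronglyMeasurable
  refine (integrable_prod_iff hm).2 ⟨Filter.Eventually.of_forall fun x => (op_int hG hf x).mul_const (F x), ?_⟩
  have i := (hF.integrable_of_hasCompactSupport hFc (μ := volume)).norm.const_mul (2 * K * D)
  refine i.mono' hm.norm.integral_prod_right' (Filter.Eventually.of_forall fun x => ?_)
  rw [Real.norm_of_nonneg (integral_nonneg fun _ => norm_nonneg _)]
  simp only [norm_mul]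
  rw [integral_mul_const]
  refine mul_le_mul_of_nonneg_right ?_ (norm_nonneg _)
  have := hG.Kn
  calc ∫ x', ‖(G x x' : ℂ)‖ * ‖f x'‖ ≤ ∫ x', 2 * K * (wt (x.2 - x'.2) * ‖f x'‖) := by
        refine integral_mono_of_nonneg (Filter.Eventually.of_forall fun _ => by positivity) ((hf.int x.2).const_mul _) (Filter.Eventually.of_forall fun x' => ?_)
        simp only
        rw [norm_real, ← mul_assoc]
        exact mul_le_mul_of_nonneg_right (hG.bdw x x') (norm_nonneg _)
    _ ≤ 2 * K * D := by
        rw [integral_const_mul]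
        exact mul_le_mul_of_nonneg_left (hf.le x.2) (by positivity)

/-- smallness of the potential -/
structure VSm (V : ℝ × ℝ → ℝ) (δ : ℝ) : Prop where
  cont : Continuous V
  int : ∀ t : ℝ, Integrable (fun x' : ℝ × ℝ => wt (t - x'.2) * |V x'|)
  le : ∀ t : ℝ, ∫ x' : ℝ × ℝ, wt (t - x'.2) * |V x'| ≤ δ

lemma VSm.src {V : ℝ × ℝ → ℝ} {δ : ℝ} (hV : VSm V δ) {m : ℝ × ℝ → ℂ} (hm : Continuous m) {B : ℝ} (hB : ∀ x, ‖m x‖ ≤ B) :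
    Src (fun x => (V x : ℂ) * m x) (δ * B) := by
  have hB0 : 0 ≤ B := (norm_nonneg _).trans (hB 0)
  have c1 : Continuous (fun x => (V x : ℂ) * m x) := (Complex.continuous_ofReal.comp hV.cont).mul hm
  have le : ∀ t, ∀ x' : ℝ × ℝ, wt (t - x'.2) * ‖(V x' : ℂ) * m x'‖ ≤ wt (t - x'.2) * |V x'| * B := fun t x' => by
    rw [norm_mul, norm_real, ← mul_assoc]
    have := wt_one (t - x'.2)
    exact mul_le_mul_of_nonneg_left (hB x') (mul_nonneg (by linarith) (norm_nonneg _))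
  have nn : ∀ t, ∀ x' : ℝ × ℝ, 0 ≤ wt (t - x'.2) * ‖(V x' : ℂ) * m x'‖ := fun t x' =>
    mul_nonneg (by have := wt_one (t - x'.2); linarith) (norm_nonneg _)
  refine ⟨c1, fun t => ?_, fun t => ?_⟩
  · refine ((hV.int t).mul_const B).mono' ?_ (Filter.Eventually.of_forall fun x' => ?_)
    · exact (wt_meas.comp (by fun_prop)).aestronglyMeasurable.mul c1.norm.aestronglyMeasurable
    · rw [Real.norm_of_nonneg (nn t x')]; exact le t x'
  · refine (integral_mono_of_nonneg (Filter.Eventually.of_forall (nn t)) ((hV.int t).mul_const B) (Filter.Eventually.of_forall (le t))).trans ?_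
    rw [integral_mul_const]
    exact mul_le_mul_of_nonneg_right (hV.le t) hB0

def WSol (b : ℝ) (U : ℝ × ℝ → ℝ) (m : ℝ × ℝ → ℂ) : Prop :=
  ∀ φ : ℝ × ℝ → ℂ, Sm φ → HasCompactSupport φ → ∫ x, m x * Hs b U φ x = 0

lemma Hs_add (b : ℝ) (U V : ℝ × ℝ → ℝ) (φ : ℝ × ℝ → ℂ) (x : ℝ × ℝ) :
    Hs b (fun x => U x + V x) φ x = Hs b U φ x + (V x : ℂ) * φ x := by
  unfold Hs; push_cast; ring

lemma cs_int {m F : ℝ × ℝ → ℂ} (hm : Continuous m) (hF : Continuous F) (hFc : HasCompactSupport F) :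
    Integrable (fun x => m x * F x) :=
  (hm.mul hF).integrable_of_hasCompactSupport hFc.mul_left

theorem abs_exists {b δ : ℝ} {U V : ℝ × ℝ → ℝ} (hU : Continuous U) (hG : Ker G K)
    (hfund : ∀ φ : ℝ × ℝ → ℂ, Sm φ → HasCompactSupport φ → ∀ x', ∫ x, (G x x' : ℂ) * Hs b U φ x = - φ x')
    (hV : VSm V δ) (hδ : 2 * K * δ ≤ 1 / 2) {χ : ℝ × ℝ → ℂ} (hχ : Continuous χ) {B : ℝ} (hB : ∀ x, ‖χ x‖ ≤ B)
    (hχs : WSol b U χ) :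
    ∃ m : ℝ × ℝ → ℂ, Continuous m ∧ (∃ B : ℝ, ∀ x, ‖m x‖ ≤ B) ∧ WSol b (fun x => U x + V x) m ∧
      Filter.Tendsto (fun x => m x - χ x) (Filter.cocompact (ℝ × ℝ)) (nhds 0) := by
  have hsrc : ∀ m : (ℝ × ℝ) →ᵇ ℂ, Src (fun x => (V x : ℂ) * m x) (δ * ‖m‖) := fun m =>
    hV.src m.continuous (fun x => m.norm_coe_le_norm x)
  let T : ((ℝ × ℝ) →ᵇ ℂ) → ((ℝ × ℝ) →ᵇ ℂ) := fun m =>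
    BoundedContinuousFunction.ofNormedAddCommGroup (fun x => χ x + op G (fun x => (V x : ℂ) * m x) x)
      (hχ.add (op_cont hG (hsrc m))) (B + 2 * K * (δ * ‖m‖))
      (fun x => (norm_add_le _ _).trans (add_le_add (hB x) (op_bd hG (hsrc m) x)))
  have hT : ContractingWith (1/2 : ℝ≥0) T := by
    refine ⟨by rw [← NNReal.coe_lt_coe]; norm_num, LipschitzWith.of_dist_le_mul fun m m' => ?_⟩
    rw [BoundedContinuousFunction.dist_le (by positivity)]
    intro x
    have e : T m x - T m' x = op G (fun x => (V x : ℂ) * (m - m') x) x := by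
      change (χ x + op G (fun x => (V x : ℂ) * m x) x) - (χ x + op G (fun x => (V x : ℂ) * m' x) x) = _
      unfold op
      rw [add_sub_add_left_eq_sub, ← integral_sub (op_int hG (hsrc m) x) (op_int hG (hsrc m') x)]
      refine integral_congr_ae (Filter.Eventually.of_forall fun x' => ?_)
      simp only [BoundedContinuousFunction.coe_sub, Pi.sub_apply]; ring
    rw [dist_eq_norm, e, dist_eq_norm]
    refine (op_bd hG (hsrc (m - m')) x).trans ?_
    have := norm_nonneg (m - m')
    calc 2 * K * (δ * ‖m - m'‖) = 2 * K * δ * ‖m - m'‖ := by ring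
      _ ≤ 1 / 2 * ‖m - m'‖ := by gcongr
      _ = _ := by norm_num
  obtain ⟨m, hm⟩ : ∃ m, T m = m := ⟨_, hT.fixedPoint_isFixedPt⟩
  have hm' : ∀ x, m x = χ x + op G (fun x => (V x : ℂ) * m x) x := fun x => by
    conv_lhs => rw [← hm]
    rfl
  refine ⟨m, m.continuous, ⟨‖m‖, fun x => m.norm_coe_le_norm x⟩, ?_, ?_⟩
  · intro φ hφ hc
    have hF : Continuous (Hs b U φ) := Hs_cont hU hφ
    have hFc : HasCompactSupport (Hs b U φ) := Hs_cs hφ hc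
    have i1 := cs_int hχ hF hFc
    have i2 := cs_int (op_cont hG (hsrc m)) hF hFc
    have i3 := cs_int (hsrc m).cont hφ.continuous hc
    have e : ∀ x, m x * Hs b (fun x => U x + V x) φ x = (χ x * Hs b U φ x + op G (fun x => (V x : ℂ) * m x) x * Hs b U φ x)
        + ((V x : ℂ) * m x) * φ x := fun x => by
      rw [Hs_add, mul_add]
      nth_rewrite 1 [hm' x]
      ring
    simp_rw [e]
    have i12 : Integrable (fun x => χ x * Hs b U φ x + op G (fun x => (V x : ℂ) * m x) x * Hs b U φ x) := i1.add i2
    rw [integral_add i12 i3, integral_add i1 i2, hχs φ hφ hc, op_adj hG (hsrc m) hF hFc]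
    simp_rw [hfund φ hφ hc]
    rw [zero_add, ← integral_add]
    · simp
    · simpa using i3.neg
    · exact i3
  · refine (op_tendsto hG (hsrc m)).congr fun x => ?_
    rw [hm' x]; ring

theorem abs_unique {b δ : ℝ} {U V : ℝ × ℝ → ℝ} (hU : Continuous U) (hG : Ker G K)
    (hfund : ∀ φ : ℝ × ℝ → ℂ, Sm φ → HasCompactSupport φ → ∀ x', ∫ x, (G x x' : ℂ) * Hs b U φ x = - φ x')
    (hV : VSm V δ) (hδ : 2 * K * δ ≤ 1 / 2)
    (hL : ∀ h : ℝ × ℝ → ℂ, Continuous h → (∃ B : ℝ, ∀ x, ‖h x‖ ≤ B) → WSol b U h →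
      Filter.Tendsto h (Filter.cocompact (ℝ × ℝ)) (nhds 0) → ∀ x, h x = 0)
    {w : ℝ × ℝ → ℂ} (hw : Continuous w) {B : ℝ} (hB : ∀ x, ‖w x‖ ≤ B) (hs : WSol b (fun x => U x + V x) w)
    (ht : Filter.Tendsto w (Filter.cocompact (ℝ × ℝ)) (nhds 0)) : ∀ x, w x = 0 := by
  let W : (ℝ × ℝ) →ᵇ ℂ := BoundedContinuousFunction.ofNormedAddCommGroup w hw B hB
  have hW : ∀ x, ‖w x‖ ≤ ‖W‖ := fun x => W.norm_coe_le_norm x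
  have hsrc := hV.src hw hW
  have hz := hL (fun x => w x - op G (fun x => (V x : ℂ) * w x) x) (hw.sub (op_cont hG hsrc))
    ⟨B + 2 * K * (δ * ‖W‖), fun x => (norm_sub_le _ _).trans (add_le_add (hB x) (op_bd hG hsrc x))⟩ ?_ ?_
  · have h1 : ‖W‖ ≤ 1 / 2 * ‖W‖ := by
      refine W.norm_le (by positivity) |>.2 fun x => ?_
      have : W x = op G (fun x => (V x : ℂ) * w x) x := sub_eq_zero.1 (hz x)
      rw [this]
      refine (op_bd hG hsrc x).trans ?_
      calc 2 * K * (δ * ‖W‖) = 2 * K * δ * ‖W‖ := by ring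
        _ ≤ 1 / 2 * ‖W‖ := by gcongr
    have h2 : ‖W‖ ≤ 0 := by linarith
    intro x
    exact norm_le_zero_iff.1 ((hW x).trans h2)
  · intro φ hφ hc
    have hF : Continuous (Hs b U φ) := Hs_cont hU hφ
    have hFc : HasCompactSupport (Hs b U φ) := Hs_cs hφ hc
    have i1 := cs_int hw hF hFc
    have i2 := cs_int (op_cont hG hsrc) hF hFc
    have i3 := cs_int hsrc.cont hφ.continuous hc
    have h1 := hs φ hφ hc
    have e : ∀ x, w x * Hs b (fun x => U x + V x) φ x = w x * Hs b U φ x + ((V x : ℂ) * w x) * φ x := fun x => by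
      rw [Hs_add]; ring
    simp_rw [e] at h1
    rw [integral_add i1 i3] at h1
    simp_rw [sub_mul]
    rw [integral_sub i1 i2, op_adj hG hsrc hF hFc]
    simp_rw [hfund φ hφ hc, mul_neg]
    rw [integral_neg, sub_neg_eq_add]
    exact h1
  · have := ht.sub (op_tendsto hG hsrc)
    simpa using this

end Part16

section Part17

/-! ### Liouville theorem -/

/-- correlation -/
def Cv (g f : ℝ × ℝ → ℂ) (z : ℝ × ℝ) : ℂ := ∫ x, g x * f (x + z)

lemma Cv_conv (g f : ℝ × ℝ → ℂ) :
    Cv g f = MeasureTheory.convolution (fun x => g (-x)) f (ContinuousLinearMap.mul ℝ ℂ) volume := by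
  ext z
  unfold Cv MeasureTheory.convolution
  rw [← integral_neg_eq_self (fun x => g x * f (x + z))]
  refine integral_congr_ae (Filter.Eventually.of_forall fun x => ?_)
  simp only [ContinuousLinearMap.mul_apply', neg_add_eq_sub]

lemma Cv_sm {g f : ℝ × ℝ → ℂ} (hg : Continuous g) (hf : Sm f) (hc : HasCompactSupport f) : Sm (Cv g f) := by
  rw [Cv_conv]
  exact hc.contDiff_convolution_right _ (by fun_prop : Continuous fun x => g (-x)).locallyIntegrable hf

lemma Cv_fd {g f : ℝ × ℝ → ℂ} (hg : Continuous g) (hf : Sm f) (hc : HasCompactSupport f) (z v : ℝ × ℝ) :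
    fderiv ℝ (Cv g f) z v = Cv g (fun x => fderiv ℝ f x v) z := by
  have hl : LocallyIntegrable (fun x => g (-x)) := (by fun_prop : Continuous fun x => g (-x)).locallyIntegrable
  have h := hc.hasFDerivAt_convolution_right (ContinuousLinearMap.mul ℝ ℂ) hl (hf.of_le (by simp)) z
  rw [Cv_conv g f, h.fderiv, Cv_conv]
  unfold MeasureTheory.convolution
  rw [ContinuousLinearMap.integral_apply]
  · rfl
  · have := (hc.fderiv (𝕜 := ℝ)).convolutionExists_right ((ContinuousLinearMap.mul ℝ ℂ).precompR (ℝ × ℝ)) hl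
      (hf.continuous_fderiv (by simp)) z
    exact this

lemma Cv_pd1 {g f : ℝ × ℝ → ℂ} (hg : Continuous g) (hf : Sm f) (hc : HasCompactSupport f) :
    pd1 (Cv g f) = Cv g (pd1 f) := by
  rw [pd1_eq_fderiv (Cv_sm hg hf hc), pd1_eq_fderiv hf]
  exact funext fun z => Cv_fd hg hf hc z _
lemma Cv_pd2 {g f : ℝ × ℝ → ℂ} (hg : Continuous g) (hf : Sm f) (hc : HasCompactSupport f) :
    pd2 (Cv g f) = Cv g (pd2 f) := by
  rw [pd2_eq_fderiv (Cv_sm hg hf hc), pd2_eq_fderiv hf]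
  exact funext fun z => Cv_fd hg hf hc z _

lemma cs_tr {f : ℝ × ℝ → ℂ} (hc : HasCompactSupport f) (z : ℝ × ℝ) : HasCompactSupport (fun x => f (x + z)) :=
  hc.comp_homeomorph (Homeomorph.addRight z)

lemma sm_tr {f : ℝ × ℝ → ℂ} (hf : Sm f) (z : ℝ × ℝ) : Sm (fun x => f (x + z)) :=
  hf.comp (contDiff_id.add contDiff_const)

lemma pd1_tr (f : ℝ × ℝ → ℂ) (z : ℝ × ℝ) : pd1 (fun x => f (x + z)) = fun x => pd1 f (x + z) := by
  ext x
  unfold pd1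
  exact deriv_comp_add_const (f := fun t => f (t, x.2 + z.2)) (a := z.1) (x := x.1)
lemma pd2_tr (f : ℝ × ℝ → ℂ) (z : ℝ × ℝ) : pd2 (fun x => f (x + z)) = fun x => pd2 f (x + z) := by
  ext x
  unfold pd2
  exact deriv_comp_add_const (f := fun t => f (x.1 + z.1, t)) (a := z.2) (x := x.2)

lemma Cv_int {g f : ℝ × ℝ → ℂ} (hg : Continuous g) (hf : Continuous f) (hc : HasCompactSupport f) (z : ℝ × ℝ) :
    Integrable (fun x => g x * f (x + z)) :=
  cs_int hg (hf.comp (continuous_id.add continuous_const)) (cs_tr hc z)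

lemma Cv_tendsto {g f : ℝ × ℝ → ℂ} (hg : Continuous g) {B : ℝ} (hB : ∀ x, ‖g x‖ ≤ B)
    (ht : Filter.Tendsto g (Filter.cocompact (ℝ × ℝ)) (nhds 0)) (hf : Continuous f) (hc : HasCompactSupport f) :
    Filter.Tendsto (Cv g f) (Filter.cocompact (ℝ × ℝ)) (nhds 0) := by
  have e : Cv g f = fun z => ∫ x, g (x - z) * f x := by
    ext z
    unfold Cv
    rw [← integral_sub_right_eq_self (fun x => g x * f (x + z)) z]
    simp
  rw [e]
  have hcg : (Filter.cocompact (ℝ × ℝ)).IsCountablyGenerated := by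
    rw [← Metric.cobounded_eq_cocompact, ← comap_norm_atTop]; infer_instance
  have := tendsto_integral_filter_of_dominated_convergence (l := Filter.cocompact (ℝ × ℝ)) (μ := volume)
    (F := fun z x => g (x - z) * f x) (f := fun _ => 0) (fun x => B * ‖f x‖)
    (Filter.Eventually.of_forall fun z => by
      exact ((hg.comp (continuous_id.sub continuous_const)).mul hf).aestronglyMeasurable)
    (Filter.Eventually.of_forall fun z => Filter.Eventually.of_forall fun x => by
      rw [norm_mul]; exact mul_le_mul_of_nonneg_right (hB _) (norm_nonneg _))
    ((hf.integrable_of_hasCompactSupport hc).norm.const_mul B)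
    (Filter.Eventually.of_forall fun x => by
      have h1 : Filter.Tendsto (fun z => x - z) (Filter.cocompact (ℝ × ℝ)) (Filter.cocompact (ℝ × ℝ)) :=
        (Homeomorph.subLeft x).isClosedEmbedding.tendsto_cocompact
      simpa using (ht.comp h1).mul_const (f x))
  simpa using this

/-- the Darboux coefficient -/
def Tt (k1 k2 l : ℝ) (x : ℝ × ℝ) : ℂ := k2 * qa k1 k2 l x + k1 * qb k1 k2 l x

lemma Tt_sm (k1 k2 l : ℝ) : Sm (Tt k1 k2 l) :=
  (contDiff_const.mul (qa_sm k1 k2 l)).add (contDiff_const.mul (qb_sm k1 k2 l))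

lemma pd1_const (c : ℂ) : pd1 (fun _ : ℝ × ℝ => c) = fun _ => 0 := by
  ext x; simp [pd1]
lemma pd2_const (c : ℂ) : pd2 (fun _ : ℝ × ℝ => c) = fun _ => 0 := by
  ext x; simp [pd2]

lemma Tt_pd1 (k1 k2 l : ℝ) : pd1 (Tt k1 k2 l) = fun x => (-(k2 - k1) ^ 2 : ℂ) * (qa k1 k2 l x * qb k1 k2 l x) := by
  unfold Tt
  rw [pd1_add (contDiff_const.mul (qa_sm k1 k2 l)) (contDiff_const.mul (qb_sm k1 k2 l)),
    pd1_mul contDiff_const (qa_sm k1 k2 l), pd1_mul contDiff_const (qb_sm k1 k2 l), qa_pd1, qb_pd1, pd1_const, pd1_const]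
  ext x; ring
lemma Tt_pd2 (k1 k2 l : ℝ) : pd2 (Tt k1 k2 l) = fun x => (-(k2 - k1) * (k2 ^ 2 - k1 ^ 2) : ℂ) * (qa k1 k2 l x * qb k1 k2 l x) := by
  unfold Tt
  rw [pd2_add (contDiff_const.mul (qa_sm k1 k2 l)) (contDiff_const.mul (qb_sm k1 k2 l)),
    pd2_mul contDiff_const (qa_sm k1 k2 l), pd2_mul contDiff_const (qb_sm k1 k2 l), qa_pd2, qb_pd2, pd2_const, pd2_const]
  ext x; ring

lemma darboux (k1 k2 l b : ℝ) {ψ : ℝ × ℝ → ℂ} (hψ : Sm ψ) (x : ℝ × ℝ) :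
    Hs b (uu k1 k2 l) (fun x => pd1 ψ x + Tt k1 k2 l x * ψ x) x
      = Hs b (fun _ => 0) (pd1 ψ) x + Tt k1 k2 l x * Hs b (fun _ => 0) ψ x := by
  have T := Tt_sm k1 k2 l
  have A := qa_sm k1 k2 l
  have B := qb_sm k1 k2 l
  have QQ : Sm (fun x => (qa k1 k2 l x * qb k1 k2 l x : ℂ)) := A.mul B
  have C : Sm (fun _ => (-(k2 - k1) ^ 2 : ℂ)) := contDiff_const
  unfold Hs
  rw [pd2_add hψ.pd1 (T.mul hψ), pd2_mul T hψ, pd1_add hψ.pd1 (T.mul hψ), pd1_mul T hψ,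
    pd1_add hψ.pd1.pd1 ((T.pd1.mul hψ).add (T.mul hψ.pd1)), pd1_add (T.pd1.mul hψ) (T.mul hψ.pd1),
    pd1_mul T.pd1 hψ, pd1_mul T hψ.pd1, Tt_pd2, Tt_pd1, pd1_mul C QQ, pd1_mul A B, qa_pd1, qb_pd1, pd1_const]
  have hq : (qb k1 k2 l x : ℂ) = 1 - qa k1 k2 l x := by
    rw [qb_fun]; push_cast; ring
  simp only [uu, Tt]
  push_cast
  rw [hq]
  ring

end Part17

section Part18

lemma G0_heat {t : ℝ} (ht : 0 < t) (Y : ℝ) : |G0 0 Y t| ≤ 1 / √t * Real.exp (-(1 / (4 * t)) * Y ^ 2) := by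
  have hF := fourierIntegral_gaussian (b := (t : ℂ)) (by simpa using ht) (Y : ℂ)
  have hi : Integrable (fun x : ℝ => cexp (I * Y * x) * cexp (-(t : ℂ) * x ^ 2)) := by
    have := integrable_cexp_quadratic (b := (t : ℂ)) (by simpa using ht) (I * Y) 0
    refine this.congr (Filter.Eventually.of_forall fun x => ?_)
    simp only [← Complex.exp_add]
    congr 1; ring
  have h1 : ∫ s : ℝ, Real.cos (s * Y) * Real.exp (-t * s ^ 2) = (∫ x : ℝ, cexp (I * Y * x) * cexp (-(t : ℂ) * x ^ 2)).re := by
    have h := integral_re (𝕜 := ℂ) hi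
    simp only [RCLike.re_to_complex] at h
    rw [← h]
    refine integral_congr_ae (Filter.Eventually.of_forall fun s => ?_)
    simp only
    have e1 : cexp (I * Y * s) * cexp (-(t : ℂ) * s ^ 2) = cexp (((s * Y : ℝ) : ℂ) * I) * ((Real.exp (-t * s ^ 2) : ℝ) : ℂ) := by
      push_cast; congr 2; ring
    rw [e1, Complex.re_mul_ofReal, Complex.exp_ofReal_mul_I_re]
  have h2 : ∫ s : ℝ, Real.cos (s * Y) * Real.exp (-t * s ^ 2) = 2 * ∫ s in Set.Ioi (0:ℝ), Real.cos (s * Y) * Real.exp (-t * s ^ 2) := by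
    rw [← integral_comp_abs (f := fun s => Real.cos (s * Y) * Real.exp (-t * s ^ 2))]
    refine integral_congr_ae (Filter.Eventually.of_forall fun s => ?_)
    simp only [sq_abs]
    rcases abs_choice s with h | h <;> rw [h]
    rw [show -s * Y = -(s * Y) by ring, Real.cos_neg]
  have h3 : |∫ s : ℝ, Real.cos (s * Y) * Real.exp (-t * s ^ 2)| ≤ √(Real.pi / t) * Real.exp (-(1 / (4 * t)) * Y ^ 2) := by
    rw [h1, hF]
    refine (Complex.abs_re_le_norm _).trans ?_
    rw [norm_mul]
    apply le_of_eq
    congr 1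
    · rw [← Complex.ofReal_div, Complex.norm_cpow_eq_rpow_re_of_pos (by positivity), Real.sqrt_eq_rpow]
      norm_num
    · rw [Complex.norm_exp]
      congr 1
      have : (-(Y:ℂ) ^ 2 / (4 * (t:ℂ))) = ((-(1 / (4 * t)) * Y ^ 2 : ℝ) : ℂ) := by push_cast; ring
      rw [this, Complex.ofReal_re]
  have h4 : G0 0 Y t = 1 / Real.pi * ∫ s in Set.Ioi (0:ℝ), Real.cos (s * Y) * Real.exp (-t * s ^ 2) := by
    unfold G0 PP
    rw [Preg_pos ht, Real.sign_of_pos ht]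
    congr 1
    refine integral_congr_ae (Filter.Eventually.of_forall fun s => ?_)
    simp only
    congr 2; ring
  have h5 : G0 0 Y t = 1 / (2 * Real.pi) * ∫ s : ℝ, Real.cos (s * Y) * Real.exp (-t * s ^ 2) := by
    rw [h4, h2]
    generalize (∫ s in Set.Ioi (0:ℝ), Real.cos (s * Y) * Real.exp (-t * s ^ 2)) = J
    field_simp
  rw [h5, abs_mul, abs_of_pos (by positivity)]
  have hpi := Real.pi_gt_three
  have h6 : √Real.pi ≤ Real.pi := Real.sqrt_le_iff.2 ⟨by linarith, by nlinarith⟩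
  calc 1 / (2 * Real.pi) * |∫ s : ℝ, Real.cos (s * Y) * Real.exp (-t * s ^ 2)|
      ≤ 1 / (2 * Real.pi) * (√(Real.pi / t) * Real.exp (-(1 / (4 * t)) * Y ^ 2)) := by gcongr
    _ = (√Real.pi / (2 * Real.pi)) * (1 / √t * Real.exp (-(1 / (4 * t)) * Y ^ 2)) := by
        rw [Real.sqrt_div Real.pi_pos.le]; ring
    _ ≤ 1 * (1 / √t * Real.exp (-(1 / (4 * t)) * Y ^ 2)) := by
        gcongr
        rw [div_le_one (by positivity)]; linarith
    _ = _ := one_mul _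

lemma G0_slab {b : ℝ} (hb : 0 ≤ b) : ∃ C : ℝ, 0 ≤ C ∧ ∀ R t : ℝ, 0 < R → R ≤ |t| →
    ∫⁻ Y in Set.Icc (-(2 * R)) (2 * R), ENNReal.ofReal |G0 b Y t| ≤ ENNReal.ofReal C := by
  rcases hb.eq_or_lt with h0 | h0
  · subst h0
    refine ⟨4, by norm_num, fun R t hR ht => ?_⟩
    rcases lt_trichotomy t 0 with h | h | h
    · have : ∀ Y, G0 0 Y t = 0 := fun Y => by
        unfold G0 PP; rw [Preg_neg h]; simp
      simp [this]
    · subst h; simp at ht; linarith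
    · calc ∫⁻ Y in Set.Icc (-(2 * R)) (2 * R), ENNReal.ofReal |G0 0 Y t|
          ≤ ∫⁻ Y : ℝ, ENNReal.ofReal (1 / √t * Real.exp (-(1 / (4 * t)) * Y ^ 2)) :=
            (setLIntegral_le_lintegral _ _).trans (lintegral_mono fun Y => ENNReal.ofReal_le_ofReal (G0_heat h Y))
        _ = ENNReal.ofReal (∫ Y : ℝ, (1 / √t * Real.exp (-(1 / (4 * t)) * Y ^ 2))) := by
            rw [ofReal_integral_eq_lintegral_ofReal ((integrable_exp_neg_mul_sq (by positivity)).const_mul _)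
              (Filter.Eventually.of_forall fun Y => by positivity)]
        _ ≤ _ := by
            refine ENNReal.ofReal_le_ofReal ?_
            rw [integral_const_mul, integral_gaussian]
            have e : Real.pi / (1 / (4 * t)) = (4 * Real.pi) * t := by field_simp
            rw [e, Real.sqrt_mul (by positivity)]
            have : √t ≠ 0 := by positivity
            field_simp
            have hpi := Real.pi_lt_four
            exact Real.sqrt_le_iff.2 ⟨by norm_num, by nlinarith⟩
  · refine ⟨4 / b, by positivity, fun R t hR ht => ?_⟩
    have ht0 : 0 < |t| := hR.trans_le ht
    calc ∫⁻ Y in Set.Icc (-(2 * R)) (2 * R), ENNReal.ofReal |G0 b Y t|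
          ≤ ∫⁻ Y in Set.Icc (-(2 * R)) (2 * R), ENNReal.ofReal (1 / (b * R)) :=
            lintegral_mono fun Y => ENNReal.ofReal_le_ofReal ((G0_bt h0 Y t).trans (by gcongr))
      _ = ENNReal.ofReal (1 / (b * R)) * ENNReal.ofReal (4 * R) := by
          rw [setLIntegral_const, Real.volume_Icc]; congr 2; ring
      _ ≤ _ := by
          rw [← ENNReal.ofReal_mul (by positivity)]
          refine ENNReal.ofReal_le_ofReal (le_of_eq ?_)
          field_simp

end Part18

section Part19

lemma cutoff : ∃ (ζ : ℝ → ℝ) (c : ℝ), ContDiff ℝ (⊤ : ℕ∞) ζ ∧ ζ 0 = 1 ∧ (∀ s, |ζ s| ≤ 1) ∧ (∀ s, 2 < |s| → ζ s = 0) ∧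
    0 ≤ c ∧ (∀ s, |deriv ζ s| ≤ c) ∧ (∀ s, |deriv (deriv ζ) s| ≤ c) ∧
    (∀ s, |s| < 1 → deriv ζ s = 0) ∧ (∀ s, |s| < 1 → deriv (deriv ζ) s = 0) ∧
    (∀ s, 2 < |s| → deriv ζ s = 0) ∧ (∀ s, 2 < |s| → deriv (deriv ζ) s = 0) := by
  let f : ContDiffBump (0 : ℝ) := ⟨1, 2, by norm_num, by norm_num⟩
  have hf : ContDiff ℝ (⊤ : ℕ∞) f := f.contDiff
  have h1 : ContDiff ℝ (⊤ : ℕ∞) (deriv f) := by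
    exact ((contDiff_succ_iff_deriv (n := ((⊤ : ℕ∞) : WithTop ℕ∞))).1 (by simpa using hf)).2.2
  have h2 : ContDiff ℝ (⊤ : ℕ∞) (deriv (deriv f)) := by
    exact ((contDiff_succ_iff_deriv (n := ((⊤ : ℕ∞) : WithTop ℕ∞))).1 (by simpa using h1)).2.2
  have hc : HasCompactSupport f := f.hasCompactSupport
  obtain ⟨c1, hc1⟩ := hc.deriv.exists_bound_of_continuous h1.continuous
  obtain ⟨c2, hc2⟩ := hc.deriv.deriv.exists_bound_of_continuous h2.continuous
  have in1 : ∀ s : ℝ, |s| < 1 → (f : ℝ → ℝ) =ᶠ[nhds s] fun _ => 1 := fun s hs => by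
    have : Metric.ball (0:ℝ) 1 ∈ nhds s := Metric.isOpen_ball.mem_nhds (by simpa using hs)
    filter_upwards [this] with y hy
    exact f.one_of_mem_closedBall (Metric.ball_subset_closedBall hy)
  have out : ∀ s : ℝ, 2 < |s| → (f : ℝ → ℝ) =ᶠ[nhds s] fun _ => 0 := fun s hs => by
    have : (Metric.closedBall (0:ℝ) 2)ᶜ ∈ nhds s := Metric.isClosed_closedBall.isOpen_compl.mem_nhds (by simpa using hs)
    filter_upwards [this] with y hy
    refine f.zero_of_le_dist ?_
    simp at hy
    simpa using hy.le
  refine ⟨f, max c1 c2, hf, (in1 0 (by simp)).eq_of_nhds, fun s => ?_, fun s hs => (out s hs).eq_of_nhds, ?_, fun s => ?_, fun s => ?_,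
    fun s hs => ?_, fun s hs => ?_, fun s hs => ?_, fun s hs => ?_⟩
  · rw [abs_of_nonneg f.nonneg]; exact f.le_one
  · exact le_max_of_le_left ((norm_nonneg _).trans (hc1 0))
  · exact (hc1 s).trans (le_max_left _ _)
  · exact (hc2 s).trans (le_max_right _ _)
  · rw [(in1 s hs).deriv_eq]; simp
  · rw [(in1 s hs).deriv.deriv_eq]; simp
  · rw [(out s hs).deriv_eq]; simp
  · rw [(out s hs).deriv.deriv_eq]; simp

lemma GG_free (b : ℝ) (x : ℝ × ℝ) : GG 1 1 0 b x 0 = G0 b x.1 x.2 := by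
  simp [GG]
lemma uu_free : uu 1 1 0 = fun _ => 0 := by
  ext x; simp [uu]

lemma G0_box {b R C : ℝ} (hm : Measurable (fun x : ℝ × ℝ => G0 b x.1 x.2)) (hR : 0 < R)
    (hC : ∀ t : ℝ, R ≤ |t| → ∫⁻ Y in Set.Icc (-(2 * R)) (2 * R), ENNReal.ofReal |G0 b Y t| ≤ ENNReal.ofReal C) :
    ∫⁻ x in Set.Icc (-(2 * R)) (2 * R) ×ˢ Set.Icc (-(2 * R)) (2 * R),
      (if R ≤ |x.2| then ENNReal.ofReal |G0 b x.1 x.2| else 0) ≤ ENNReal.ofReal (4 * R) * ENNReal.ofReal C := by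
  have ms : MeasurableSet {x : ℝ × ℝ | R ≤ |x.2|} := measurableSet_le measurable_const (by fun_prop)
  have hm' : Measurable (fun x : ℝ × ℝ => if R ≤ |x.2| then ENNReal.ofReal |G0 b x.1 x.2| else 0) :=
    Measurable.ite ms hm.abs.ennreal_ofReal measurable_const
  rw [Measure.volume_eq_prod, ← Measure.prod_restrict, lintegral_prod_symm _ hm'.aemeasurable]
  calc _ ≤ ∫⁻ t in Set.Icc (-(2 * R)) (2 * R), ENNReal.ofReal C := by
        refine lintegral_mono fun t => ?_
        by_cases h : R ≤ |t|
        · simpa [h] using hC t h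
        · simp [h]
    _ = _ := by
        rw [setLIntegral_const, Real.volume_Icc, mul_comm]; congr 2; ring

end Part19

section Part20

lemma Hs_cut {b r : ℝ} {ζ : ℝ → ℝ} (hζ : ContDiff ℝ (⊤ : ℕ∞) ζ) {P : ℝ × ℝ → ℂ} (hP : Sm P)
    (hs : ∀ x, Hs b (fun _ => 0) P x = 0) :
    Sm (fun x => ((ζ (r * x.1) : ℂ) * (ζ (r * x.2) : ℂ)) * P x) ∧
    ∀ x, Hs b (fun _ => 0) (fun x => ((ζ (r * x.1) : ℂ) * (ζ (r * x.2) : ℂ)) * P x) x =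
      ((r ^ 2 * deriv (deriv ζ) (r * x.1) * ζ (r * x.2) : ℝ) : ℂ) * P x
      + ((2 * r * deriv ζ (r * x.1) * ζ (r * x.2) : ℝ) : ℂ) * pd1 P x
      + ((r * ζ (r * x.1) * deriv ζ (r * x.2) : ℝ) : ℂ) * P x := by
  have hζ1 : ContDiff ℝ (⊤ : ℕ∞) (deriv ζ) := by
    exact ((contDiff_succ_iff_deriv (n := ((⊤ : ℕ∞) : WithTop ℕ∞))).1 (by simpa using hζ)).2.2
  have sA : Sm (fun x => (ζ (r * x.1) : ℂ)) := ofReal_sm (f := fun x => ζ (r * x.1)) (hζ.comp (by fun_prop))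
  have sA1 : Sm (fun x => ((r * deriv ζ (r * x.1) : ℝ) : ℂ)) :=
    ofReal_sm (f := fun x => r * deriv ζ (r * x.1)) (contDiff_const.mul (hζ1.comp (by fun_prop)))
  have sB : Sm (fun x => (ζ (r * x.2) : ℂ)) := ofReal_sm (f := fun x => ζ (r * x.2)) (hζ.comp (by fun_prop))
  have gen : ∀ (g : ℝ → ℝ) (hg : Differentiable ℝ g) (y : ℝ), HasDerivAt (fun y => ((g (r * y) : ℝ) : ℂ)) ((r * deriv g (r * y) : ℝ) : ℂ) y := by
    intro g hg y
    have h1 := (hg (r * y)).hasDerivAt.comp y ((hasDerivAt_id y).const_mul r)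
    have := h1.ofReal_comp
    exact this.congr_deriv (by simp only [mul_one]; rw [mul_comm])
  have dA : pd1 (fun x : ℝ × ℝ => (ζ (r * x.1) : ℂ)) = fun x => ((r * deriv ζ (r * x.1) : ℝ) : ℂ) :=
    funext fun x => (gen ζ (hζ.differentiable (by simp)) x.1).deriv
  have dA1 : pd1 (fun x : ℝ × ℝ => ((r * deriv ζ (r * x.1) : ℝ) : ℂ)) = fun x => ((r * (r * deriv (deriv ζ) (r * x.1)) : ℝ) : ℂ) :=
    funext fun x => by
      have := ((gen _ (hζ1.differentiable (by simp)) x.1).const_mul (r : ℂ)).deriv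
      unfold pd1
      push_cast at this ⊢
      exact this
  have dA2 : pd2 (fun x : ℝ × ℝ => (ζ (r * x.1) : ℂ)) = fun x => 0 := funext fun x => by simp [pd2]
  have dB : pd2 (fun x : ℝ × ℝ => (ζ (r * x.2) : ℂ)) = fun x => ((r * deriv ζ (r * x.2) : ℝ) : ℂ) :=
    funext fun x => (gen ζ (hζ.differentiable (by simp)) x.2).deriv
  have dB1 : pd1 (fun x : ℝ × ℝ => (ζ (r * x.2) : ℂ)) = fun x => 0 := funext fun x => by simp [pd1]
  have sAB := sA.mul sB
  refine ⟨sAB.mul hP, fun x => ?_⟩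
  have e1 : pd1 (fun x => ((ζ (r * x.1) : ℂ) * (ζ (r * x.2) : ℂ)) * P x) =
      fun x => (((r * deriv ζ (r * x.1) : ℝ) : ℂ) * (ζ (r * x.2) : ℂ)) * P x + ((ζ (r * x.1) : ℂ) * (ζ (r * x.2) : ℂ)) * pd1 P x := by
    rw [pd1_mul sAB hP, pd1_mul sA sB, dA, dB1]; ext x; ring
  have h0 := hs x
  unfold Hs at h0 ⊢
  rw [e1, pd1_add ((sA1.mul sB).mul hP) (sAB.mul hP.pd1), pd1_mul (sA1.mul sB) hP, pd1_mul sAB hP.pd1,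
    pd1_mul sA1 sB, pd1_mul sA sB, dA1, dB1, dA, pd2_mul sAB hP, pd2_mul sA sB, dA2, dB]
  push_cast at h0 ⊢
  linear_combination ((ζ (r * x.1) : ℂ) * (ζ (r * x.2) : ℂ)) * h0

theorem free_liouville {b : ℝ} (hb : 0 ≤ b) {P : ℝ × ℝ → ℂ} (hP : Sm P)
    (hs : ∀ x, Hs b (fun _ => 0) P x = 0) (t0 : Filter.Tendsto P (Filter.cocompact (ℝ × ℝ)) (nhds 0))
    (t1 : Filter.Tendsto (pd1 P) (Filter.cocompact (ℝ × ℝ)) (nhds 0)) : P 0 = 0 := by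
  obtain ⟨ζ, c, hζ, z0, z1, z2, c0, d1, d2, i1, i2, o1, o2⟩ := cutoff
  obtain ⟨C, hC0, hC⟩ := G0_slab hb
  have hG := GG_ker (le_refl (1:ℝ)) hb (by norm_num) (by norm_num) 0
  have hm : Measurable (fun x : ℝ × ℝ => G0 b x.1 x.2) := by
    have := hG.meas.comp (measurable_id.prodMk (measurable_const (a := (0 : ℝ × ℝ))))
    have e : (fun x : ℝ × ℝ => G0 b x.1 x.2) = ((fun z : (ℝ × ℝ) × (ℝ × ℝ) => GG 1 1 0 b z.1 z.2) ∘ fun a => (id a, 0)) := by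
      ext x; exact (GG_free b x).symm
    rw [e]; exact this
  suffices H : ∀ δ : ℝ, 0 < δ → ‖P 0‖ ≤ (96 * c + 4 * C * c) * δ by
    by_contra hne
    have hpos : 0 < ‖P 0‖ := norm_pos_iff.2 hne
    have hK : 0 ≤ 96 * c + 4 * C * c := by positivity
    have := H (‖P 0‖ / (2 * (96 * c + 4 * C * c + 1))) (by positivity)
    rw [mul_div_assoc', le_div_iff₀ (by positivity)] at this
    nlinarith
  intro δ hδ
  have hev : ∀ᶠ x in Filter.cocompact (ℝ × ℝ), ‖P x‖ < δ ∧ ‖pd1 P x‖ < δ := by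
    have := (t0.norm.eventually_lt_const (u := δ) (by simpa)).and (t1.norm.eventually_lt_const (u := δ) (by simpa))
    exact this
  rw [← Metric.cobounded_eq_cocompact, ← comap_norm_atTop, Filter.eventually_comap] at hev
  obtain ⟨R0, hR0⟩ := Filter.eventually_atTop.1 hev
  set R := max R0 1 with hRdef
  have hR1 : 1 ≤ R := le_max_right _ _
  have hRp : 0 < R := by linarith
  have hsm : ∀ x : ℝ × ℝ, R ≤ ‖x‖ → ‖P x‖ ≤ δ ∧ ‖pd1 P x‖ ≤ δ := fun x hx => by
    have := hR0 ‖x‖ ((le_max_left _ _).trans hx) x rfl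
    exact ⟨this.1.le, this.2.le⟩
  set r := R⁻¹ with hr
  have hrp : 0 < r := inv_pos.2 hRp
  have hr1 : r ≤ 1 := inv_le_one_of_one_le₀ hR1
  have habs : ∀ y : ℝ, |r * y| = |y| / R := fun y => by rw [abs_mul, abs_of_pos hrp, hr]; field_simp
  obtain ⟨sφ, hφ⟩ := Hs_cut (b := b) (r := r) hζ hP hs
  set φ : ℝ × ℝ → ℂ := fun x => ((ζ (r * x.1) : ℂ) * (ζ (r * x.2) : ℂ)) * P x with hφd
  have out : ∀ y : ℝ, 2 * R < |y| → 2 < |r * y| := fun y hy => by rw [habs, lt_div_iff₀ hRp]; exact hy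
  have inn : ∀ y : ℝ, |y| < R → |r * y| < 1 := fun y hy => by rw [habs, div_lt_one hRp]; exact hy
  have cφ : HasCompactSupport φ := by
    refine HasCompactSupport.intro (isCompact_Icc.prod isCompact_Icc : IsCompact (Set.Icc (-(2 * R)) (2 * R) ×ˢ Set.Icc (-(2 * R)) (2 * R))) fun x hx => ?_
    simp only [Set.mem_prod, Set.mem_Icc, ← abs_le, not_and_or, not_le] at hx
    rcases hx with h | h
    · simp [hφd, z2 _ (out _ h)]
    · simp [hφd, z2 _ (out _ h)]
  have key := fund (k1 := 1) (k2 := 1) (l := 0) hb hG sφ cφ 0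
  rw [uu_free] at key
  simp_rw [GG_free] at key
  have hφ0 : φ 0 = P 0 := by simp [hφd, z0]
  set S : Set (ℝ × ℝ) := Set.Icc (-(2 * R)) (2 * R) ×ˢ Set.Icc (-(2 * R)) (2 * R) with hS
  have mS : MeasurableSet S := measurableSet_Icc.prod measurableSet_Icc
  have n1 : ‖P 0‖ₑ ≤ ∫⁻ x, S.indicator (fun x => ENNReal.ofReal (6 * c * δ / R ^ 2)
      + (if R ≤ |x.2| then ENNReal.ofReal |G0 b x.1 x.2| else 0) * ENNReal.ofReal (c * δ / R)) x := by
    rw [← hφ0, ← enorm_neg, ← key]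
    refine (enorm_integral_le_lintegral_enorm _).trans (lintegral_mono fun x => ?_)
    by_cases hx : x ∈ S
    · rw [Set.indicator_of_mem hx]
      have e : ENNReal.ofReal (6 * c * δ / R ^ 2)
          + (if R ≤ |x.2| then ENNReal.ofReal |G0 b x.1 x.2| else 0) * ENNReal.ofReal (c * δ / R)
          = ENNReal.ofReal (6 * c * δ / R ^ 2 + (if R ≤ |x.2| then |G0 b x.1 x.2| else 0) * (c * δ / R)) := by
        rw [ENNReal.ofReal_add (by positivity) (by split_ifs <;> positivity), ENNReal.ofReal_mul (by split_ifs <;> positivity)]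
        split_ifs <;> simp
      rw [e, ← ofReal_norm]
      refine ENNReal.ofReal_le_ofReal ?_
      rw [norm_mul, norm_real, Real.norm_eq_abs, hφ x]
      refine (mul_le_mul_of_nonneg_left (norm_add_le _ _) (abs_nonneg _)).trans ?_
      rw [mul_add]
      refine add_le_add ?_ ?_
      · by_cases h : |x.1| < R
        · rw [i1 _ (inn _ h), i2 _ (inn _ h)]
          simp
          positivity
        · push Not at h
          have hn : R ≤ ‖x‖ := h.trans (norm_fst_le x)
          obtain ⟨p1, p2⟩ := hsm x hn
          have hx0 : x.1 ≠ 0 := by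
            intro h0; rw [h0] at h; simp at h; linarith
          have g1 : |G0 b x.1 x.2| ≤ 2 / R := (G0_Y hb hx0 _).trans (by gcongr)
          have f1 : ‖((r ^ 2 * deriv (deriv ζ) (r * x.1) * ζ (r * x.2) : ℝ) : ℂ) * P x
              + ((2 * r * deriv ζ (r * x.1) * ζ (r * x.2) : ℝ) : ℂ) * pd1 P x‖ ≤ 3 * c * δ * r := by
            refine (norm_add_le _ _).trans ?_
            rw [norm_mul, norm_mul, norm_real, norm_real, Real.norm_eq_abs, Real.norm_eq_abs, abs_mul, abs_mul, abs_mul, abs_mul, abs_mul,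
              abs_of_pos hrp, abs_of_pos (by positivity : 0 < r ^ 2), abs_two]
            have q1 := d1 (r * x.1)
            have q2 := d2 (r * x.1)
            have q3 := z1 (r * x.2)
            calc r ^ 2 * |deriv (deriv ζ) (r * x.1)| * |ζ (r * x.2)| * ‖P x‖ + 2 * r * |deriv ζ (r * x.1)| * |ζ (r * x.2)| * ‖pd1 P x‖
                ≤ (r * 1) * c * 1 * δ + 2 * r * c * 1 * δ := by
                  rw [sq]; gcongr
              _ = _ := by ring
          calc _ ≤ 2 / R * (3 * c * δ * r) := by gcongr
            _ = _ := by rw [hr]; field_simp; ring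
      · by_cases h : |x.2| < R
        · rw [i1 _ (inn _ h)]
          simp [not_le.2 h]
        · push Not at h
          rw [if_pos h]
          have hn : R ≤ ‖x‖ := h.trans (norm_snd_le x)
          obtain ⟨p1, p2⟩ := hsm x hn
          refine mul_le_mul_of_nonneg_left ?_ (abs_nonneg _)
          rw [norm_mul, norm_real, Real.norm_eq_abs, abs_mul, abs_mul, abs_of_pos hrp]
          have q1 := d1 (r * x.2)
          have q3 := z1 (r * x.1)
          calc r * |ζ (r * x.1)| * |deriv ζ (r * x.2)| * ‖P x‖ ≤ r * 1 * c * δ := by gcongr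
            _ = _ := by rw [hr]; field_simp
    · rw [Set.indicator_of_notMem hx, hφ]
      simp only [hS, Set.mem_prod, Set.mem_Icc, ← abs_le, not_and_or, not_le] at hx
      rcases hx with h | h
      · simp [z2 _ (out _ h), o1 _ (out _ h), o2 _ (out _ h)]
      · simp [z2 _ (out _ h), o1 _ (out _ h), o2 _ (out _ h)]
  have vS : volume S = ENNReal.ofReal (16 * R ^ 2) := by
    rw [hS, Measure.volume_eq_prod, Measure.prod_prod, Real.volume_Icc, ← ENNReal.ofReal_mul (by linarith)]
    congr 1; ring
  have n2 := G0_box hm hRp (fun t ht => hC R t hRp ht)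
  rw [lintegral_indicator mS, lintegral_add_left measurable_const, setLIntegral_const, vS, lintegral_mul_const'] at n1
  · have n3 : ‖P 0‖ₑ ≤ ENNReal.ofReal ((96 * c + 4 * C * c) * δ) := by
      refine n1.trans ((add_le_add le_rfl (mul_le_mul_left n2 _)).trans (le_of_eq ?_))
      rw [← ENNReal.ofReal_mul (by positivity), ← ENNReal.ofReal_mul (by positivity), ← ENNReal.ofReal_mul (by positivity),
        ← ENNReal.ofReal_add (by positivity) (by positivity)]
      congr 1
      field_simp
      ring
    rw [← ofReal_norm] at n3
    exact (ENNReal.ofReal_le_ofReal_iff (by positivity)).1 n3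
  · exact ENNReal.ofReal_ne_top

end Part20

section Part21

section
variable {k1 k2 l b : ℝ} {h : ℝ × ℝ → ℂ}

lemma Tt_bd (k1 k2 l : ℝ) (x : ℝ × ℝ) : ‖Tt k1 k2 l x‖ ≤ |k2| + |k1| := by
  unfold Tt
  refine (norm_add_le _ _).trans ?_
  rw [norm_mul, norm_mul, norm_real, norm_real, norm_real, norm_real, Real.norm_of_nonneg (qa_pos k1 k2 l x).le,
    Real.norm_of_nonneg (qb_pos k1 k2 l x).le]
  exact add_le_add (mul_le_of_le_one_right (norm_nonneg _) (qa_le k1 k2 l x)) (mul_le_of_le_one_right (norm_nonneg _) (qb_le k1 k2 l x))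

lemma D_zero (hb : 0 ≤ b) (hc : Continuous h) {B : ℝ} (hB : ∀ x, ‖h x‖ ≤ B) (hs : WSol b (uu k1 k2 l) h)
    (ht : Filter.Tendsto h (Filter.cocompact (ℝ × ℝ)) (nhds 0)) {ρ : ℝ × ℝ → ℂ} (hρ : Sm ρ) (cρ : HasCompactSupport ρ) :
    ∫ x, h x * (pd1 ρ x + Tt k1 k2 l x * ρ x) = 0 := by
  set g : ℝ × ℝ → ℂ := fun x => h x * Tt k1 k2 l x with hg
  have gc : Continuous g := hc.mul (Tt_sm k1 k2 l).continuous
  have B0 : 0 ≤ B := (norm_nonneg _).trans (hB 0)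
  have gB : ∀ x, ‖g x‖ ≤ B * (|k2| + |k1|) := fun x => by
    rw [hg]; simp only [norm_mul]
    exact mul_le_mul (hB x) (Tt_bd k1 k2 l x) (norm_nonneg _) B0
  have gt : Filter.Tendsto g (Filter.cocompact (ℝ × ℝ)) (nhds 0) := by
    have := ht.norm.mul_const (|k2| + |k1|)
    rw [norm_zero, zero_mul] at this
    refine squeeze_zero_norm (fun x => ?_) this
    rw [hg]; simp only [norm_mul]
    exact mul_le_mul_of_nonneg_left (Tt_bd k1 k2 l x) (norm_nonneg _)
  have c1 := hcs_pd1 hρ cρ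
  have c2 := hcs_pd2 hρ cρ
  have c11 := hcs_pd1 hρ.pd1 c1
  have s1 := Cv_sm hc hρ.pd1 c1
  have s2 := Cv_sm gc hρ cρ
  have sP : Sm (fun z => Cv h (pd1 ρ) z + Cv g ρ z) := s1.add s2
  have p1 : pd1 (fun z => Cv h (pd1 ρ) z + Cv g ρ z) = fun z => Cv h (pd1 (pd1 ρ)) z + Cv g (pd1 ρ) z := by
    rw [pd1_add s1 s2, Cv_pd1 hc hρ.pd1 c1, Cv_pd1 gc hρ cρ]
  have key := free_liouville hb sP ?_ ?_ ?_
  · have i1 := Cv_int hc hρ.pd1.continuous c1 0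
    have i2 := Cv_int gc hρ.continuous cρ 0
    unfold Cv at key
    rw [← integral_add i1 i2] at key
    rw [← key]
    refine integral_congr_ae (Filter.Eventually.of_forall fun x => ?_)
    simp only [hg, add_zero]; ring
  · intro z
    have q := hs _ ((hρ.pd1.add ((Tt_sm k1 k2 l).mul (sm_tr hρ (-0)))) |> fun _ =>
      ((sm_tr hρ z).pd1.add ((Tt_sm k1 k2 l).mul (sm_tr hρ z)))) ((hcs_pd1 (sm_tr hρ z) (cs_tr cρ z)).add (cs_tr cρ z).mul_left)
    unfold Hs
    rw [p1, pd1_add (Cv_sm hc hρ.pd1.pd1 c11) (Cv_sm gc hρ.pd1 c1), pd2_add s1 s2, Cv_pd1 hc hρ.pd1.pd1 c11,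
      Cv_pd1 gc hρ.pd1 c1, Cv_pd2 hc hρ.pd1 c1, Cv_pd2 gc hρ cρ]
    have c111 := hcs_pd1 hρ.pd1.pd1 c11
    have c21 := hcs_pd2 hρ.pd1 c1
    have i1 := Cv_int hc hρ.pd1.pd2.continuous c21 z
    have i2 := Cv_int gc hρ.pd2.continuous c2 z
    have i3 := Cv_int hc hρ.pd1.pd1.pd1.continuous c111 z
    have i4 := Cv_int gc hρ.pd1.pd1.continuous c11 z
    have i5 := Cv_int hc hρ.pd1.continuous c1 z
    have i6 := Cv_int gc hρ.continuous cρ z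
    have e : ∀ x, h x * Hs b (uu k1 k2 l) (fun x => pd1 (fun x => ρ (x + z)) x + Tt k1 k2 l x * ρ (x + z)) x =
        ((h x * pd2 (pd1 ρ) (x + z) + g x * pd2 ρ (x + z)) + (h x * pd1 (pd1 (pd1 ρ)) (x + z) + g x * pd1 (pd1 ρ) (x + z)))
        + ((b ^ 2 + 0 : ℝ) : ℂ) * (h x * pd1 ρ (x + z) + g x * ρ (x + z)) := fun x => by
      rw [darboux k1 k2 l b (sm_tr hρ z)]
      unfold Hs
      rw [pd1_tr, pd1_tr, pd1_tr, pd2_tr, pd2_tr]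
      simp only [hg]; ring
    have q' : ∫ x, h x * Hs b (uu k1 k2 l) (fun x => pd1 (fun x => ρ (x + z)) x + Tt k1 k2 l x * ρ (x + z)) x = 0 := q
    simp_rw [e] at q'
    have j1 : Integrable (fun x => h x * pd2 (pd1 ρ) (x + z) + g x * pd2 ρ (x + z)) := i1.add i2
    have j2 : Integrable (fun x => h x * pd1 (pd1 (pd1 ρ)) (x + z) + g x * pd1 (pd1 ρ) (x + z)) := i3.add i4
    have j3 : Integrable (fun x => h x * pd1 ρ (x + z) + g x * ρ (x + z)) := i5.add i6
    have j12 : Integrable (fun x => (h x * pd2 (pd1 ρ) (x + z) + g x * pd2 ρ (x + z)) + (h x * pd1 (pd1 (pd1 ρ)) (x + z) + g x * pd1 (pd1 ρ) (x + z))) := j1.add j2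
    rw [integral_add j12 (j3.const_mul _), integral_add j1 j2, integral_const_mul, integral_add i1 i2, integral_add i3 i4,
      integral_add i5 i6] at q'
    exact q'
  · have := (Cv_tendsto hc hB ht hρ.pd1.continuous c1).add (Cv_tendsto gc gB gt hρ.continuous cρ)
    simpa using this
  · rw [p1]
    have := (Cv_tendsto hc hB ht hρ.pd1.pd1.continuous c11).add (Cv_tendsto gc gB gt hρ.pd1.continuous c1)
    simpa using this

lemma Bs_pos (k1 k2 l b : ℝ) (x : ℝ × ℝ) : 0 < Bs k1 k2 l b x := mul_pos (qb_pos _ _ _ _) (Real.exp_pos _)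

lemma Bs_pd1 (k1 k2 l b : ℝ) : pd1 (fun x => (Bs k1 k2 l b x : ℂ)) = fun x => Tt k1 k2 l x * (Bs k1 k2 l b x : ℂ) := by
  ext x
  have h1 : HasDerivAt (fun y : ℝ => Real.exp (k1 * y + (k1 ^ 2 + b ^ 2) * x.2)) (k1 * Real.exp (k1 * x.1 + (k1 ^ 2 + b ^ 2) * x.2)) x.1 := by
    have := ((((hasDerivAt_id x.1).const_mul k1).add_const ((k1 ^ 2 + b ^ 2) * x.2))).exp
    exact this.congr_deriv (by simp; ring)
  have h2 := ((qb_d1 k1 k2 l x).mul h1).ofReal_comp.deriv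
  refine Eq.trans h2 ?_
  unfold Tt Bs
  have hq : (qb k1 k2 l x : ℂ) = 1 - qa k1 k2 l x := by
    rw [qb_fun]; push_cast; ring
  push_cast
  rw [hq]; ring

/-- weakly constant functions -/
lemma const_of_weak {k : ℝ × ℝ → ℂ} (hk : Continuous k)
    (h1 : ∀ ρ : ℝ × ℝ → ℂ, Sm ρ → HasCompactSupport ρ → ∫ x, k x * pd1 ρ x = 0)
    (h2 : ∀ ρ : ℝ × ℝ → ℂ, Sm ρ → HasCompactSupport ρ → ∫ x, k x * pd2 ρ x = 0) (z : ℝ × ℝ) : k z = k 0 := by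
  have cst : ∀ ρ : ℝ × ℝ → ℂ, Sm ρ → HasCompactSupport ρ → Cv k ρ (-z) = Cv k ρ 0 := by
    intro ρ hρ hc
    have s := Cv_sm hk hρ hc
    have f1 : ∀ w, fderiv ℝ (Cv k ρ) w (1, 0) = 0 := fun w => by
      have : pd1 (Cv k ρ) w = 0 := by
        rw [Cv_pd1 hk hρ hc]
        have := h1 _ (sm_tr hρ w) (cs_tr hc w)
        rw [pd1_tr] at this
        exact this
      rwa [pd1_eq_fderiv s] at this
    have f2 : ∀ w, fderiv ℝ (Cv k ρ) w (0, 1) = 0 := fun w => by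
      have : pd2 (Cv k ρ) w = 0 := by
        rw [Cv_pd2 hk hρ hc]
        have := h2 _ (sm_tr hρ w) (cs_tr hc w)
        rw [pd2_tr] at this
        exact this
      rwa [pd2_eq_fderiv s] at this
    refine is_const_of_fderiv_eq_zero (𝕜 := ℝ) s.diff (fun w => ?_) _ _
    ext v
    · simpa using f1 w
    · simpa using f2 w
  have hae : ∀ᵐ x : ℝ × ℝ, k (x + z) - k x = 0 := by
    refine ae_eq_zero_of_integral_contDiff_smul_eq_zero ?_ ?_
    · exact (by fun_prop : Continuous fun x => k (x + z) - k x).locallyIntegrable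
    · intro g hg hgc
      have sρ : Sm (fun x => (g x : ℂ)) := ofReal_sm hg
      have cρ : HasCompactSupport (fun x => (g x : ℂ)) := hgc.comp_left (g := fun r : ℝ => (r : ℂ)) rfl
      have := cst _ sρ cρ
      unfold Cv at this
      rw [← integral_add_right_eq_self (fun x => k x * (g (x + -z) : ℂ)) z] at this
      simp only [add_neg_cancel_right, add_zero] at this
      have i1 : Integrable (fun x => k (x + z) * (g x : ℂ)) := cs_int (by fun_prop) sρ.continuous cρ
      have i2 : Integrable (fun x => k x * (g x : ℂ)) := cs_int hk sρ.continuous cρ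
      rw [← sub_eq_zero, ← integral_sub i1 i2] at this
      rw [← this]
      refine integral_congr_ae (Filter.Eventually.of_forall fun x => ?_)
      simp only [Complex.real_smul]; ring
  have heq : (fun x => k (x + z) - k x) = fun _ => 0 :=
    Continuous.ae_eq_iff_eq volume (by fun_prop) continuous_const |>.1 hae
  have := congrFun heq 0
  simpa [sub_eq_zero] using this

lemma h_multiple (hb : 0 ≤ b) (hc : Continuous h) {B : ℝ} (hB : ∀ x, ‖h x‖ ≤ B) (hs : WSol b (uu k1 k2 l) h)
    (ht : Filter.Tendsto h (Filter.cocompact (ℝ × ℝ)) (nhds 0)) : ∃ D : ℂ, ∀ x, h x = D * (Bs k1 k2 l b x : ℂ) := by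
  obtain ⟨sE, solE⟩ := Bs_sol k1 k2 l b
  set E : ℝ × ℝ → ℂ := fun x => (Bs k1 k2 l b x : ℂ) with hE
  have Ene : ∀ x, E x ≠ 0 := fun x => by simpa [hE] using (Bs_pos k1 k2 l b x).ne'
  have sI : Sm (fun x => (E x)⁻¹) := sE.inv Ene
  set k : ℝ × ℝ → ℂ := fun x => h x * (E x)⁻¹ with hk
  have kc : Continuous k := hc.mul sI.continuous
  have w1 : ∀ ρ : ℝ × ℝ → ℂ, Sm ρ → HasCompactSupport ρ → ∫ x, k x * pd1 ρ x = 0 := by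
    intro ρ hρ cρ
    have sψ : Sm (fun x => (E x)⁻¹ * ρ x) := sI.mul hρ
    have cψ : HasCompactSupport (fun x => (E x)⁻¹ * ρ x) := cρ.mul_left
    rw [← D_zero hb hc hB hs ht sψ cψ]
    refine integral_congr_ae (Filter.Eventually.of_forall fun x => ?_)
    have e1 : pd1 ρ = fun x => pd1 E x * ((E x)⁻¹ * ρ x) + E x * pd1 (fun x => (E x)⁻¹ * ρ x) x := by
      rw [← pd1_mul sE sψ]
      congr 1; ext x; rw [mul_inv_cancel_left₀ (Ene x)]
    have e2 : pd1 E x = Tt k1 k2 l x * E x := congrFun (Bs_pd1 k1 k2 l b) x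
    simp only [hk]
    rw [e1]
    simp only
    rw [e2]
    have := Ene x
    field_simp
    ring
  have w2 : ∀ ρ : ℝ × ℝ → ℂ, Sm ρ → HasCompactSupport ρ → ∫ x, k x * pd2 ρ x = 0 := by
    intro ρ hρ cρ
    have sψ : Sm (fun x => (E x)⁻¹ * ρ x) := sI.mul hρ
    have cψ : HasCompactSupport (fun x => (E x)⁻¹ * ρ x) := cρ.mul_left
    have q := hs _ sψ cψ
    have sχ : Sm (fun x => E x * pd1 (fun x => (E x)⁻¹ * ρ x) x - pd1 E x * ((E x)⁻¹ * ρ x)) := (sE.mul sψ.pd1).sub (sE.pd1.mul sψ)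
    have cχ : HasCompactSupport (fun x => E x * pd1 (fun x => (E x)⁻¹ * ρ x) x - pd1 E x * ((E x)⁻¹ * ρ x)) :=
      (hcs_pd1 sψ cψ).mul_left.sub cψ.mul_left
    have e : ∀ x, h x * Hs b (uu k1 k2 l) (fun x => (E x)⁻¹ * ρ x) x = k x * pd2 ρ x
        + k x * pd1 (fun x => E x * pd1 (fun x => (E x)⁻¹ * ρ x) x - pd1 E x * ((E x)⁻¹ * ρ x)) x := fun x => by
      have d := Hs_divergence sE sψ solE x
      have e1 : (fun x => E x * ((E x)⁻¹ * ρ x)) = ρ := by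
        ext x; rw [mul_inv_cancel_left₀ (Ene x)]
      rw [e1] at d
      rw [← mul_add, ← d]
      simp only [hk]
      rw [mul_assoc, inv_mul_cancel_left₀ (Ene x)]
    simp_rw [e] at q
    rw [integral_add (cs_int kc hρ.pd2.continuous (hcs_pd2 hρ cρ)) (cs_int kc sχ.pd1.continuous (hcs_pd1 sχ cχ)), w1 _ sχ cχ, add_zero] at q
    exact q
  refine ⟨k 0, fun x => ?_⟩
  rw [← const_of_weak kc w1 w2 x]
  simp only [hk]
  rw [inv_mul_cancel_right₀ (Ene x)]
end

end Part21

section Part22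

lemma curve_cocompact {γ : ℝ → ℝ × ℝ} (h : ∀ s, s ≤ ‖γ s‖) : Filter.Tendsto γ Filter.atTop (Filter.cocompact (ℝ × ℝ)) := by
  rw [← Metric.cobounded_eq_cocompact, ← comap_norm_atTop, Filter.tendsto_comap_iff]
  exact Filter.tendsto_atTop_mono h Filter.tendsto_id

lemma qb_half {k1 k2 l : ℝ} {x : ℝ × ℝ} (h : 0 ≤ sgm k1 k2 l x) : 1 / 2 ≤ qb k1 k2 l x := by
  have e := qb_eq k1 k2 l x
  have a := q_add k1 k2 l x
  have p := qa_pos k1 k2 l x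
  have := Real.one_le_exp h
  nlinarith
lemma qa_half {k1 k2 l : ℝ} {x : ℝ × ℝ} (h : sgm k1 k2 l x ≤ 0) : 1 / 2 ≤ qa k1 k2 l x := by
  have e := qb_eq k1 k2 l x
  have a := q_add k1 k2 l x
  have p := qa_pos k1 k2 l x
  have := Real.exp_le_one_iff.2 h
  nlinarith

lemma Bs_curve {k1 k2 : ℝ} (h : k1 < k2) (l b : ℝ) : ∃ (c : ℝ) (γ : ℝ → ℝ × ℝ), 0 < c ∧
    Filter.Tendsto γ Filter.atTop (Filter.cocompact (ℝ × ℝ)) ∧ ∀ᶠ s in Filter.atTop, c ≤ Bs k1 k2 l b (γ s) := by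
  have hd : 0 < k2 - k1 := by linarith
  by_cases h1 : 0 ≤ k1
  · refine ⟨1 / 2, fun s => (s, 0), by norm_num, curve_cocompact fun s => ?_, ?_⟩
    · exact (le_abs_self s).trans (norm_fst_le (s, (0:ℝ)))
    · filter_upwards [Filter.eventually_ge_atTop 0, Filter.eventually_ge_atTop (-l / (k2 - k1))] with s hs hs2
      rw [div_le_iff₀ hd] at hs2
      have : 1 / 2 ≤ qb k1 k2 l (s, 0) := qb_half (by simp [sgm]; linarith)
      unfold Bs
      have e : 1 ≤ Real.exp (k1 * (s, (0:ℝ)).1 + (k1 ^ 2 + b ^ 2) * (s, (0:ℝ)).2) := Real.one_le_exp (by simp; positivity)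
      nlinarith
  · push Not at h1
    by_cases h2 : k2 ≤ 0
    · refine ⟨Real.exp l / 2, fun s => (-s, 0), by positivity, curve_cocompact fun s => ?_, ?_⟩
      · exact (neg_le_abs (-s)).trans' (by simp) |>.trans (norm_fst_le (-s, (0:ℝ)))
      · filter_upwards [Filter.eventually_ge_atTop 0, Filter.eventually_ge_atTop (l / (k2 - k1))] with s hs hs2
        rw [div_le_iff₀ hd] at hs2
        have : 1 / 2 ≤ qa k1 k2 l (-s, 0) := qa_half (by simp [sgm]; linarith)
        unfold Bs
        rw [qb_eq]
        have e : Real.exp (sgm k1 k2 l (-s, 0)) * Real.exp (k1 * (-s, (0:ℝ)).1 + (k1 ^ 2 + b ^ 2) * (-s, (0:ℝ)).2)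
            = Real.exp l * Real.exp (-k2 * s) := by
          rw [← Real.exp_add, ← Real.exp_add]; congr 1; simp [sgm]; ring
        have e2 : 1 ≤ Real.exp (-k2 * s) := Real.one_le_exp (by nlinarith)
        have e3 := Real.exp_pos l
        rw [mul_right_comm, e]
        have := mul_le_mul_of_nonneg_left e2 e3.le
        nlinarith
    · push Not at h2
      refine ⟨1 / 2 * Real.exp (-k1 * l / (k2 - k1)), fun s => (-(k1 + k2) * s - l / (k2 - k1), s), by positivity, curve_cocompact fun s => ?_, ?_⟩
      · exact (le_abs_self s).trans (norm_snd_le (-(k1 + k2) * s - l / (k2 - k1), s))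
      · filter_upwards [Filter.eventually_ge_atTop 0] with s hs
        have : 1 / 2 ≤ qb k1 k2 l (-(k1 + k2) * s - l / (k2 - k1), s) := qb_half (by
          simp only [sgm]; apply le_of_eq; field_simp; ring)
        unfold Bs
        refine mul_le_mul this (Real.exp_le_exp.2 ?_) (Real.exp_pos _).le (by linarith)
        have e : k1 * (-(k1 + k2) * s - l / (k2 - k1)) + (k1 ^ 2 + b ^ 2) * s = -k1 * l / (k2 - k1) + (-k1 * k2 + b ^ 2) * s := by
          field_simp; ring
        simp only
        rw [e]
        have : 0 ≤ (-k1 * k2 + b ^ 2) * s := mul_nonneg (by nlinarith [sq_nonneg b]) hs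
        linarith

theorem liouville {k1 k2 l b : ℝ} (hk : k1 < k2) (hb : 0 ≤ b) (h : ℝ × ℝ → ℂ) (hc : Continuous h)
    (hB : ∃ B : ℝ, ∀ x, ‖h x‖ ≤ B) (hs : WSol b (uu k1 k2 l) h)
    (ht : Filter.Tendsto h (Filter.cocompact (ℝ × ℝ)) (nhds 0)) : ∀ x, h x = 0 := by
  obtain ⟨B, hB⟩ := hB
  obtain ⟨D, hD⟩ := h_multiple hb hc hB hs ht
  obtain ⟨c, γ, c0, hγ, hge⟩ := Bs_curve hk l b
  have h1 := (ht.comp hγ).norm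
  have h2 : ‖D‖ * c ≤ 0 := by
    rw [norm_zero] at h1
    refine ge_of_tendsto h1 ?_
    filter_upwards [hge] with s hs
    simp only [Function.comp, hD, norm_mul, norm_real]
    rw [Real.norm_of_nonneg (Bs_pos _ _ _ _ _).le]
    gcongr
  have h3 : ‖D‖ = 0 := le_antisymm (by by_contra hh; push Not at hh; nlinarith) (norm_nonneg _)
  intro x
  rw [hD, norm_eq_zero.1 h3, zero_mul]

end Part22

section Part23

/-! ### Smallness of the perturbation -/

lemma hr_pow (t : ℝ) : hr (-(8/9)) t ^ (3/4 : ℝ) = hr (-(2/3)) t := by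
  unfold hr
  by_cases ht : t ∈ Set.Ioo (-1:ℝ) 1
  · rw [Set.indicator_of_mem ht, Set.indicator_of_mem ht, ← Real.rpow_mul (abs_nonneg t)]
    norm_num
  · rw [Set.indicator_of_notMem ht, Set.indicator_of_notMem ht]
    norm_num

lemma young_w {w : ℝ} (hw : 0 < w) (t : ℝ) :
    w⁻¹ * hr (-(2/3)) t ≤ 1 / 4 + 3 / 4 * (w ^ (-(4/3) : ℝ) * hr (-(8/9)) t) := by
  have h := Real.geom_mean_le_arith_mean2_weighted (w₁ := 1/4) (w₂ := 3/4) (p₁ := 1)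
    (p₂ := w ^ (-(4/3) : ℝ) * hr (-(8/9)) t) (by norm_num) (by norm_num) (by norm_num)
    (mul_nonneg (Real.rpow_nonneg hw.le _) (hr_nn _ _)) (by norm_num)
  rw [Real.one_rpow, one_mul, Real.mul_rpow (Real.rpow_nonneg hw.le _) (hr_nn _ _), hr_pow,
    ← Real.rpow_mul hw.le] at h
  have e : (-(4/3) * (3/4) : ℝ) = -1 := by norm_num
  rw [e, Real.rpow_neg_one] at h
  linarith

def CC : ℝ := 9 / 4 + 3 / 4 * ((∫ y : ℝ, (1 + ‖y‖) ^ (-(4/3) : ℝ)) * ∫ s, hr (-(8/9)) s)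

lemma CC_pos : 0 < CC := by
  unfold CC
  have h1 : 0 ≤ ∫ y : ℝ, (1 + ‖y‖) ^ (-(4/3) : ℝ) := integral_nonneg fun y => by positivity
  have h2 : 0 ≤ ∫ s, hr (-(8/9)) s := integral_nonneg fun s => hr_nn _ _
  have := mul_nonneg h1 h2
  linarith

lemma vsm_of {v : ℝ × ℝ → ℝ} (hv : Continuous v) {ε : ℝ} (hε : 0 ≤ ε) (h : wL1Linf v ≤ ENNReal.ofReal ε) :
    VSm v (CC * ε) := by
  unfold wL1Linf at h
  set f : ℝ × ℝ → ℝ := fun x => (1 + |x.1| + |x.2|) * v x with hf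
  have hfc : Continuous f := by fun_prop
  have h1 : eLpNorm f 1 volume ≤ ENNReal.ofReal ε := le_self_add.trans h
  have h2 : eLpNorm f ⊤ volume ≤ ENNReal.ofReal ε := le_add_self.trans h
  have fi : Integrable f := memLp_one_iff_integrable.1 ⟨hfc.aestronglyMeasurable, h1.trans_lt ENNReal.ofReal_lt_top⟩
  have fI : ∫ x, |f x| ≤ ε := by
    have := integral_norm_eq_lintegral_enorm hfc.aestronglyMeasurable (μ := volume)
    simp only [Real.norm_eq_abs] at this
    rw [this, ← eLpNorm_one_eq_lintegral_enorm]
    exact ENNReal.toReal_le_of_le_ofReal hε h1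
  have fa : ∀ᵐ x, |f x| ≤ ε := by
    rw [eLpNorm_exponent_top] at h2
    filter_upwards [ae_le_eLpNormEssSup (f := f) (μ := volume)] with x hx
    have := hx.trans h2
    rw [← ofReal_norm, ENNReal.ofReal_le_ofReal_iff hε] at this
    exact this
  have g1 : Integrable (fun y : ℝ => (1 + ‖y‖) ^ (-(4/3) : ℝ)) := integrable_one_add_norm (by norm_num)
  have gi : ∀ t : ℝ, Integrable (fun x : ℝ × ℝ => (1 + ‖x.1‖) ^ (-(4/3) : ℝ) * hr (-(8/9)) (t - x.2)) := fun t =>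
    g1.mul_prod ((hr_int (r := -(8/9)) (by norm_num) (by norm_num)).comp_sub_left t)
  have gI : ∀ t : ℝ, ∫ x : ℝ × ℝ, (1 + ‖x.1‖) ^ (-(4/3) : ℝ) * hr (-(8/9)) (t - x.2)
      = (∫ y : ℝ, (1 + ‖y‖) ^ (-(4/3) : ℝ)) * ∫ s, hr (-(8/9)) s := fun t => by
    rw [Measure.volume_eq_prod, integral_prod_mul (fun y : ℝ => (1 + ‖y‖) ^ (-(4/3) : ℝ)) (fun s => hr (-(8/9)) (t - s)),
      integral_sub_left_eq_self (fun s => hr (-(8/9)) s)]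
  have ri : ∀ t : ℝ, Integrable (fun x : ℝ × ℝ => 9 / 4 * |f x| + 3 / 4 * ε * ((1 + ‖x.1‖) ^ (-(4/3) : ℝ) * hr (-(8/9)) (t - x.2))) :=
    fun t => (fi.abs.const_mul _).add ((gi t).const_mul _)
  have nn : ∀ t, ∀ x : ℝ × ℝ, 0 ≤ wt (t - x.2) * |v x| := fun t x =>
    mul_nonneg (by have := wt_one (t - x.2); linarith) (abs_nonneg _)
  have le : ∀ t : ℝ, ∀ᵐ x : ℝ × ℝ, wt (t - x.2) * |v x|
      ≤ 9 / 4 * |f x| + 3 / 4 * ε * ((1 + ‖x.1‖) ^ (-(4/3) : ℝ) * hr (-(8/9)) (t - x.2)) := fun t => by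
    filter_upwards [fa] with x hx
    set w := 1 + |x.1| + |x.2| with hw
    have p1 := abs_nonneg x.1
    have p2 := abs_nonneg x.2
    have w1 : 1 ≤ w := by linarith
    have w0 : 0 < w := by linarith
    have ef : |f x| = w * |v x| := by simp only [hf, abs_mul]; rw [abs_of_pos w0]
    have ev : |v x| = |f x| * w⁻¹ := by rw [ef]; field_simp
    have y := young_w w0 (t - x.2)
    have hp : w ^ (-(4/3) : ℝ) ≤ (1 + ‖x.1‖) ^ (-(4/3) : ℝ) :=
      Real.rpow_le_rpow_of_nonpos (by positivity) (by rw [Real.norm_eq_abs]; linarith) (by norm_num)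
    have hp0 : 0 ≤ w ^ (-(4/3) : ℝ) := Real.rpow_nonneg w0.le _
    have hH := hr_nn (-(8/9)) (t - x.2)
    have vf : |v x| ≤ |f x| := by rw [ef]; exact le_mul_of_one_le_left (abs_nonneg _) w1
    calc wt (t - x.2) * |v x| ≤ (2 + hr (-(2/3)) (t - x.2)) * |v x| :=
          mul_le_mul_of_nonneg_right (wt_le _) (abs_nonneg _)
      _ = 2 * |v x| + |f x| * (w⁻¹ * hr (-(2/3)) (t - x.2)) := by
          rw [← mul_assoc, ← ev]; ring
      _ ≤ 2 * |f x| + |f x| * (1 / 4 + 3 / 4 * (w ^ (-(4/3) : ℝ) * hr (-(8/9)) (t - x.2))) := by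
          have := mul_le_mul_of_nonneg_left y (abs_nonneg (f x))
          linarith
      _ = 9 / 4 * |f x| + 3 / 4 * (|f x| * (w ^ (-(4/3) : ℝ) * hr (-(8/9)) (t - x.2))) := by ring
      _ ≤ 9 / 4 * |f x| + 3 / 4 * (ε * ((1 + ‖x.1‖) ^ (-(4/3) : ℝ) * hr (-(8/9)) (t - x.2))) := by
          have := mul_le_mul hx (mul_le_mul_of_nonneg_right hp hH) (mul_nonneg hp0 hH) hε
          linarith
      _ = _ := by ring
  refine ⟨hv, fun t => (ri t).mono' ?_ ?_, fun t => ?_⟩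
  · exact (wt_meas.comp (by fun_prop)).aestronglyMeasurable.mul hv.abs.aestronglyMeasurable
  · filter_upwards [le t] with x hx
    rwa [Real.norm_of_nonneg (nn t x)]
  · refine (integral_mono_of_nonneg (Filter.Eventually.of_forall (nn t)) (ri t) (le t)).trans ?_
    rw [integral_add (fi.abs.const_mul _) ((gi t).const_mul _), integral_const_mul, integral_const_mul, gI]
    unfold CC
    nlinarith [fI]

/-- shear -/
def shr (α : ℝ) (x : ℝ × ℝ) : ℝ × ℝ := (x.1 + 2 * α * x.2, x.2)

lemma shr_inv (α : ℝ) (x : ℝ × ℝ) : shr α (shr (-α) x) = x := by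
  unfold shr; ext <;> simp
lemma shr_inv' (α : ℝ) (x : ℝ × ℝ) : shr (-α) (shr α x) = x := by
  unfold shr; ext <;> simp

lemma shr_cont (α : ℝ) : Continuous (shr α) := by unfold shr; fun_prop
lemma shr_sm (α : ℝ) : ContDiff ℝ (⊤:ℕ∞) (shr α) := by unfold shr; fun_prop

def shrH (α : ℝ) : (ℝ × ℝ) ≃ₜ (ℝ × ℝ) where
  toFun := shr α
  invFun := shr (-α)
  left_inv := shr_inv' α
  right_inv := shr_inv α
  continuous_toFun := shr_cont α
  continuous_invFun := shr_cont (-α)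

lemma shr_mp (α : ℝ) : MeasurePreserving (shr α) volume volume := by
  have h : MeasurePreserving (fun p : ℝ × ℝ => (p.1, p.2 + 2 * α * p.1)) (volume.prod volume) (volume.prod volume) :=
    (MeasurePreserving.id volume).skew_product (g := fun s y => y + 2 * α * s) (by fun_prop)
      (Filter.Eventually.of_forall fun s => (measurePreserving_add_right volume (2 * α * s)).map_eq)
  have := (Measure.measurePreserving_swap (μ := (volume : Measure ℝ)) (ν := (volume : Measure ℝ))).comp (h.comp Measure.measurePreserving_swap)
  exact this

lemma shr_me (α : ℝ) : MeasurableEmbedding (shr α) := (shrH α).measurableEmbedding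

lemma VSm.shear {v : ℝ × ℝ → ℝ} {δ : ℝ} (hv : VSm v δ) (α : ℝ) : VSm (fun x => v (shr α x)) δ := by
  refine ⟨hv.cont.comp (shr_cont α), fun t => ?_, fun t => ?_⟩
  · exact ((shr_mp α).integrable_comp_emb (shr_me α) (g := fun x' : ℝ × ℝ => wt (t - x'.2) * |v x'|)).2 (hv.int t)
  · refine le_trans (le_of_eq ?_) (hv.le t)
    exact (shr_mp α).integral_comp (shr_me α) (fun x' : ℝ × ℝ => wt (t - x'.2) * |v x'|)

end Part23

section Part24

/-! ### Reduction to the normalized problem: gauge and shear -/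

def ee (β : ℝ) (x : ℝ × ℝ) : ℂ := Complex.exp (I * β * x.1)

lemma ee_sm (β : ℝ) : Sm (ee β) := (cexp_cd (I * β)).comp contDiff_fst
lemma ee_norm (β : ℝ) (x : ℝ × ℝ) : ‖ee β x‖ = 1 := by
  unfold ee; rw [Complex.norm_exp]; simp
lemma ee_inv (β : ℝ) (x : ℝ × ℝ) : ee (-β) x * ee β x = 1 := by
  unfold ee; rw [← Complex.exp_add]; simp
lemma ee_pd1 (β : ℝ) : pd1 (ee β) = fun x => I * β * ee β x := by
  ext x; exact (cexpd (I * β) x.1).deriv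
lemma ee_pd2 (β : ℝ) : pd2 (ee β) = fun _ => 0 := by
  ext x; simp [pd2, ee]

lemma pd1_shr (f : ℝ × ℝ → ℂ) (α : ℝ) : pd1 (fun x => f (shr α x)) = fun x => pd1 f (shr α x) := by
  ext x
  unfold pd1 shr
  exact deriv_comp_add_const (f := fun t => f (t, x.2)) (a := 2 * α * x.2) (x := x.1)

lemma pd2_shr {f : ℝ × ℝ → ℂ} (hf : Sm f) (α : ℝ) :
    pd2 (fun x => f (shr α x)) = fun x => pd2 f (shr α x) + 2 * α * pd1 f (shr α x) := by
  ext x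
  have h1 : HasFDerivAt f (fderiv ℝ f (shr α x)) (shr α (x.1, x.2)) := (hf.diff _).hasFDerivAt
  have h2 : HasDerivAt (fun t : ℝ => shr α (x.1, t)) (2 * α, 1) x.2 := by
    unfold shr
    exact ((((hasDerivAt_id x.2).const_mul (2 * α)).const_add x.1).congr_deriv (by ring)).prodMk (hasDerivAt_id x.2)
  have h3 := (HasFDerivAt.comp_hasDerivAt (f := fun t : ℝ => shr α (x.1, t)) x.2 h1 h2).deriv
  rw [pd1_eq_fderiv hf, pd2_eq_fderiv hf]
  have e : ((2 * α, 1) : ℝ × ℝ) = (0, 1) + (2 * α) • (1, 0) := by ext <;> simp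
  rw [e, map_add, map_smul] at h3
  refine h3.trans ?_
  simp [Complex.real_smul]

lemma Lop_eq {ψ : ℝ × ℝ → ℂ} (hψ : Sm ψ) (lam : ℂ) (u : ℝ × ℝ → ℝ) (x : ℝ × ℝ) :
    (pd2 (fun x => ee lam.im (shr lam.re x) * ψ (shr lam.re x)) x
      + pd1 (pd1 (fun x => ee lam.im (shr lam.re x) * ψ (shr lam.re x))) x
      - 2 * lam * pd1 (fun x => ee lam.im (shr lam.re x) * ψ (shr lam.re x)) x
      + (u x : ℂ) * (ee lam.im (shr lam.re x) * ψ (shr lam.re x)))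
    = ee lam.im (shr lam.re x) * Hs |lam.im| (fun y => u (shr (-lam.re) y)) ψ (shr lam.re x) := by
  have he := ee_sm lam.im
  have hm : Sm (fun y => ee lam.im y * ψ y) := he.mul hψ
  have d1 : pd1 (fun y => ee lam.im y * ψ y) = fun y => ee lam.im y * (I * lam.im * ψ y + pd1 ψ y) := by
    rw [pd1_mul he hψ, ee_pd1]; ext y; ring
  have hc : Sm (fun _ : ℝ × ℝ => I * (lam.im : ℂ)) := contDiff_const
  have d11 : pd1 (pd1 (fun y => ee lam.im y * ψ y)) = fun y => ee lam.im y *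
      (-(lam.im : ℂ) ^ 2 * ψ y + 2 * I * lam.im * pd1 ψ y + pd1 (pd1 ψ) y) := by
    rw [d1, pd1_mul he ((hc.mul hψ).add hψ.pd1), pd1_add (hc.mul hψ) hψ.pd1, pd1_mul hc hψ, ee_pd1, pd1_const]
    ext y
    linear_combination (ee lam.im y * lam.im ^ 2 * ψ y) * I_sq
  have d2 : pd2 (fun y => ee lam.im y * ψ y) = fun y => ee lam.im y * pd2 ψ y := by
    rw [pd2_mul he hψ, ee_pd2]; ext y; ring
  rw [pd2_shr hm lam.re, pd1_shr (fun y => ee lam.im y * ψ y) lam.re, pd1_shr (pd1 (fun y => ee lam.im y * ψ y)) lam.re, d11, d1, d2]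
  simp only [Hs, shr_inv', sq_abs]
  have hl : lam = lam.re + lam.im * I := (re_add_im lam).symm
  generalize ee lam.im (shr lam.re x) = e
  generalize ψ (shr lam.re x) = p
  generalize pd1 ψ (shr lam.re x) = p1
  generalize pd1 (pd1 ψ) (shr lam.re x) = p11
  generalize pd2 ψ (shr lam.re x) = p2
  push_cast
  linear_combination (-2 * e * (I * lam.im * p + p1)) * hl - 2 * e * lam.im ^ 2 * p * I_sq

/-- the gauge-transformed function -/
def gau (lam : ℂ) (m : ℝ × ℝ → ℂ) (y : ℝ × ℝ) : ℂ := ee lam.im y * m (shr (-lam.re) y)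

lemma gau_wsol {u : ℝ × ℝ → ℝ} {lam : ℂ} {m : ℝ × ℝ → ℂ} :
    IsDistribLaxSol u lam m ↔ WSol |lam.im| (fun y => u (shr (-lam.re) y)) (gau lam m) := by
  have key : ∀ ψ : ℝ × ℝ → ℂ, Sm ψ →
      ∫ x, m x * (pd2 (fun x => ee lam.im (shr lam.re x) * ψ (shr lam.re x)) x
      + pd1 (pd1 (fun x => ee lam.im (shr lam.re x) * ψ (shr lam.re x))) x
      - 2 * lam * pd1 (fun x => ee lam.im (shr lam.re x) * ψ (shr lam.re x)) x
      + (u x : ℂ) * (ee lam.im (shr lam.re x) * ψ (shr lam.re x)))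
      = ∫ y, gau lam m y * Hs |lam.im| (fun y => u (shr (-lam.re) y)) ψ y := fun ψ hψ => by
    rw [← (shr_mp lam.re).integral_comp (shr_me lam.re) (fun y => gau lam m y * Hs |lam.im| (fun y => u (shr (-lam.re) y)) ψ y)]
    refine integral_congr_ae (Filter.Eventually.of_forall fun x => ?_)
    simp only
    rw [Lop_eq hψ lam u x]
    simp only [gau, shr_inv']
    ring
  constructor
  · intro h ψ hψ hc
    rw [← key ψ hψ]
    have c1 : HasCompactSupport (fun y => ee lam.im y * ψ y) := HasCompactSupport.mul_left (f := ee lam.im) hc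
    have s1 : Sm (fun y => ee lam.im y * ψ y) := (ee_sm _).mul hψ
    exact h (fun x => ee lam.im (shr lam.re x) * ψ (shr lam.re x)) (s1.comp (shr_sm _)) (c1.comp_homeomorph (shrH lam.re))
  · intro h φ hφ hc
    have hψ : Sm (fun y => ee (-lam.im) y * φ (shr (-lam.re) y)) := (ee_sm _).mul (hφ.comp (shr_sm _))
    have hψc : HasCompactSupport (fun y => ee (-lam.im) y * φ (shr (-lam.re) y)) :=
      HasCompactSupport.mul_left (f := ee (-lam.im)) (f' := fun y => φ (shr (-lam.re) y))
        (hc.comp_homeomorph (shrH (-lam.re)))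
    have := h _ hψ hψc
    rw [← key _ hψ] at this
    have e : (fun x => ee lam.im (shr lam.re x) * (ee (-lam.im) (shr lam.re x) * φ (shr (-lam.re) (shr lam.re x)))) = φ := by
      ext x
      rw [shr_inv', ← mul_assoc, mul_comm (ee lam.im _), ee_inv, one_mul]
    rw [e] at this
    refine (integral_congr_ae (Filter.Eventually.of_forall fun x => ?_)).trans this
    rw [congrFun e x]

lemma sgm_shr (κ₁ κ₂ l α : ℝ) (y : ℝ × ℝ) : sgm κ₁ κ₂ l (shr (-α) y) = sgm (κ₁ - α) (κ₂ - α) l y := by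
  unfold sgm shr; ring
lemma qa_shr (κ₁ κ₂ l α : ℝ) (y : ℝ × ℝ) : qa κ₁ κ₂ l (shr (-α) y) = qa (κ₁ - α) (κ₂ - α) l y := by
  unfold qa; rw [sgm_shr]
lemma qb_shr (κ₁ κ₂ l α : ℝ) (y : ℝ × ℝ) : qb κ₁ κ₂ l (shr (-α) y) = qb (κ₁ - α) (κ₂ - α) l y := by
  unfold qb; rw [sgm_shr]

lemma exp_th {κ₁ κ₂ a : ℝ} (ha : 0 < a) (x : ℝ × ℝ) :
    a * Real.exp (theta κ₂ x) = Real.exp (theta κ₁ x) * Real.exp (sgm κ₁ κ₂ (Real.log a) x) := by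
  rw [← Real.exp_add]
  conv_lhs => rw [← Real.exp_log ha, ← Real.exp_add]
  congr 1; unfold theta sgm; ring

lemma tau_eq {κ₁ κ₂ a : ℝ} (ha : 0 < a) (x : ℝ × ℝ) :
    tau κ₁ κ₂ a x = Real.exp (theta κ₁ x) * (1 + Real.exp (sgm κ₁ κ₂ (Real.log a) x)) := by
  unfold tau; rw [exp_th (κ₁ := κ₁) ha]; ring

lemma us_eq {κ₁ κ₂ a : ℝ} (ha : 0 < a) (x : ℝ × ℝ) : us κ₁ κ₂ a x = uu κ₁ κ₂ (Real.log a) x := by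
  set l := Real.log a
  have e : (fun y => Real.log (tau κ₁ κ₂ a y)) = fun y => theta κ₁ y + Real.log (1 + Real.exp (sgm κ₁ κ₂ l y)) := by
    ext y
    rw [tau_eq ha, Real.log_mul (Real.exp_pos _).ne' (opos κ₁ κ₂ l y).ne', Real.log_exp]
  have d1 : pd1 (fun y => Real.log (tau κ₁ κ₂ a y)) = fun y => κ₁ + (κ₂ - κ₁) * qb κ₁ κ₂ l y := by
    rw [e]
    ext y
    have hs : HasDerivAt (fun t => sgm κ₁ κ₂ l (t, y.2)) (κ₂ - κ₁) y.1 :=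
      ((((hasDerivAt_id y.1).const_mul (κ₂ - κ₁)).add_const ((κ₂ ^ 2 - κ₁ ^ 2) * y.2)).add_const l).congr_deriv (by ring)
    have ht : HasDerivAt (fun t => theta κ₁ (t, y.2)) κ₁ y.1 :=
      (((hasDerivAt_id y.1).const_mul κ₁).add_const (κ₁ ^ 2 * y.2)).congr_deriv (by ring)
    have hl := (hs.exp.const_add 1).log (opos κ₁ κ₂ l y).ne'
    refine (ht.add hl).deriv.trans ?_
    unfold qb
    simp only [Prod.mk.eta]
    ring
  unfold us
  rw [d1]
  have : pd1 (fun y => κ₁ + (κ₂ - κ₁) * qb κ₁ κ₂ l y) x = (κ₂ - κ₁) * ((κ₂ - κ₁) * (qa κ₁ κ₂ l x * qb κ₁ κ₂ l x)) :=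
    (((qb_d1 κ₁ κ₂ l x).const_mul (κ₂ - κ₁)).const_add κ₁).deriv
  rw [this]
  unfold uu; ring

lemma gau_us {κ₁ κ₂ a : ℝ} (ha : 0 < a) (α : ℝ) (y : ℝ × ℝ) :
    us κ₁ κ₂ a (shr (-α) y) = uu (κ₁ - α) (κ₂ - α) (Real.log a) y := by
  rw [us_eq ha]; unfold uu; rw [qa_shr, qb_shr]; ring

lemma chi_eq {κ₁ κ₂ a : ℝ} (ha : 0 < a) (x : ℝ × ℝ) {lam : ℂ} (hl : lam ≠ 0) : chi κ₁ κ₂ a x lam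
    = ((lam - κ₁) * qa κ₁ κ₂ (Real.log a) x + (lam - κ₂) * qb κ₁ κ₂ (Real.log a) x) / lam := by
  unfold chi
  rw [mul_assoc, ← ofReal_mul, exp_th (κ₁ := κ₁) ha, tau_eq ha]
  unfold qa qb
  have h1 : ((1 + Real.exp (sgm κ₁ κ₂ (Real.log a) x) : ℝ) : ℂ) ≠ 0 := ofReal_ne_zero.2 (opos _ _ _ x).ne'
  have h2 : ((Real.exp (theta κ₁ x) : ℝ) : ℂ) ≠ 0 := ofReal_ne_zero.2 (Real.exp_pos _).ne'
  simp only [ofReal_mul, ofReal_inv]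
  generalize ((1 + Real.exp (sgm κ₁ κ₂ (Real.log a) x) : ℝ) : ℂ) = A at *
  generalize ((Real.exp (theta κ₁ x) : ℝ) : ℂ) = B at *
  field_simp

lemma gau_chi {κ₁ κ₂ a : ℝ} (ha : 0 < a) {lam : ℂ} (hl : lam ≠ 0) (y : ℝ × ℝ) :
    gau lam (fun x => chi κ₁ κ₂ a x lam) y = ch0 (κ₁ - lam.re) (κ₂ - lam.re) (Real.log a) lam.im lam y := by
  unfold gau ch0 ee
  simp only
  rw [chi_eq ha _ hl, qa_shr, qb_shr]
  have h : ∀ κ : ℝ, lam - κ = I * lam.im - ((κ - lam.re : ℝ) : ℂ) := fun κ => by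
    conv_lhs => rw [← re_add_im lam]
    push_cast; ring
  rw [h κ₁, h κ₂, mul_div_assoc]

lemma gau_tendsto (lam : ℂ) (f : ℝ × ℝ → ℂ) :
    Filter.Tendsto f (Filter.cocompact (ℝ × ℝ)) (nhds 0) ↔ Filter.Tendsto (gau lam f) (Filter.cocompact (ℝ × ℝ)) (nhds 0) := by
  have hn : ∀ y, ‖gau lam f y‖ = ‖f (shr (-lam.re) y)‖ := fun y => by
    unfold gau; rw [norm_mul, ee_norm, one_mul]
  rw [tendsto_zero_iff_norm_tendsto_zero, tendsto_zero_iff_norm_tendsto_zero (f := gau lam f)]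
  simp_rw [hn]
  constructor
  · intro h
    exact h.comp (shrH (-lam.re)).isClosedEmbedding.tendsto_cocompact
  · intro h
    have := h.comp (shrH lam.re).isClosedEmbedding.tendsto_cocompact
    refine this.congr fun x => ?_
    change ‖f (shr (-lam.re) (shr lam.re x))‖ = _
    rw [shr_inv']

lemma gau_cont {lam : ℂ} {m : ℝ × ℝ → ℂ} (hm : Continuous m) : Continuous (gau lam m) :=
  (ee_sm _).continuous.mul (hm.comp (shr_cont _))

def ung (lam : ℂ) (M : ℝ × ℝ → ℂ) (x : ℝ × ℝ) : ℂ := ee (-lam.im) (shr lam.re x) * M (shr lam.re x)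

lemma gau_ung (lam : ℂ) (M : ℝ × ℝ → ℂ) : gau lam (ung lam M) = M := by
  ext y; unfold gau ung; rw [shr_inv, ← mul_assoc, mul_comm (ee lam.im _), ee_inv, one_mul]

lemma WSol.sub {b : ℝ} {U : ℝ × ℝ → ℝ} (hU : Continuous U) {f g : ℝ × ℝ → ℂ} (hf : Continuous f) (hg : Continuous g)
    (h1 : WSol b U f) (h2 : WSol b U g) : WSol b U (fun x => f x - g x) := fun φ hφ hc => by
  simp only [sub_mul]
  rw [integral_sub (cs_int hf (Hs_cont hU hφ) (Hs_cs hφ hc)) (cs_int hg (Hs_cont hU hφ) (Hs_cs hφ hc)),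
    h1 φ hφ hc, h2 φ hφ hc, sub_zero]

theorem main_aux
    (κ₁ κ₂ a : ℝ) (hκ : κ₁ < κ₂) (ha : 0 < a) (d : ℕ) :
    ∃ ε : ℝ, 0 < ε ∧
      ∀ v₀ : ℝ × ℝ → ℝ, ContDiff ℝ ((d : ℕ∞) + 8) v₀ →
        (∑ l ∈ (Finset.range (d + 9) ×ˢ Finset.range (d + 9)).filter
            (fun l => l.1 + l.2 ≤ d + 8), wL1Linf (pdIter l v₀)) ≤ ENNReal.ofReal ε →
        ∀ lam : ℂ, lam ≠ 0 → lam ≠ (κ₁ : ℂ) → lam ≠ (κ₂ : ℂ) →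
          ∃! m : ℝ × ℝ → ℂ,
            Continuous m ∧ (∃ B : ℝ, ∀ x, ‖m x‖ ≤ B)
            ∧ IsDistribLaxSol (fun x => us κ₁ κ₂ a x + v₀ x) lam m
            ∧ Filter.Tendsto (fun x : ℝ × ℝ => m x - chi κ₁ κ₂ a x lam)
                (Filter.cocompact (ℝ × ℝ)) (nhds 0) := by
  set K := 1 + 49 * (κ₂ - κ₁) with hK
  have hKp : 0 < K := by linarith
  have hC := CC_pos
  refine ⟨1 / (4 * K * CC), by positivity, fun v₀ hv hsum lam hl0 hl1 hl2 => ?_⟩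
  set ε := 1 / (4 * K * CC) with hε
  have hε0 : 0 < ε := by positivity
  have hw : wL1Linf v₀ ≤ ENNReal.ofReal ε := by
    refine le_trans ?_ hsum
    have h0 : pdIter (0, 0) v₀ = v₀ := rfl
    have hmem : ((0, 0) : ℕ × ℕ) ∈ (Finset.range (d + 9) ×ˢ Finset.range (d + 9)).filter (fun l => l.1 + l.2 ≤ d + 8) := by
      simp
    have := Finset.single_le_sum (N := ℝ≥0∞) (f := fun l => wL1Linf (pdIter l v₀)) (fun _ _ => zero_le) hmem
    simp only [h0] at this
    exact this
  have hV := (vsm_of hv.continuous hε0.le hw).shear (-lam.re)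
  have hδ : 2 * K * (CC * ε) ≤ 1 / 2 := by rw [hε]; apply le_of_eq; field_simp; norm_num
  set k1 := κ₁ - lam.re with hk1
  set k2 := κ₂ - lam.re with hk2
  set l := Real.log a with hl
  set b := |lam.im| with hb
  have hb0 : 0 ≤ b := abs_nonneg _
  have hk : k1 < k2 := by linarith
  have hn : ∀ κ : ℝ, lam ≠ κ → κ - lam.re = 0 → 0 < b := fun κ h1 h2 => by
    refine abs_pos.2 fun h3 => h1 (Complex.ext ?_ ?_)
    · simp; linarith
    · simpa using h3
  have hG : Ker (GG k1 k2 l b) K := by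
    have := GG_ker hk.le hb0 (hn κ₁ hl1) (hn κ₂ hl2) l
    have e : 1 + 49 * (k2 - k1) = K := by rw [hK, hk1, hk2]; ring
    rwa [e] at this
  have hfund : ∀ φ : ℝ × ℝ → ℂ, Sm φ → HasCompactSupport φ → ∀ x', ∫ x, (GG k1 k2 l b x x' : ℂ) * Hs b (uu k1 k2 l) φ x = - φ x' :=
    fun φ hφ hc x' => fund hb0 hG hφ hc x'
  have hUc := uu_cont k1 k2 l
  have hpot : (fun y => us κ₁ κ₂ a (shr (-lam.re) y) + v₀ (shr (-lam.re) y))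
      = fun y => uu k1 k2 l y + v₀ (shr (-lam.re) y) := by
    ext y; rw [gau_us ha]
  have hUVc : Continuous (fun y => uu k1 k2 l y + v₀ (shr (-lam.re) y)) := hUc.add hV.cont
  have hch : gau lam (fun x => chi κ₁ κ₂ a x lam) = ch0 k1 k2 l lam.im lam := funext fun y => gau_chi ha hl0 y
  have hdiff : ∀ f g : ℝ × ℝ → ℂ, gau lam (fun x => f x - g x) = fun y => gau lam f y - gau lam g y := fun f g => by
    ext y; unfold gau; ring
  obtain ⟨B, hB⟩ := ch0_bdd k1 k2 l lam.im lam
  obtain ⟨cs, cl⟩ := ch0_sol k1 k2 l lam.im b (sq_abs _) lam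
  obtain ⟨M, Mc, ⟨BM, hBM⟩, Ms, Mt⟩ := abs_exists hUc hG hfund hV hδ cs.continuous hB
    (fun φ hφ hc => weak_all hUc cs hφ hc cl)
  refine ⟨ung lam M, ⟨?_, ⟨BM, fun x => ?_⟩, ?_, ?_⟩, ?_⟩
  · exact ((ee_sm _).continuous.comp (shr_cont _)).mul (Mc.comp (shr_cont _))
  · unfold ung; rw [norm_mul, ee_norm, one_mul]; exact hBM _
  · rw [gau_wsol, gau_ung, hpot]; exact Ms
  · rw [gau_tendsto lam, hdiff, gau_ung, hch]; exact Mt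
  · rintro m' ⟨mc, ⟨B', hB'⟩, ms, mt⟩
    rw [gau_wsol, hpot] at ms
    rw [gau_tendsto lam, hdiff, hch] at mt
    have ht : Filter.Tendsto (fun y => gau lam m' y - M y) (Filter.cocompact (ℝ × ℝ)) (nhds 0) := by
      have := mt.sub Mt
      rw [sub_zero] at this
      exact this.congr fun y => by ring
    have hz := abs_unique hUc hG hfund hV hδ (fun h hc hB hs ht => liouville hk hb0 h hc hB hs ht)
      (w := fun y => gau lam m' y - M y) ((gau_cont mc).sub Mc) (B := B' + BM)
      (fun y => (norm_sub_le _ _).trans (add_le_add (by unfold gau; rw [norm_mul, ee_norm, one_mul]; exact hB' _) (hBM y)))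
      (WSol.sub hUVc (gau_cont mc) Mc ms Ms) ht
    ext x
    have := hz (shr lam.re x)
    simp only [gau, shr_inv'] at this
    unfold ung
    rw [← sub_eq_zero.1 this, ← mul_assoc, ee_inv, one_mul]

end Part24

/-- Direct scattering for perturbed KP 1-line solitons: unique existence of a bounded
continuous eigenfunction with boundary value the Sato normalized eigenfunction. -/
theorem direct_scattering_perturbed_one_soliton
    (κ₁ κ₂ a : ℝ) (hκ : κ₁ < κ₂) (ha : 0 < a) (d : ℕ) :
    ∃ ε : ℝ, 0 < ε ∧
      ∀ v₀ : ℝ × ℝ → ℝ, ContDiff ℝ ((d : ℕ∞) + 8) v₀ →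
        (∑ l ∈ (Finset.range (d + 9) ×ˢ Finset.range (d + 9)).filter
            (fun l => l.1 + l.2 ≤ d + 8), wL1Linf (pdIter l v₀)) ≤ ENNReal.ofReal ε →
        ∀ lam : ℂ, lam ≠ 0 → lam ≠ (κ₁ : ℂ) → lam ≠ (κ₂ : ℂ) →
          ∃! m : ℝ × ℝ → ℂ,
            Continuous m ∧ (∃ B : ℝ, ∀ x, ‖m x‖ ≤ B)
            ∧ IsDistribLaxSol (fun x => us κ₁ κ₂ a x + v₀ x) lam m
            ∧ Filter.Tendsto (fun x : ℝ × ℝ => m x - chi κ₁ κ₂ a x lam)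
                (Filter.cocompact (ℝ × ℝ)) (nhds 0) := by
  exact main_aux κ₁ κ₂ a hκ ha d
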